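/- arXiv:1112.5942 — 3 statements merged into one kernel-verified Lean document; each statement's English description precedes it below -/
import Mathlib

section
/- If X₁, …, Xₙ are compact subsets of ℝⁿ, each of which has convex (interval) image under every linear functional ℝⁿ → ℝ, and X = X₁ ∪ ⋯ ∪ Xₙ, then every point of conv X is a convex combination of at most n points of X. -/
open Finset

/-- `convComb k X`: points expressible as a convex combination of at most `k` points of `X`. -/
def convComb {n : ℕ} (k : ℕ) (X : Set (EuclideanSpace ℝ (Fin n))) :
    Set (EuclideanSpace ℝ (Fin n)) :=
  {p | ∃ (t : Fin k → ℝ) (x : Fin k → EuclideanSpace ℝ (Fin n)),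
    (∀ i, 0 ≤ t i) ∧ (∀ i, x i ∈ X) ∧ ∑ i, t i = 1 ∧ ∑ i, t i • x i = p}

/-- If `p` is not a combination of `n` points, any relation with `n+1` points has positive weights. -/
lemma hr_pos {n : ℕ} {X : Set (EuclideanSpace ℝ (Fin n))} {p : EuclideanSpace ℝ (Fin n)}
    (hp : p ∉ convComb n X) (y : Fin (n+1) → EuclideanSpace ℝ (Fin n)) (hy : ∀ i, y i ∈ X)
    (a : Fin (n+1) → ℝ) (ha : ∀ i, 0 ≤ a i) (hs : 0 < ∑ i, a i)
    (h0 : ∑ i, a i • (y i - p) = 0) : ∀ i, 0 < a i := by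
  intro j
  by_contra hj
  have hj0 : a j = 0 := le_antisymm (not_lt.mp hj) (ha j)
  apply hp
  rw [Fin.sum_univ_succAbove _ j, hj0] at hs h0
  simp only [zero_add, zero_smul] at hs h0
  set S := ∑ i, a (j.succAbove i) with hS
  refine ⟨fun i => S⁻¹ * a (j.succAbove i), fun i => y (j.succAbove i), ?_, ?_, ?_, ?_⟩
  · intro i
    have := ha (j.succAbove i)
    positivity
  · intro i; exact hy _
  · rw [← Finset.mul_sum, ← hS]
    exact inv_mul_cancel₀ hs.ne'
  · simp only [smul_sub, Finset.sum_sub_distrib, ← Finset.sum_smul] at h0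
    rw [← hS, sub_eq_zero] at h0
    simp only [mul_smul, ← Finset.smul_sum]
    rw [h0, smul_smul, inv_mul_cancel₀ hs.ne', one_smul]

lemma hr_shift {m : ℕ} (t β : Fin (m+1) → ℝ) (ht : ∀ i, 0 < t i) :
    ∃ (s : ℝ) (j : Fin (m+1)), (∀ i, 0 ≤ s * t i - β i) ∧ s * t j - β j = 0 := by
  obtain ⟨j, hj⟩ := Finite.exists_max (fun i => β i / t i)
  refine ⟨β j / t j, j, ?_, ?_⟩
  · intro i
    have h1 := hj i
    have h2 := ht i
    have h3 : β i ≤ β j / t j * t i := (div_le_iff₀ h2).mp h1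
    linarith
  · have := (ht j).ne'
    field_simp
    ring

lemma hr_indep_aux {n : ℕ} {X : Set (EuclideanSpace ℝ (Fin n))} {p : EuclideanSpace ℝ (Fin n)}
    (hp : p ∉ convComb n X) (y : Fin (n+1) → EuclideanSpace ℝ (Fin n)) (hy : ∀ i, y i ∈ X)
    (t : Fin (n+1) → ℝ) (ht : ∀ i, 0 < t i)
    (h0 : ∑ i, t i • (y i - p) = 0) (β : Fin (n+1) → ℝ) (j1 : Fin (n+1)) (hβ : β j1 = 0)
    (hb : ∑ i, β i • (y i - p) = 0) : ∀ i, β i ≤ 0 := by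
  obtain ⟨s, j, h1, h2⟩ := hr_shift t β ht
  have hs0 : 0 ≤ s := by
    have := h1 j1
    rw [hβ, sub_zero] at this
    exact nonneg_of_mul_nonneg_left this (ht j1)
  rcases hs0.eq_or_lt with hs | hs
  · intro i
    have := h1 i
    rw [← hs] at this
    linarith
  · exfalso
    have hpos := hr_pos hp y hy (fun i => s * t i - β i) h1 ?_ ?_ j
    · simp only [h2, lt_irrefl] at hpos
    · apply Finset.sum_pos' (fun i _ => h1 i)
      refine ⟨j1, Finset.mem_univ _, ?_⟩
      rw [hβ, sub_zero]
      exact mul_pos hs (ht j1)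
    · simp only [sub_smul, Finset.sum_sub_distrib, mul_smul, ← Finset.smul_sum] at *
      rw [h0, hb]; simp

lemma hr_indep {n : ℕ} {X : Set (EuclideanSpace ℝ (Fin n))} {p : EuclideanSpace ℝ (Fin n)}
    (hp : p ∉ convComb n X) (y : Fin (n+1) → EuclideanSpace ℝ (Fin n)) (hy : ∀ i, y i ∈ X)
    (t : Fin (n+1) → ℝ) (ht : ∀ i, 0 < t i)
    (h0 : ∑ i, t i • (y i - p) = 0) (j1 : Fin (n+1)) :
    LinearIndependent ℝ (fun k : Fin n => y (j1.succAbove k) - p) := by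
  rw [Fintype.linearIndependent_iff]
  intro g hg k
  set β : Fin (n+1) → ℝ := j1.insertNth 0 g with hβ
  have hb1 : β j1 = 0 := by simp [hβ]
  have hbk : ∀ k, β (j1.succAbove k) = g k := by simp [hβ]
  have hb : ∑ i, β i • (y i - p) = 0 := by
    rw [Fin.sum_univ_succAbove _ j1, hb1]
    simp only [hbk, hg]
    simp
  have h1 := hr_indep_aux hp y hy t ht h0 β j1 hb1 hb (j1.succAbove k)
  have h2 := hr_indep_aux hp y hy t ht h0 (fun i => -β i) j1 (by simp [hb1])
    (by simp [hb]) (j1.succAbove k)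
  rw [hbk] at h1
  simp only [hbk] at h2
  linarith

lemma hr_main {n : ℕ} {X Y : Set (EuclideanSpace ℝ (Fin n))} {p : EuclideanSpace ℝ (Fin n)}
    (hX : IsCompact X) (hY : IsCompact Y) (hYX : Y ⊆ X)
    (hconv : ∀ f : EuclideanSpace ℝ (Fin n) →ₗ[ℝ] ℝ, Convex ℝ (f '' Y))
    (hp : p ∉ convComb n X) (z : Fin (n+1) → EuclideanSpace ℝ (Fin n)) (hz : ∀ i, z i ∈ X)
    (w : Fin (n+1) → ℝ) (hw : ∀ i, 0 ≤ w i) (hw1 : ∑ i, w i = 1)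
    (hwz : ∑ i, w i • (z i - p) = 0) (j1 j2 : Fin (n+1)) (hj : j1 ≠ j2)
    (hz1 : z j1 ∈ Y) (hz2 : z j2 ∈ Y) : False := by
  classical
  let V : Set ((Fin (n+1) → EuclideanSpace ℝ (Fin n)) × (Fin (n+1) → ℝ)) :=
    ((Set.univ.pi fun _ => X) ×ˢ stdSimplex ℝ (Fin (n+1))) ∩
      ({q | q.1 j1 ∈ Y} ∩ ({q | q.1 j2 ∈ Y} ∩ {q | ∑ i, q.2 i • (q.1 i - p) = 0}))
  have hVc : IsCompact V := by
    apply IsCompact.inter_right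
    · exact (isCompact_univ_pi fun _ => hX).prod (isCompact_stdSimplex ℝ _)
    · refine (hY.isClosed.preimage (by fun_prop)).inter
        ((hY.isClosed.preimage (by fun_prop)).inter
          (isClosed_eq (by fun_prop) continuous_const))
  have hVpos : ∀ q ∈ V, ∀ i, 0 < q.2 i := by
    rintro q ⟨⟨hq1, hq2⟩, -, -, hq0⟩
    refine hr_pos hp q.1 (fun i => hq1 i trivial) q.2 hq2.1 ?_ hq0
    rw [hq2.2]; exact one_pos
  have hVne : V.Nonempty := ⟨(z, w), ⟨⟨fun i _ => hz i, hw, hw1⟩, hz1, hz2, hwz⟩⟩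
  obtain ⟨q0, hq0, hq0m⟩ := hVc.exists_isMinOn (f := fun q => q.2 j1) hVne (by fun_prop)
  set ε := q0.2 j1 with hε
  have hεpos : 0 < ε := hVpos q0 hq0 j1
  obtain ⟨q, hq, hqm⟩ := hVc.exists_isMinOn
    (f := fun q => (q.2 j1 - ε * (1 - q.2 j1 - q.2 j2)) / q.2 j2) hVne (by
      apply ContinuousOn.div
      · fun_prop
      · fun_prop
      · intro q hq
        exact (hVpos q hq j2).ne')
  have hqpos := hVpos q hq
  obtain ⟨y, t⟩ := q
  have hq' := hq
  obtain ⟨⟨hyX, ht0, ht1⟩, hy1, hy2, hyt⟩ := hq'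
  simp only [Set.mem_ofPred_eq] at hyX ht0 ht1 hy1 hy2 hyt hqpos
  have hyX' : ∀ i, y i ∈ X := fun i => hyX i trivial
  have hεt : ε ≤ t j1 := hq0m hq
  set c := (t j1 - ε * (1 - t j1 - t j2)) / t j2 with hc
  have hcpos : 0 < c := by
    apply div_pos _ (hqpos j2)
    nlinarith [mul_pos hεpos (hqpos j1), mul_pos hεpos (hqpos j2)]
  let φ : Fin (n+1) → ℝ := fun i => if i = j1 then -1 else if i = j2 then c else ε
  have hφ1 : φ j1 = -1 := by simp [φ]
  have hφ2 : φ j2 = c := by simp [φ, hj.symm]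
  have hφpos : ∀ i, i ≠ j1 → 0 < φ i := by
    intro i hi
    simp only [φ, if_neg hi]
    split_ifs <;> assumption
  have hφsum : ∀ a : Fin (n+1) → ℝ,
      ∑ i, a i * φ i = ε * (∑ i, a i - a j1 - a j2) - a j1 + c * a j2 := by
    intro a
    have h : ∀ i, a i * φ i = ε * a i + ((if i = j1 then (-1 - ε) * a i else 0)
        + (if i = j2 then (c - ε) * a i else 0)) := by
      intro i
      by_cases h1 : i = j1
      · subst h1; simp only [hφ1, if_true, if_neg hj]; ring
      · by_cases h2 : i = j2
        · subst h2; simp only [hφ2, if_true, if_neg h1]; ring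
        · simp only [φ, if_neg h1, if_neg h2]; ring
    simp only [h, Finset.sum_add_distrib, ← Finset.mul_sum, Finset.sum_ite_eq',
      Finset.mem_univ, if_true]
    ring
  have htφ : ∑ i, t i * φ i = 0 := by
    rw [hφsum, ht1, hc]
    have := (hqpos j2).ne'
    field_simp
    ring
  -- minimality
  have hmin : ∀ (y' : Fin (n+1) → EuclideanSpace ℝ (Fin n)) (a : Fin (n+1) → ℝ),
      (∀ i, y' i ∈ X) → y' j1 ∈ Y → y' j2 ∈ Y → (∀ i, 0 ≤ a i) → 0 < ∑ i, a i →
      ∑ i, a i • (y' i - p) = 0 → ∑ i, a i * φ i ≤ 0 := by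
    intro y' a h1 h2 h3 h4 h5 h6
    set S := ∑ i, a i with hS
    have hV : (y', fun i => S⁻¹ * a i) ∈ V := by
      refine ⟨⟨fun i _ => h1 i, fun i => ?_, ?_⟩, h2, h3, ?_⟩
      · have := h4 i
        positivity
      · rw [← Finset.mul_sum, ← hS]
        exact inv_mul_cancel₀ h5.ne'
      · simp only [Set.mem_ofPred_eq, mul_smul, ← Finset.smul_sum, h6, smul_zero]
    have h7 : c ≤ (S⁻¹ * a j1 - ε * (1 - S⁻¹ * a j1 - S⁻¹ * a j2)) / (S⁻¹ * a j2) := hqm hV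
    have h8 : 0 < S⁻¹ * a j2 := hVpos _ hV j2
    rw [le_div_iff₀ h8] at h7
    have h9 := mul_le_mul_of_nonneg_left h7 h5.le
    have e : S * S⁻¹ = 1 := mul_inv_cancel₀ h5.ne'
    have e1 : S * (c * (S⁻¹ * a j2)) = c * a j2 := by
      linear_combination (c * a j2) * e
    have e2 : S * (S⁻¹ * a j1 - ε * (1 - S⁻¹ * a j1 - S⁻¹ * a j2))
        = a j1 - ε * (S - a j1 - a j2) := by
      linear_combination (a j1 + ε * a j1 + ε * a j2) * e
    rw [e1, e2] at h9
    rw [hφsum, ← hS]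
    linarith
  -- the functional
  have hli := hr_indep hp y hyX' t hqpos hyt j1
  have : Nonempty (Fin n) := by
    rcases Nat.eq_zero_or_pos n with h | h
    · subst h
      exact absurd (Fin.ext (by omega)) hj
    · exact ⟨⟨0, h⟩⟩
  let B := basisOfLinearIndependentOfCardEqFinrank hli (by simp)
  have hB : ∀ k, B k = y (j1.succAbove k) - p := by
    intro k; simp [B]
  let f : EuclideanSpace ℝ (Fin n) →ₗ[ℝ] ℝ := B.constr ℝ (fun k => φ (j1.succAbove k))
  have hf' : ∀ k, f (y (j1.succAbove k) - p) = φ (j1.succAbove k) := by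
    intro k
    rw [← hB, Module.Basis.constr_basis]
  have hf : ∀ i, f (y i - p) = φ i := by
    intro i
    rcases Fin.eq_self_or_eq_succAbove j1 i with h | ⟨k, h⟩
    · subst h
      have h1 := congrArg f hyt
      rw [map_sum, map_zero] at h1
      simp only [map_smul, smul_eq_mul] at h1
      rw [Fin.sum_univ_succAbove _ i] at h1 htφ
      simp only [hf'] at h1
      have h2 : t i * f (y i - p) = t i * φ i := by linarith
      exact mul_left_cancel₀ (hqpos i).ne' h2
    · rw [h]; exact hf' k
  obtain ⟨x, hxY, hx⟩ : f p ∈ f '' Y := by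
    have h1 : f (y j1) ≤ f p := by
      have := hf j1
      rw [map_sub, hφ1] at this
      linarith
    have h2 : f p ≤ f (y j2) := by
      have := hf j2
      rw [map_sub, hφ2] at this
      linarith
    exact (hconv f).ordConnected.out ⟨_, hy1, rfl⟩ ⟨_, hy2, rfl⟩ ⟨h1, h2⟩
  -- expand x - p
  let β : Fin (n+1) → ℝ := j1.insertNth 0 (fun k => B.repr (x - p) k)
  have hβ : ∑ i, β i • (y i - p) = x - p := by
    rw [Fin.sum_univ_succAbove _ j1]
    simp only [β, Fin.insertNth_apply_same, Fin.insertNth_apply_succAbove, zero_smul, zero_add]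
    conv_rhs => rw [← B.sum_repr (x - p)]
    simp only [hB]
  obtain ⟨s, j, h1, h2⟩ := hr_shift t β hqpos
  let a : Fin (n+1) → ℝ := fun i => s * t i - β i
  have haj : a j = 0 := h2
  have ha : ∑ i, a i • (y i - p) = -(x - p) := by
    simp only [a, sub_smul, Finset.sum_sub_distrib, mul_smul, ← Finset.smul_sum]
    rw [hyt, hβ]; simp
  have haφ : ∑ i, a i * φ i = 0 := by
    have h3 := congrArg f ha
    rw [map_sum, map_neg, map_sub, hx, sub_self, neg_zero] at h3
    simpa only [map_smul, smul_eq_mul, hf] using h3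
  let y' := Function.update y j x
  let a' := Function.update a j 1
  have hy' : ∀ i, y' i ∈ X := by
    intro i
    by_cases h : i = j
    · subst h; simpa [y'] using hYX hxY
    · simpa [y', h] using hyX' i
  have hyY : ∀ i, y i ∈ Y → y' i ∈ Y := by
    intro i hi
    by_cases h : i = j
    · subst h; simpa [y'] using hxY
    · simpa [y', h] using hi
  have ha' : ∀ i, 0 ≤ a' i := by
    intro i
    by_cases h : i = j
    · subst h; simp [a']
    · simp only [a', Function.update_of_ne h]
      exact h1 i
  have ha's : 0 < ∑ i, a' i :=
    Finset.sum_pos' (fun i _ => ha' i) ⟨j, Finset.mem_univ _, by simp [a']⟩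
  have ha'0 : ∑ i, a' i • (y' i - p) = 0 := by
    rw [Fin.sum_univ_succAbove _ j] at ha ⊢
    rw [haj, zero_smul, zero_add] at ha
    simp only [a', y', Function.update_self, Function.update_of_ne (Fin.succAbove_ne j _), ha]
    simp
  have hsum' : ∑ i, a' i * φ i = φ j := by
    rw [Fin.sum_univ_succAbove _ j] at haφ ⊢
    rw [haj, zero_mul, zero_add] at haφ
    simp only [a', Function.update_self, Function.update_of_ne (Fin.succAbove_ne j _), haφ]
    simp
  have hle := hmin y' a' hy' (hyY _ hy1) (hyY _ hy2) ha' ha's ha'0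
  rw [hsum'] at hle
  have hjj : j = j1 := by
    by_contra h
    exact absurd (hφpos j h) (not_lt.mpr hle)
  have hpos' := hr_pos hp y' hy' a' ha' ha's ha'0
  have hpa : 0 < ∑ i, a i * φ i := by
    rw [Fin.sum_univ_succAbove _ j, haj, zero_mul, zero_add]
    apply Finset.sum_pos
    · intro k _
      apply mul_pos
      · have := hpos' (j.succAbove k)
        simpa only [a', Function.update_of_ne (Fin.succAbove_ne j _)] using this
      · apply hφpos
        rw [← hjj]
        exact Fin.succAbove_ne j _
    · exact Finset.univ_nonempty
  rw [haφ] at hpa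
  exact lt_irrefl _ hpa

/-- Hanner–Rådström: if `X` is the union of `n` compact `1`-convex subsets of `ℝⁿ`,
then every point of `conv X` is a convex combination of at most `n` points of `X`. -/
theorem hanner_radstrom {n : ℕ} (X : Fin n → Set (EuclideanSpace ℝ (Fin n)))
    (hcpt : ∀ i, IsCompact (X i))
    (hconv : ∀ i, ∀ f : EuclideanSpace ℝ (Fin n) →ₗ[ℝ] ℝ, Convex ℝ (f '' X i)) :
    convexHull ℝ (⋃ i, X i) ⊆ convComb n (⋃ i, X i) := by
  classical
  intro p hpc
  by_contra hp
  obtain ⟨ι, hι, z, w, hz, hai, hw, hw1, hwz⟩ := eq_pos_convex_span_of_mem_convexHull hpc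
  have hcard : Fintype.card ι ≤ Fintype.card (Fin (n+1)) := by
    have := hai.card_le_finrank_succ
    have h2 := Submodule.finrank_le (vectorSpan ℝ (Set.range z))
    simp only [finrank_euclideanSpace, Fintype.card_fin] at h2 ⊢
    omega
  obtain ⟨e⟩ := Function.Embedding.nonempty_of_card_le hcard
  have hne : Nonempty ι := by
    by_contra h
    rw [not_nonempty_iff] at h
    simp at hw1
  obtain ⟨i0⟩ := hne
  let z' : Fin (n+1) → EuclideanSpace ℝ (Fin n) := Function.extend e z (fun _ => z i0)
  let w' : Fin (n+1) → ℝ := Function.extend e w (fun _ => 0)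
  have hz'e : ∀ i, z' (e i) = z i := fun i => e.injective.extend_apply _ _ _
  have hw'e : ∀ i, w' (e i) = w i := fun i => e.injective.extend_apply _ _ _
  have hz'n : ∀ k, (¬ ∃ i, e i = k) → z' k = z i0 := fun k hk => Function.extend_apply' _ _ _ hk
  have hw'n : ∀ k, (¬ ∃ i, e i = k) → w' k = 0 := fun k hk => Function.extend_apply' _ _ _ hk
  have hz' : ∀ k, z' k ∈ ⋃ i, X i := by
    intro k
    by_cases hk : ∃ i, e i = k
    · obtain ⟨i, rfl⟩ := hk
      rw [hz'e]; exact hz ⟨i, rfl⟩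
    · rw [hz'n k hk]; exact hz ⟨i0, rfl⟩
  have hw' : ∀ k, 0 ≤ w' k := by
    intro k
    by_cases hk : ∃ i, e i = k
    · obtain ⟨i, rfl⟩ := hk
      rw [hw'e]; exact (hw i).le
    · rw [hw'n k hk]
  have hw'1 : ∑ k, w' k = 1 := by
    rw [← hw1]
    symm
    apply Fintype.sum_of_injective e e.injective
    · intro k hk; exact hw'n k hk
    · intro i; exact (hw'e i).symm
  have hwz' : ∑ k, w' k • z' k = p := by
    rw [← hwz]
    symm
    apply Fintype.sum_of_injective e e.injective
    · intro k hk; rw [hw'n k hk, zero_smul]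
    · intro i; rw [hw'e, hz'e]
  have hwz0 : ∑ k, w' k • (z' k - p) = 0 := by
    simp only [smul_sub, Finset.sum_sub_distrib, ← Finset.sum_smul]
    rw [hwz', hw'1, one_smul, sub_self]
  choose col hcol using fun k => Set.mem_iUnion.mp (hz' k)
  obtain ⟨j1, j2, hj, hc⟩ := Fintype.exists_ne_map_eq_of_card_lt col (by simp)
  exact hr_main (isCompact_iUnion hcpt) (hcpt (col j1)) (Set.subset_iUnion X (col j1))
    (hconv (col j1)) hp z' hz' w' hw' hw'1 hwz0 j1 j2 hj (hcol j1) (hc ▸ hcol j2)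
end

section
/- Let 0 ≤ k ≤ n and let X₁, …, X_{n−k} be compact subsets of ℝⁿ. If the point p does not lie in conv_{k+1} X_i for any i (i.e., p is not a convex combination of at most k+1 points of any X_i), then there exists an affine k-dimensional subspace L of ℝⁿ containing p such that L ∩ X_i = ∅ for every i. -/
open Finset

namespace MKF

/-- `0` is a convex combination of the points `q j`, `j ≠ i`. -/
def Hit {ι : Type*} [Fintype ι] {m : ℕ} (q : ι → Fin m → ℝ) (i : ι) : Prop :=
  ∃ l : ι → ℝ, (∀ j, 0 ≤ l j) ∧ ∑ j, l j = 1 ∧ l i = 0 ∧ ∑ j, l j • q j = 0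

/-- every convex combination equal to `0` has at most one vanishing coefficient -/
def Gen {ι : Type*} [Fintype ι] {m : ℕ} (q : ι → Fin m → ℝ) : Prop :=
  ∀ l : ι → ℝ, (∀ j, 0 ≤ l j) → ∑ j, l j = 1 → ∑ j, l j • q j = 0 →
    ∀ i j, l i = 0 → l j = 0 → i = j

lemma move {ι : Type*} [Fintype ι] (l μ : ι → ℝ) (hl : ∀ j, 0 ≤ l j)
    (hμ : ∑ j, μ j = 0) (hne : μ ≠ 0) :
    ∃ t : ℝ, 0 ≤ t ∧ (∀ j, 0 ≤ l j + t * μ j) ∧ ∃ j, μ j < 0 ∧ l j + t * μ j = 0 := by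
  classical
  have hneg : ∃ j, μ j < 0 := by
    by_contra h
    push Not at h
    apply hne
    funext j
    have := (Finset.sum_eq_zero_iff_of_nonneg (fun i _ => h i)).1 hμ j (mem_univ j)
    simpa using this
  obtain ⟨j0, hj0⟩ := hneg
  have hS : (univ.filter (fun j => μ j < 0)).Nonempty := ⟨j0, by simp [hj0]⟩
  obtain ⟨j, hj, hmin⟩ := Finset.exists_min_image _ (fun j => l j / (- μ j)) hS
  simp only [mem_filter, mem_univ, true_and] at hj hmin
  have hjp : 0 < - μ j := by linarith
  refine ⟨l j / (- μ j), div_nonneg (hl j) hjp.le, ?_, j, hj, ?_⟩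
  · intro i
    by_cases hi : μ i < 0
    · have h1 := hmin i hi
      have hip : 0 < - μ i := by linarith
      have h2 : l j / (- μ j) * (- μ i) ≤ l i := by
        calc _ ≤ l i / (- μ i) * (- μ i) := by gcongr
          _ = l i := div_mul_cancel₀ _ hip.ne'
      linarith
    · push Not at hi
      have := mul_nonneg (div_nonneg (hl j) hjp.le) hi
      linarith [hl i]
  · have : μ j ≠ 0 := hj.ne
    field_simp
    ring

lemma parity {ι : Type*} [Fintype ι] {m : ℕ} (hcard : Fintype.card ι = m + 2)
    (q : ι → Fin m → ℝ) (hq : Gen q) [DecidablePred (Hit q)] :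
    Even (univ.filter (fun i => Hit q i)).card := by
  classical
  rcases (univ.filter (fun i => Hit q i)).eq_empty_or_nonempty with h | ⟨i, hi⟩
  · rw [h]; simp
  simp only [mem_filter, mem_univ, true_and] at hi
  obtain ⟨l, l0, l1, li, lq⟩ := hi
  have hpos : ∀ j, j ≠ i → 0 < l j := fun j hj =>
    lt_of_le_of_ne (l0 j) (fun h => hj (hq l l0 l1 lq _ _ h.symm li))
  -- nonzero kernel vectors have nonzero i-th coordinate
  have key : ∀ μ : ι → ℝ, ∑ j, μ j = 0 → ∑ j, μ j • q j = 0 → μ i = 0 → μ = 0 := by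
    intro μ h1 h2 h3
    by_contra hne
    obtain ⟨t, t0, tn, j, hj, hj0⟩ := move l μ l0 h1 hne
    have := hq (fun j => l j + t * μ j) tn
      (by simp [Finset.sum_add_distrib, ← Finset.mul_sum, l1, h1])
      (by simp [add_smul, mul_smul, Finset.sum_add_distrib, ← Finset.smul_sum, lq, h2])
      i j (by simp [li, h3]) hj0
    subst this
    linarith
  obtain ⟨μ, hμ1, hμ2, hμne⟩ : ∃ μ : ι → ℝ, ∑ j, μ j = 0 ∧ ∑ j, μ j • q j = 0 ∧ μ ≠ 0 := by
    let Φ : (ι → ℝ) →ₗ[ℝ] (Fin m → ℝ) × ℝ :=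
      { toFun := fun μ => (∑ j, μ j • q j, ∑ j, μ j)
        map_add' := by intro a b; simp [add_smul, Finset.sum_add_distrib]
        map_smul' := by intro a b; simp [mul_smul, Finset.smul_sum, Finset.mul_sum] }
    have hlt : Module.finrank ℝ ((Fin m → ℝ) × ℝ) < Module.finrank ℝ (ι → ℝ) := by
      simp [hcard]
    obtain ⟨μ, hμ, hne⟩ := (Submodule.ne_bot_iff _).1 (LinearMap.ker_ne_bot_of_finrank_lt (f := Φ) hlt)
    have h := LinearMap.mem_ker.1 hμ
    have h' : (∑ j, μ j • q j, ∑ j, μ j) = ((0, 0) : (Fin m → ℝ) × ℝ) := h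
    rw [Prod.mk.injEq] at h'
    exact ⟨μ, h'.2, h'.1, hne⟩
  wlog hμi : 0 < μ i generalizing μ
  · refine this (-μ) (by simp [hμ1]) (by simp [hμ2]) (by simpa using hμne) ?_
    have : μ i ≠ 0 := fun h => hμne (key μ hμ1 hμ2 h)
    simp only [Pi.neg_apply, Left.neg_pos_iff]
    exact lt_of_le_of_ne (not_lt.1 hμi) this
  obtain ⟨t, t0, tn, j, hj, hj0⟩ := move l μ l0 hμ1 hμne
  have hji : j ≠ i := by rintro rfl; linarith
  have S1 : ∑ j, (l j + t * μ j) = 1 := by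
    simp [Finset.sum_add_distrib, ← Finset.mul_sum, l1, hμ1]
  have S2 : ∑ j, (l j + t * μ j) • q j = 0 := by
    simp [add_smul, mul_smul, Finset.sum_add_distrib, ← Finset.smul_sum, lq, hμ2]
  have hset : univ.filter (fun i => Hit q i) = {i, j} := by
    ext x
    simp only [mem_filter, mem_univ, true_and, mem_insert, mem_singleton]
    constructor
    · rintro ⟨l', l0', l1', lx, lq'⟩
      by_cases hxi : x = i
      · exact Or.inl hxi
      right
      have hi' : 0 < l' i := lt_of_le_of_ne (l0' i)
        (fun h => hxi (hq l' l0' l1' lq' _ _ lx h.symm))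
      set c := l' i / μ i with hc
      have hcpos : 0 < c := div_pos hi' hμi
      have hz : (fun j => l' j - l j - c * μ j) = 0 := by
        apply key
        · simp [Finset.sum_sub_distrib, ← Finset.mul_sum, l1', l1, hμ1]
        · simp [sub_smul, mul_smul, Finset.sum_sub_distrib, ← Finset.smul_sum, lq', lq, hμ2]
        · simp only [li, hc]
          field_simp
          ring
      have hz' : ∀ y, l' y = l y + c * μ y := fun y => by
        have := congrFun hz y
        simp only [Pi.zero_apply] at this
        linarith
      have e1 : c ≤ t := by
        have a := l0' j
        rw [hz'] at a
        have : (t - c) * μ j ≤ 0 := by nlinarith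
        by_contra hh
        push Not at hh
        nlinarith [mul_pos_of_neg_of_neg (sub_neg.2 hh) hj]
      have hx0 : l x + c * μ x = 0 := by rw [← hz', lx]
      have hxpos := hpos x hxi
      have hμx : μ x < 0 := by
        by_contra hh
        push Not at hh
        nlinarith [mul_nonneg hcpos.le hh]
      have e2 : t ≤ c := by
        have a := tn x
        by_contra hh
        push Not at hh
        nlinarith [mul_neg_of_pos_of_neg (sub_pos.2 hh) hμx]
      have e : c = t := le_antisymm e1 e2
      rw [e] at hx0
      exact hq _ tn S1 S2 x j hx0 hj0
    · rintro (rfl | rfl)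
      · exact ⟨l, l0, l1, li, lq⟩
      · exact ⟨_, tn, S1, hj0, S2⟩
  rw [hset, Finset.card_pair hji.symm]
  exact even_two

end MKF


namespace MKF

def Zero {m : ℕ} (q : Fin (m + 1) → Fin m → ℝ) : Prop :=
  ∃ l : Fin (m + 1) → ℝ, (∀ j, 0 ≤ l j) ∧ ∑ j, l j = 1 ∧ ∑ j, l j • q j = 0

open Classical in
noncomputable def cnt {C : Type*} [Fintype C] {m : ℕ} (F : C → Fin (m + 1) → Fin m → ℝ) : ℕ :=
  (univ.filter (fun c => Zero (F c))).card

def mix {m : ℕ} (F G : Fin (m + 1) → Fin m → ℝ) (t : ℕ) : Fin (m + 1) → Fin m → ℝ :=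
  fun s => if (s : ℕ) < t then G s else F s

def mixq {m : ℕ} (F G : Fin (m + 1) → Fin m → ℝ) (t : Fin (m + 1)) :
    Option (Fin (m + 1)) → Fin m → ℝ :=
  fun o => o.elim (G t) (mix F G t)

lemma hit_none {m : ℕ} (F G : Fin (m + 1) → Fin m → ℝ) (t : Fin (m + 1)) :
    Hit (mixq F G t) none ↔ Zero (mix F G t) := by
  constructor
  · rintro ⟨l, l0, l1, ln, lq⟩
    refine ⟨fun s => l (some s), fun s => l0 _, ?_, ?_⟩
    · simpa [Fintype.sum_option, ln] using l1
    · simpa [Fintype.sum_option, ln, mixq] using lq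
  · rintro ⟨l, l0, l1, lq⟩
    refine ⟨fun o => o.elim 0 l, ?_, ?_, rfl, ?_⟩
    · rintro (_ | s)
      · simp
      · simpa using l0 s
    · simpa [Fintype.sum_option] using l1
    · simpa [Fintype.sum_option, mixq] using lq

lemma hit_some {m : ℕ} (F G : Fin (m + 1) → Fin m → ℝ) (t : Fin (m + 1)) :
    Hit (mixq F G t) (some t) ↔ Zero (mix F G (t + 1)) := by
  have hm : ∀ s, s ≠ t → mix F G (t + 1) s = mix F G t s := by
    intro s hs
    have : (s : ℕ) ≠ t := fun h => hs (Fin.ext h)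
    unfold mix
    by_cases h : (s : ℕ) < t
    · simp [h, Nat.lt_succ_of_lt h]
    · have h2 : ¬ (s : ℕ) < t + 1 := by omega
      simp [h, h2]
  have ht : mix F G (t + 1) t = G t := by simp [mix]
  constructor
  · rintro ⟨l, l0, l1, ln, lq⟩
    refine ⟨fun s => if s = t then l none else l (some s), ?_, ?_, ?_⟩
    · intro s
      dsimp only
      split_ifs <;> exact l0 _
    · rw [Fintype.sum_option, ← Finset.add_sum_erase _ _ (mem_univ t), ln, zero_add] at l1
      rw [← Finset.add_sum_erase _ _ (mem_univ t), if_pos rfl, ← l1]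
      congr 1
      exact Finset.sum_congr rfl (fun s hs => if_neg (Finset.ne_of_mem_erase hs))
    · rw [Fintype.sum_option, ← Finset.add_sum_erase _ _ (mem_univ t), ln, zero_smul, zero_add] at lq
      rw [← Finset.add_sum_erase _ _ (mem_univ t)]
      beta_reduce
      rw [if_pos rfl, ← lq]
      congr 1
      · rw [ht]; rfl
      · refine Finset.sum_congr rfl (fun s hs => ?_)
        rw [if_neg (Finset.ne_of_mem_erase hs), hm s (Finset.ne_of_mem_erase hs)]; rfl
  · rintro ⟨l, l0, l1, lq⟩
    refine ⟨fun o => o.elim (l t) (fun s => if s = t then 0 else l s), ?_, ?_, by simp, ?_⟩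
    · rintro (_ | s)
      · simpa using l0 t
      · simp only [Option.elim_some]
        split_ifs
        · exact le_rfl
        · exact l0 s
    · rw [Fintype.sum_option, ← Finset.add_sum_erase _ _ (mem_univ t)]
      rw [← Finset.add_sum_erase _ _ (mem_univ t)] at l1
      rw [← l1]
      simp only [Option.elim_none, Option.elim_some, if_true, zero_add]
      congr 1
      exact Finset.sum_congr rfl (fun s hs => if_neg (Finset.ne_of_mem_erase hs))
    · rw [Fintype.sum_option, ← Finset.add_sum_erase _ _ (mem_univ t)]
      rw [← Finset.add_sum_erase _ _ (mem_univ t)] at lq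
      rw [← lq]
      simp only [Option.elim_none, Option.elim_some, if_true, zero_add, zero_smul]
      congr 1
      · rw [ht]; rfl
      · refine Finset.sum_congr rfl (fun s hs => ?_)
        rw [if_neg (Finset.ne_of_mem_erase hs), hm s (Finset.ne_of_mem_erase hs)]; rfl

lemma even_of_invol {C : Type*} [Fintype C] (I : C → C) (hinv : ∀ c, I (I c) = c)
    (hfp : ∀ c, I c ≠ c) (p : C → Prop) [DecidablePred p] (hp : ∀ c, p c → p (I c)) :
    ((univ.filter p).card : ZMod 2) = 0 := by
  classical
  rw [Finset.card_eq_sum_ones, Nat.cast_sum]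
  refine Finset.sum_involution (fun c _ => I c) ?_ ?_ ?_ ?_
  · intro a _; decide
  · intro a _ _; exact hfp a
  · intro a ha
    simp only [mem_filter, mem_univ, true_and] at ha ⊢
    exact hp a ha
  · intro a _; exact hinv a

lemma cnt_step {C : Type*} [Fintype C] {m : ℕ} (I : Fin (m + 1) → C → C)
    (hinv : ∀ s c, I s (I s c) = c) (hfp : ∀ s c, I s c ≠ c)
    (F G : C → Fin (m + 1) → Fin m → ℝ) (t : Fin (m + 1))
    (hgen : ∀ c, Gen (mixq (F c) (G c) t))
    (hI : ∀ s, s ≠ t → ∀ c, Hit (mixq (F c) (G c) t) (some s) →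
      Hit (mixq (F (I s c)) (G (I s c)) t) (some s)) :
    ((cnt fun c => mix (F c) (G c) t : ℕ) : ZMod 2) = (cnt fun c => mix (F c) (G c) (t + 1) : ℕ) := by
  classical
  have h1 : ∑ c, ((univ.filter (fun i => Hit (mixq (F c) (G c) t) i)).card : ZMod 2) = 0 := by
    apply Finset.sum_eq_zero
    intro c _
    have := parity (by simp) _ (hgen c)
    exact (ZMod.natCast_eq_zero_iff_even).2 this
  have h2 : ∑ c, ((univ.filter (fun i => Hit (mixq (F c) (G c) t) i)).card : ZMod 2)
      = ∑ i, ((univ.filter (fun c => Hit (mixq (F c) (G c) t) i)).card : ZMod 2) := by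
    simp only [Finset.card_filter, Nat.cast_sum]
    exact Finset.sum_comm
  rw [h2, Fintype.sum_option, ← Finset.add_sum_erase _ _ (mem_univ t)] at h1
  have h3 : ∑ s ∈ univ.erase t,
      ((univ.filter (fun c => Hit (mixq (F c) (G c) t) (some s))).card : ZMod 2) = 0 := by
    apply Finset.sum_eq_zero
    intro s hs
    exact even_of_invol (I s) (hinv s) (hfp s) _ (hI s (Finset.ne_of_mem_erase hs))
  rw [h3, add_zero] at h1
  unfold cnt
  simp only [hit_none, hit_some] at h1
  have := eq_neg_of_add_eq_zero_left h1
  rw [ZMod.neg_eq_self_mod_two] at this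
  exact this

lemma cnt_eq {C : Type*} [Fintype C] {m : ℕ} (I : Fin (m + 1) → C → C)
    (hinv : ∀ s c, I s (I s c) = c) (hfp : ∀ s c, I s c ≠ c)
    (F G : C → Fin (m + 1) → Fin m → ℝ)
    (hgen : ∀ t c, Gen (mixq (F c) (G c) t))
    (hI : ∀ t s, s ≠ t → ∀ c, Hit (mixq (F c) (G c) t) (some s) →
      Hit (mixq (F (I s c)) (G (I s c)) t) (some s)) :
    ((cnt F : ℕ) : ZMod 2) = (cnt G : ℕ) := by
  have h : ∀ t : ℕ, t ≤ m + 1 → ((cnt F : ℕ) : ZMod 2) = (cnt fun c => mix (F c) (G c) t : ℕ) := by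
    intro t
    induction t with
    | zero =>
      intro _
      have : (fun c => mix (F c) (G c) 0) = F := by
        funext c s; simp [mix]
      rw [this]
    | succ t ih =>
      intro ht
      rw [ih (by omega)]
      exact cnt_step I hinv hfp F G ⟨t, by omega⟩ (hgen _) (hI _)
  rw [h (m + 1) le_rfl]
  have : (fun c => mix (F c) (G c) (m + 1)) = G := by
    funext c s; exact if_pos s.is_lt
  rw [this]

end MKF


namespace MKF

/-- integer valued sign -/
def sg (z : ℤ) : ℤ := if Even z then 1 else -1

lemma sg_add (x y : ℤ) : sg (x + y) = sg x * sg y := by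
  unfold sg
  by_cases hx : Even x <;> by_cases hy : Even y <;> simp [hx, hy, Int.even_add]

lemma sg_zero : sg 0 = 1 := by simp [sg]

lemma sg_sq (x : ℤ) : sg x * sg x = 1 := by
  unfold sg; split_ifs <;> simp

lemma sg_mul_sg (x y : ℤ) : sg (sg x * y) = sg y := by
  unfold sg; split_ifs <;> simp_all [even_neg]

lemma sg_congr {x y : ℤ} (h : Even x ↔ Even y) : sg x = sg y := by
  unfold sg; simp [h]

/-- twisting exponent -/
def tw {m : ℕ} (κ : Fin m → Fin m → ℤ) (a : Fin m → ℤ) (j : Fin m) : ℤ :=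
  ∑ i, if i < j then κ i j * a i else 0

def gam {m : ℕ} (κ : Fin m → Fin m → ℤ) (P : ℤ) (a : Fin m → ℤ) (v : Fin m → ℤ) : Fin m → ℤ :=
  fun j => sg (tw κ a j) * v j + P * a j

lemma tw_zero {m : ℕ} (κ : Fin m → Fin m → ℤ) (j : Fin m) : tw κ 0 j = 0 := by
  simp [tw]

lemma gam_zero {m : ℕ} (κ : Fin m → Fin m → ℤ) (P : ℤ) (v : Fin m → ℤ) : gam κ P 0 v = v := by
  funext j; simp [gam, tw_zero, sg_zero]

lemma tw_single {m : ℕ} (κ : Fin m → Fin m → ℤ) (j i : Fin m) (z : ℤ) :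
    tw κ (Pi.single j z) i = if j < i then κ j i * z else 0 := by
  unfold tw
  rw [Finset.sum_eq_single j]
  · simp
  · intro b _ hb; simp [hb]
  · simp

abbrev Ch (d N : ℕ) := (Fin (d + 1) → Fin (4 * N)) × Equiv.Perm (Fin (d + 1))

def oo (N h : ℕ) : ℤ := 2 * (h / 2 : ℕ) + 1 - 2 * N
def ee (N h : ℕ) : ℤ := 2 * ((h + 1) / 2 : ℕ) - 2 * N

def vert {d N : ℕ} (c : Ch d N) (t : Fin (d + 2)) (j : Fin (d + 1)) : ℤ :=
  if (c.2 j : ℕ) < t then oo N (c.1 j) else ee N (c.1 j)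

def fo {N : ℕ} (h : Fin (4 * N)) : Fin (4 * N) :=
  ⟨if (h : ℕ) % 2 = 0 then h + 1 else h - 1, by split_ifs <;> omega⟩

def fe {N : ℕ} (h : Fin (4 * N)) : Fin (4 * N) :=
  ⟨if (h : ℕ) = 0 then 4 * N - 1 else if (h : ℕ) = 4 * N - 1 then 0 else
    if (h : ℕ) % 2 = 0 then h - 1 else h + 1, by have := h.is_lt; split_ifs <;> omega⟩

lemma fe_cases {N : ℕ} (h : Fin (4 * N)) :
    ((h : ℕ) = 0 ∧ (fe h : ℕ) = 4 * N - 1) ∨ ((h : ℕ) = 4 * N - 1 ∧ (fe h : ℕ) = 0) ∨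
    ((h : ℕ) % 2 = 0 ∧ (h : ℕ) ≠ 0 ∧ (fe h : ℕ) = h - 1) ∨
    ((h : ℕ) % 2 = 1 ∧ (h : ℕ) ≠ 4 * N - 1 ∧ (fe h : ℕ) = h + 1) := by
  have := h.is_lt
  simp only [fe]; split_ifs <;> omega

lemma fo_fo {N : ℕ} (h : Fin (4 * N)) : fo (fo h) = h := by
  apply Fin.ext; simp only [fo]; split_ifs <;> omega
lemma fo_ne {N : ℕ} (h : Fin (4 * N)) : fo h ≠ h := by
  intro e; have := congrArg Fin.val e; simp only [fo] at this; split_ifs at this <;> omega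
lemma fe_fe {N : ℕ} (h : Fin (4 * N)) : fe (fe h) = h := by
  apply Fin.ext; have := h.is_lt
  rcases fe_cases h with h1 | h1 | h1 | h1 <;> rcases fe_cases (fe h) with h2 | h2 | h2 | h2 <;> omega
lemma fe_ne {N : ℕ} (h : Fin (4 * N)) : fe h ≠ h := by
  intro e; have h1 := h.is_lt; have := congrArg Fin.val e; simp only [fe] at this; split_ifs at this <;> omega
lemma oo_fo {N : ℕ} (h : Fin (4 * N)) : oo N (fo h) = oo N h := by
  simp only [oo, fo]; split_ifs <;> omega

def edge {N : ℕ} (h : Fin (4 * N)) : Prop := (h : ℕ) = 0 ∨ (h : ℕ) = 4 * N - 1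

instance {N : ℕ} (h : Fin (4 * N)) : Decidable (edge h) := by unfold edge; infer_instance

lemma edge_fe {N : ℕ} (h : Fin (4 * N)) : edge (fe h) ↔ edge h := by
  have h1 := h.is_lt
  simp only [edge]
  rcases fe_cases h with h1 | h1 | h1 | h1 <;> omega

lemma ee_fe {N : ℕ} (h : Fin (4 * N)) (hh : ¬ edge h) : ee N (fe h) = ee N h := by
  have h1 := h.is_lt
  simp only [edge] at hh
  simp only [ee, fe]; split_ifs <;> omega

def wrapI {d N : ℕ} (κ : Fin (d + 1) → Fin (d + 1) → ℤ) (j : Fin (d + 1))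
    (h : Fin (d + 1) → Fin (4 * N)) : Fin (d + 1) → Fin (4 * N) :=
  fun i => if i = j then fe (h j) else
    if edge (h j) ∧ j < i ∧ ¬ Even (κ j i) then Fin.rev (h i) else h i

lemma wrapI_wrapI {d N : ℕ} (κ : Fin (d + 1) → Fin (d + 1) → ℤ) (j : Fin (d + 1))
    (h : Fin (d + 1) → Fin (4 * N)) : wrapI κ j (wrapI κ j h) = h := by
  funext i
  by_cases hi : i = j
  · subst hi; simp [wrapI, fe_fe]
  · by_cases hc : edge (h j) ∧ j < i ∧ ¬ Even (κ j i)
    · simp [wrapI, hi, edge_fe, hc]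
    · simp only [wrapI, hi, edge_fe, hc, if_true, if_false]

def Iv {d N : ℕ} (κ : Fin (d + 1) → Fin (d + 1) → ℤ) (s : Fin (d + 2)) (c : Ch d N) : Ch d N :=
  if h0 : (s : ℕ) = 0 then
    (Function.update c.1 (c.2.symm 0) (fo (c.1 (c.2.symm 0))), c.2)
  else if hl : (s : ℕ) = d + 1 then
    (wrapI κ (c.2.symm (Fin.last d)) c.1, c.2)
  else
    (c.1, c.2.trans (Equiv.swap ⟨s - 1, by omega⟩ ⟨s, by omega⟩))

lemma Iv_Iv {d N : ℕ} (κ : Fin (d + 1) → Fin (d + 1) → ℤ) (s : Fin (d + 2)) (c : Ch d N) :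
    Iv κ s (Iv κ s c) = c := by
  by_cases h0 : (s : ℕ) = 0
  · simp only [Iv, h0, dite_true]
    simp [fo_fo]
  by_cases hl : (s : ℕ) = d + 1
  · have hI : ∀ c : Ch d N, Iv κ s c = (wrapI κ (c.2.symm (Fin.last d)) c.1, c.2) := by
      intro c; unfold Iv; rw [dif_neg h0, dif_pos hl]
    simp [hI, wrapI_wrapI]
  · simp only [Iv, h0, hl, dite_false]
    refine Prod.ext rfl ?_
    ext x
    simp

lemma Iv_ne {d N : ℕ} (κ : Fin (d + 1) → Fin (d + 1) → ℤ) (s : Fin (d + 2)) (c : Ch d N) :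
    Iv κ s c ≠ c := by
  intro e
  by_cases h0 : (s : ℕ) = 0
  · simp only [Iv, h0, dite_true] at e
    have := congrFun (congrArg Prod.fst e) (c.2.symm 0)
    simp only [Function.update_self] at this
    exact fo_ne _ this
  by_cases hl : (s : ℕ) = d + 1
  · have e1 := congrFun (congrArg Prod.fst e) (c.2.symm (Fin.last d))
    unfold Iv at e1
    rw [dif_neg h0, dif_pos hl] at e1
    simp [wrapI] at e1
    exact fe_ne _ e1
  · simp only [Iv, h0, hl, dite_false] at e
    have e1 := congrArg (fun c : Ch d N => c.2) e
    have := congrArg (fun p : Equiv.Perm (Fin (d + 1)) => (p (c.2.symm ⟨s, by omega⟩) : ℕ)) e1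
    simp at this
    omega

lemma vert_Iv {d N : ℕ} (κ : Fin (d + 1) → Fin (d + 1) → ℤ) (s : Fin (d + 2)) (c : Ch d N) :
    ∃ a : Fin (d + 1) → ℤ, (∀ t, t ≠ s → vert (Iv κ s c) t = gam κ (4 * N) a (vert c t)) ∧
      (a = 0 ∨ ∃ j, ∀ t, t ≠ s → |vert c t j| = 2 * N) := by
  by_cases h0 : (s : ℕ) = 0
  · refine ⟨0, ?_, Or.inl rfl⟩
    intro t ht
    have ht0 : 0 < (t : ℕ) := Nat.pos_of_ne_zero (fun h => ht (Fin.ext (h.trans h0.symm)))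
    rw [gam_zero]
    funext j
    simp only [Iv, h0, dite_true, vert]
    by_cases hj : j = c.2.symm 0
    · subst hj; simp [ht0, oo_fo]
    · simp [hj]
  by_cases hl : (s : ℕ) = d + 1
  · have htl : ∀ t, t ≠ s → (t : ℕ) ≤ d := by
      intro t ht
      have : (t : ℕ) ≠ s := fun h => ht (Fin.ext h)
      have := t.is_lt
      omega
    set j := c.2.symm (Fin.last d) with hjdef
    have hcj : ((c.2 j : Fin (d + 1)) : ℕ) = d := by simp [hjdef]
    have hI : Iv κ s c = (wrapI κ j c.1, c.2) := by
      unfold Iv; rw [dif_neg h0, dif_pos hl]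
    rw [hI]
    by_cases he : edge (c.1 j)
    · refine ⟨Pi.single j (if (c.1 j : ℕ) = 0 then 1 else -1), ?_, Or.inr ⟨j, ?_⟩⟩
      · intro t ht
        have ht' := htl t ht
        funext i
        unfold gam
        rw [tw_single]
        by_cases hi : i = j
        · subst hi
          have hn : ¬ ((c.2 j : Fin (d + 1)) : ℕ) < t := by omega
          simp only [vert, hn, if_false, wrapI, if_true, lt_irrefl, sg_zero, Pi.single_eq_same]
          have := (c.1 j).is_lt
          simp only [edge] at he
          simp only [ee, fe]
          split_ifs <;> omega
        · simp only [vert, wrapI, hi, if_false, he, true_and, ne_eq, not_false_eq_true,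
            Pi.single_eq_of_ne, mul_zero, add_zero]
          have hlt := (c.1 i).is_lt
          by_cases hji : j < i
          · by_cases hk : Even (κ j i)
            · have : sg (κ j i * if (c.1 j : ℕ) = 0 then 1 else -1) = 1 := by
                unfold sg; rw [if_pos (hk.mul_right _)]
              simp only [hji, hk, if_true, this, not_true, and_false, if_false, one_mul]
            · have : sg (κ j i * if (c.1 j : ℕ) = 0 then 1 else -1) = -1 := by
                unfold sg; rw [if_neg]
                split_ifs <;> simpa [even_neg] using hk
              simp only [hji, hk, if_true, this, not_false_eq_true, and_self]
              simp only [oo, ee, Fin.val_rev]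
              split_ifs <;> omega
          · simp [hji, sg_zero]
      · intro t ht
        have ht' := htl t ht
        have hn : ¬ ((c.2 j : Fin (d + 1)) : ℕ) < t := by omega
        simp only [vert, hn, if_false, ee]
        have := (c.1 j).is_lt
        simp only [edge] at he
        rw [abs_eq (by positivity)]
        omega
    · refine ⟨0, ?_, Or.inl rfl⟩
      intro t ht
      have ht' := htl t ht
      rw [gam_zero]
      funext i
      by_cases hi : i = j
      · subst hi
        have hn : ¬ ((c.2 j : Fin (d + 1)) : ℕ) < t := by omega
        simp only [vert, hn, if_false, wrapI, if_true]
        exact ee_fe _ he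
      · simp [vert, wrapI, hi, he]
  · refine ⟨0, ?_, Or.inl rfl⟩
    intro t ht
    have hts : (t : ℕ) ≠ s := fun h => ht (Fin.ext h)
    rw [gam_zero]
    funext j
    have key : ∀ x : Fin (d + 1), ((Equiv.swap (⟨s - 1, by omega⟩ : Fin (d + 1)) ⟨s, by omega⟩ x :
        Fin (d + 1)) : ℕ) < t ↔ (x : ℕ) < t := by
      intro x
      rw [Equiv.swap_apply_def]
      split_ifs with h1 h2
      · subst h1; simp; omega
      · subst h2; simp; omega
      · rfl
    simp only [vert, Iv, h0, hl, dite_false, Equiv.trans_apply, key]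

end MKF


namespace MKF

lemma vert_near {d N : ℕ} (c : Ch d N) (s t : Fin (d + 2)) (j : Fin (d + 1)) :
    |vert c s j - vert c t j| ≤ 1 := by
  rw [abs_le]
  simp only [vert, oo, ee]
  split_ifs <;> omega

lemma vert_le {d N : ℕ} (c : Ch d N) (t : Fin (d + 2)) (j : Fin (d + 1)) :
    |vert c t j| ≤ 2 * N := by
  have := (c.1 j).is_lt
  rw [abs_le]
  simp only [vert, oo, ee]
  split_ifs <;> omega

lemma vert_inj {d N : ℕ} (c : Ch d N) {s t : Fin (d + 2)} (h : vert c s = vert c t) : s = t := by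
  wlog hst : s ≤ t generalizing s t
  · exact (this h.symm (le_of_not_ge hst)).symm
  by_contra hne
  have hlt : (s : ℕ) < t := lt_of_le_of_ne hst (fun h => hne (Fin.ext h))
  have h1 := congrFun h (c.2.symm ⟨s, by omega⟩)
  simp [vert, hlt, oo, ee] at h1
  omega

/-! ### the group -/

lemma tw_parity {m : ℕ} (κ : Fin m → Fin m → ℤ) {a b : Fin m → ℤ}
    (h : ∀ i, Even (a i) ↔ Even (b i)) (j : Fin m) : Even (tw κ a j) ↔ Even (tw κ b j) := by
  have : Even (tw κ a j - tw κ b j) := by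
    unfold tw
    rw [← Finset.sum_sub_distrib]
    apply Finset.even_sum
    intro i _
    split_ifs
    · rw [← mul_sub]; exact ((Int.even_sub).2 (h i)).mul_left _
    · simp
  exact Int.even_sub.1 this

lemma tw_add {m : ℕ} (κ : Fin m → Fin m → ℤ) (a b : Fin m → ℤ) (j : Fin m) :
    tw κ (a + b) j = tw κ a j + tw κ b j := by
  unfold tw
  rw [← Finset.sum_add_distrib]
  refine Finset.sum_congr rfl (fun i _ => ?_)
  split_ifs
  · simp [mul_add]
  · simp

def comp {m : ℕ} (κ : Fin m → Fin m → ℤ) (a b : Fin m → ℤ) : Fin m → ℤ :=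
  fun j => sg (tw κ a j) * b j + a j

lemma even_sg_mul (x y : ℤ) : Even (sg x * y) ↔ Even y := by
  unfold sg; split_ifs <;> simp

lemma comp_parity {m : ℕ} (κ : Fin m → Fin m → ℤ) (a b : Fin m → ℤ) (i : Fin m) :
    Even (comp κ a b i) ↔ Even ((a + b) i) := by
  simp only [comp, Pi.add_apply, Int.even_add, even_sg_mul]
  tauto

lemma gam_comp {m : ℕ} (κ : Fin m → Fin m → ℤ) (P : ℤ) (a b v : Fin m → ℤ) :
    gam κ P a (gam κ P b v) = gam κ P (comp κ a b) v := by
  funext j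
  have : sg (tw κ (comp κ a b) j) = sg (tw κ a j) * sg (tw κ b j) := by
    rw [← sg_add, ← tw_add]
    exact sg_congr (tw_parity κ (comp_parity κ a b) j)
  simp only [gam, this, comp]
  ring

def ginv {m : ℕ} (κ : Fin m → Fin m → ℤ) (a : Fin m → ℤ) : Fin m → ℤ :=
  fun j => - (sg (tw κ a j) * a j)

lemma comp_ginv {m : ℕ} (κ : Fin m → Fin m → ℤ) (a : Fin m → ℤ) : comp κ a (ginv κ a) = 0 := by
  funext j
  simp only [comp, ginv, Pi.zero_apply]
  have := sg_sq (tw κ a j)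
  linear_combination (- a j) * this

lemma ginv_comp {m : ℕ} (κ : Fin m → Fin m → ℤ) (a : Fin m → ℤ) : comp κ (ginv κ a) a = 0 := by
  funext j
  have h : sg (tw κ (ginv κ a) j) = sg (tw κ a j) :=
    sg_congr (tw_parity κ (fun i => by simp [ginv, even_sg_mul]) j)
  simp only [comp, h, Pi.zero_apply]
  simp [ginv]

lemma gam_near {m : ℕ} (κ : Fin m → Fin m → ℤ) (P : ℤ) (hP : 1 < P) (a v : Fin m → ℤ)
    (h : ∀ j, |gam κ P a v j - v j| ≤ 1) : a = 0 := by
  have key : ∀ n : ℕ, ∀ j : Fin m, (j : ℕ) = n → a j = 0 := by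
    intro n
    induction n using Nat.strong_induction_on with
    | _ n ih =>
      intro j hj
      have htw : tw κ a j = 0 := by
        unfold tw
        apply Finset.sum_eq_zero
        intro i _
        split_ifs with hij
        · rw [ih i (by rw [← hj]; exact hij) i rfl]; simp
        · rfl
      have h1 := h j
      simp only [gam, htw, sg_zero, one_mul, add_sub_cancel_left] at h1
      by_contra hne
      have h2 : 1 ≤ |a j| := Int.one_le_abs hne
      rw [abs_mul, abs_of_pos (by omega : 0 < P)] at h1
      nlinarith
  funext j
  exact key j j rfl

/-- orbits -/
def orb {m : ℕ} (κ : Fin m → Fin m → ℤ) (P : ℤ) : Setoid (Fin m → ℤ) where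
  r u v := ∃ a, v = gam κ P a u
  iseqv :=
    { refl := fun u => ⟨0, (gam_zero κ P u).symm⟩
      symm := by
        rintro u v ⟨a, rfl⟩
        exact ⟨ginv κ a, by rw [gam_comp, ginv_comp, gam_zero]⟩
      trans := by
        rintro u v w ⟨a, rfl⟩ ⟨b, rfl⟩
        exact ⟨comp κ b a, by rw [gam_comp]⟩ }

lemma gam_inj {m : ℕ} (κ : Fin m → Fin m → ℤ) (P : ℤ) (hP : 1 < P) (a b v : Fin m → ℤ)
    (h : gam κ P a v = gam κ P b v) : a = b := by
  have h1 : comp κ (ginv κ b) a = 0 := by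
    apply gam_near κ P hP _ v
    intro j
    rw [← gam_comp, h, gam_comp, ginv_comp, gam_zero]; simp
  funext j
  have h2 := congrFun h1 j
  have h : sg (tw κ (ginv κ b) j) = sg (tw κ b j) :=
    sg_congr (tw_parity κ (fun i => by simp [ginv, even_sg_mul]) j)
  simp only [comp, h, ginv, Pi.zero_apply] at h2
  have h3 := sg_sq (tw κ b j)
  linear_combination (sg (tw κ b j)) * h2 - (a j - b j) * h3

/-- the sign character -/
def chr {m : ℕ} (δ : Fin m → Fin m → ℤ) (a : Fin m → ℤ) (l : Fin m) : ℤ :=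
  sg (∑ i, δ i l * a i)

lemma chr_comp {m : ℕ} (κ δ : Fin m → Fin m → ℤ) (a b : Fin m → ℤ) (l : Fin m) :
    chr δ (comp κ a b) l = chr δ a l * chr δ b l := by
  unfold chr
  rw [← sg_add]
  apply sg_congr
  rw [← Int.even_sub, ← Finset.sum_add_distrib, ← Finset.sum_sub_distrib]
  apply Finset.even_sum
  intro i _
  rw [← mul_add, ← mul_sub]
  refine Even.mul_left ?_ _
  exact Int.even_sub.2 (comp_parity κ a b i)

lemma chr_zero {m : ℕ} (δ : Fin m → Fin m → ℤ) (l : Fin m) : chr δ 0 l = 1 := by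
  simp [chr, sg_zero]

/-! ### the linear map -/

noncomputable def c0 (d : ℕ) (j : Fin (d + 1)) : ℝ := ((d : ℝ) + 1 - j) / (d + 2)

lemma c0_pos (d : ℕ) (j : Fin (d + 1)) : 0 < c0 d j := by
  have : (j : ℝ) < d + 1 := by exact_mod_cast j.is_lt
  unfold c0; apply div_pos <;> linarith

lemma c0_lt (d : ℕ) (j : Fin (d + 1)) : c0 d j < 1 := by
  have : (0 : ℝ) ≤ j := by positivity
  unfold c0; rw [div_lt_one (by positivity)]; linarith

lemma c0_anti (d : ℕ) {i j : Fin (d + 1)} (h : i < j) : c0 d j < c0 d i := by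
  have : (i : ℝ) < j := by exact_mod_cast h
  unfold c0; gcongr

def cstar (d N : ℕ) (hN : 0 < N) : Ch d N := (fun _ => ⟨2 * N, by omega⟩, Equiv.refl _)

lemma lin_unique {d N : ℕ} (hN : 0 < N) (c : Ch d N) (l : Fin (d + 2) → ℝ) (l0 : ∀ t, 0 ≤ l t)
    (l1 : ∑ t, l t = 1) (hl : ∀ j, ∑ t, l t * (vert c t j : ℝ) = c0 d j) :
    c = cstar d N hN ∧ ∀ t, l t ≠ 0 := by
  classical
  set Y : Fin (d + 1) → ℝ := fun r => ∑ t : Fin (d + 2), if (r : ℕ) < t then l t else 0 with hY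
  have Y0 : ∀ r, 0 ≤ Y r := fun r => Finset.sum_nonneg (fun t _ => by
    split_ifs
    · exact l0 t
    · exact le_rfl)
  have Y1 : ∀ r, Y r ≤ 1 := fun r => by
    rw [← l1]
    refine Finset.sum_le_sum (fun t _ => ?_)
    split_ifs
    · exact le_rfl
    · exact l0 t
  have Yanti : ∀ r r' : Fin (d + 1), r ≤ r' → Y r' ≤ Y r := fun r r' h => by
    refine Finset.sum_le_sum (fun t _ => ?_)
    have h' : (r : ℕ) ≤ r' := h
    split_ifs
    · exact le_rfl
    · omega
    · exact l0 t
    · exact le_rfl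
  have e : ∀ j, (ee N (c.1 j) : ℝ) + ((oo N (c.1 j) : ℝ) - ee N (c.1 j)) * Y (c.2 j) = c0 d j := by
    intro j
    rw [← hl j, hY]
    simp only
    rw [Finset.mul_sum]
    have : (ee N (c.1 j) : ℝ) = ∑ t, l t * (ee N (c.1 j) : ℝ) := by
      rw [← Finset.sum_mul, l1, one_mul]
    refine (congrArg (fun z : ℝ => z + ∑ i : Fin (d + 2), ((oo N (c.1 j) : ℝ) - ee N (c.1 j)) *
      (if ((c.2 j : Fin (d + 1)) : ℕ) < i then l i else 0)) this).trans ?_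
    rw [← Finset.sum_add_distrib]
    refine Finset.sum_congr rfl (fun t _ => ?_)
    unfold vert
    split_ifs <;> ring
  have hh : ∀ j, (c.1 j : ℕ) = 2 * N ∧ Y (c.2 j) = c0 d j := by
    intro j
    have e1 := e j
    have p0 := c0_pos d j
    have p1 := c0_lt d j
    have q0 := Y0 (c.2 j)
    have q1 := Y1 (c.2 j)
    have hlt := (c.1 j).is_lt
    rcases Nat.even_or_odd' (c.1 j : ℕ) with ⟨x, hx | hx⟩
    · have a1 : ee N (c.1 j) = 2 * x - 2 * N := by simp only [ee]; omega
      have a2 : oo N (c.1 j) = 2 * x + 1 - 2 * N := by simp only [oo]; omega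
      rw [a1, a2] at e1
      push_cast at e1
      have b1 : (2 * x : ℝ) < 2 * N + 1 := by linarith
      have b2 : (2 * N : ℝ) < 2 * x + 1 := by linarith
      have b1' : 2 * x < 2 * N + 1 := by exact_mod_cast b1
      have b2' : 2 * N < 2 * x + 1 := by exact_mod_cast b2
      have : x = N := by omega
      subst this
      exact ⟨hx, by linarith⟩
    · exfalso
      have a1 : ee N (c.1 j) = 2 * x + 2 - 2 * N := by simp only [ee]; omega
      have a2 : oo N (c.1 j) = 2 * x + 1 - 2 * N := by simp only [oo]; omega
      rw [a1, a2] at e1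
      push_cast at e1
      have b1 : (2 * x + 1: ℝ) < 2 * N + 1 := by linarith
      have b2 : (2 * N : ℝ) < 2 * x + 2 := by linarith
      have b1' : 2 * x + 1 < 2 * N + 1 := by exact_mod_cast b1
      have b2' : 2 * N < 2 * x + 2 := by exact_mod_cast b2
      omega
  have hmono : StrictMono c.2 := by
    intro i j hij
    by_contra h
    push Not at h
    have := Yanti _ _ h
    rw [(hh i).2, (hh j).2] at this
    linarith [c0_anti d hij]
  have hid : ∀ j, c.2 j = j := by
    intro j
    have h2 : (hmono.orderIsoOfSurjective _ c.2.surjective) = OrderIso.refl _ := Subsingleton.elim _ _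
    have := congrArg (fun f => f j) h2
    simpa using this
  refine ⟨Prod.ext (funext fun j => Fin.ext (hh j).1) (Equiv.ext hid), ?_⟩
  intro t ht
  have hYc : ∀ j, Y j = c0 d j := fun j => by rw [← (hh j).2, hid]
  by_cases h1 : (t : ℕ) = 0
  · have : Y 0 = 1 := by
      rw [← l1, hY]
      refine Finset.sum_congr rfl (fun s _ => ?_)
      split_ifs with hs
      · rfl
      · have : s = t := Fin.ext (by simp at hs; simp [hs, h1])
        rw [this, ht]
    rw [hYc] at this
    linarith [c0_lt d 0]
  by_cases h2 : (t : ℕ) = d + 1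
  · have : Y (Fin.last d) = 0 := by
      refine Finset.sum_eq_zero (fun s _ => ?_)
      split_ifs with hs
      · have : s = t := Fin.ext (by simp at hs; omega)
        rw [this, ht]
      · rfl
    rw [hYc] at this
    linarith [c0_pos d (Fin.last d)]
  · have : Y ⟨t - 1, by omega⟩ = Y ⟨t, by omega⟩ := by
      refine Finset.sum_congr rfl (fun s _ => ?_)
      simp only
      split_ifs with hs hs' hs'
      · rfl
      · have : s = t := Fin.ext (by omega)
        rw [this, ht]
      · omega
      · rfl
    rw [hYc, hYc] at this
    have := c0_anti d (i := ⟨t - 1, by omega⟩) (j := ⟨t, by omega⟩) (Fin.lt_def.2 (by simp only; omega))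
    linarith

lemma lin_exists {d N : ℕ} (hN : 0 < N) : ∃ l : Fin (d + 2) → ℝ, (∀ t, 0 ≤ l t) ∧ ∑ t, l t = 1 ∧
    ∀ j, ∑ t, l t * (vert (cstar d N hN) t j : ℝ) = c0 d j := by
  refine ⟨fun _ => 1 / (d + 2), fun _ => by positivity, ?_, ?_⟩
  · simp; field_simp
  · intro j
    have hv : ∀ t : Fin (d + 2), (vert (cstar d N hN) t j : ℝ) = if (j : ℕ) < t then 1 else 0 := by
      intro t
      have : vert (cstar d N hN) t j = if (j : ℕ) < t then 1 else 0 := by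
        simp only [vert, cstar, Equiv.refl_apply, oo, ee]
        split_ifs <;> omega
      rw [this]; push_cast; rfl
    simp only [hv]
    rw [← Finset.mul_sum, Finset.sum_boole]
    have : (univ.filter (fun t : Fin (d + 2) => (j : ℕ) < t)).card = d + 1 - j := by
      have : univ.filter (fun t : Fin (d + 2) => (j : ℕ) < t) = Finset.Ioi j.castSucc := by
        ext t; simp [Fin.lt_def]
      rw [this, Fin.card_Ioi]; simp
    rw [this, Nat.cast_sub (by omega)]
    unfold c0; push_cast; ring

end MKF


namespace MKF

lemma avoid {m : ℕ} (S : Set (Submodule ℝ (Fin m → ℝ))) (hS : S.Finite) (hne : ∀ p ∈ S, p ≠ ⊤)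
    (w0 : Fin m → ℝ) (ε : ℝ) (hε : 0 < ε) : ∃ w, ‖w - w0‖ < ε ∧ ∀ p ∈ S, w ∉ p := by
  have hd : Dense (⋂ p ∈ S, ((p : Set (Fin m → ℝ))ᶜ)) := by
    apply dense_biInter_of_isOpen
    · intro p _
      exact (Submodule.closed_of_finiteDimensional p).isOpen_compl
    · exact hS.countable
    · intro p hp
      rw [← interior_eq_empty_iff_dense_compl]
      by_contra h
      exact hne p hp (Submodule.eq_top_of_nonempty_interior' p (Set.nonempty_iff_ne_empty.2 h))
  obtain ⟨w, hw, hd⟩ := hd.exists_dist_lt w0 hε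
  refine ⟨w, by rwa [dist_comm, dist_eq_norm] at hd, ?_⟩
  intro p hp
  simpa using Set.mem_iInter₂.1 hw p hp

def IsSg {m : ℕ} (τ : Fin m → ℝ) : Prop := ∀ l, τ l = 1 ∨ τ l = -1

lemma IsSg.sq {m : ℕ} {τ : Fin m → ℝ} (h : IsSg τ) : τ * τ = 1 := by
  funext l; rcases h l with h | h <;> simp [h]

lemma IsSg.mul {m : ℕ} {τ σ : Fin m → ℝ} (h : IsSg τ) (h' : IsSg σ) : IsSg (τ * σ) := by
  intro l; rcases h l with h | h <;> rcases h' l with h' | h' <;> simp [h, h']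

lemma IsSg.finite (m : ℕ) : {τ : Fin m → ℝ | IsSg τ}.Finite := by
  have : {τ : Fin m → ℝ | IsSg τ} = Set.pi Set.univ (fun _ => ({1, -1} : Set ℝ)) := by
    ext τ; simp [IsSg]
  rw [this]
  exact Set.Finite.pi (fun _ => Set.toFinite _)

lemma gen_exists {Q : Type*} {m : ℕ} (B : Finset (Fin m → ℝ)) (w0 : Q → Fin m → ℝ) (ε : ℝ)
    (hε : 0 < ε) (S : Finset Q) : ∃ w : Q → Fin m → ℝ, (∀ q ∈ S, ‖w q - w0 q‖ < ε) ∧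
      ∀ T : Finset Q, T ⊆ S → ∀ U : Finset (Fin m → ℝ), U ⊆ B → T.card + U.card ≤ m →
        ∀ τ : Q → Fin m → ℝ, (∀ q, IsSg (τ q)) → ∀ α : Q → ℝ,
          ∑ q ∈ T, α q • (τ q * w q) ∈ Submodule.span ℝ (U : Set (Fin m → ℝ)) →
            ∀ q ∈ T, α q = 0 := by
  classical
  induction S using Finset.induction_on with
  | empty =>
    refine ⟨w0, by simp, ?_⟩
    intro T hT
    have : T = ∅ := by simpa using hT
    subst this
    simp
  | insert q0 S hq0 ih =>
    obtain ⟨w, hw, hT⟩ := ih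
    -- finite set of vectors to be avoided
    let V : Set (Fin m → ℝ) := Set.image2 (fun τ u => τ * u) {τ : Fin m → ℝ | IsSg τ}
      ((B : Set (Fin m → ℝ)) ∪ (S.image w : Finset _))
    have hV : V.Finite := Set.Finite.image2 _ (IsSg.finite m) (by
      exact (Finset.finite_toSet _).union (Finset.finite_toSet _))
    let 𝒮 : Set (Submodule ℝ (Fin m → ℝ)) :=
      (fun D : Set (Fin m → ℝ) => Submodule.span ℝ D) '' {D | D ⊆ V ∧ Submodule.span ℝ D ≠ ⊤}
    have h𝒮 : 𝒮.Finite := Set.Finite.image _ (hV.finite_subsets.subset (fun D hD => hD.1))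
    obtain ⟨x, hx, hx'⟩ := avoid 𝒮 h𝒮 (by rintro p ⟨D, hD, rfl⟩; exact hD.2) (w0 q0) ε hε
    refine ⟨Function.update w q0 x, ?_, ?_⟩
    · intro q hq
      by_cases h : q = q0
      · subst h; simpa using hx
      · rw [Function.update_of_ne h]
        exact hw q (Finset.mem_of_mem_insert_of_ne hq h)
    · intro T hTS U hU hcard τ hτ α hsum
      have hwS : ∀ T' : Finset Q, q0 ∉ T' → ∑ q ∈ T', α q • (τ q * Function.update w q0 x q)
          = ∑ q ∈ T', α q • (τ q * w q) := by
        intro T' h'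
        refine Finset.sum_congr rfl (fun q hq => ?_)
        have hne : q ≠ q0 := fun h => h' (h ▸ hq)
        rw [Function.update_of_ne hne]
      by_cases hq : q0 ∈ T
      · have hT'S : T.erase q0 ⊆ S := by
          intro q h
          exact Finset.mem_of_mem_insert_of_ne (hTS (Finset.mem_of_mem_erase h))
            (Finset.ne_of_mem_erase h)
        have hc : (T.erase q0).card + 1 = T.card := Finset.card_erase_add_one hq
        rw [← Finset.add_sum_erase _ _ hq, hwS _ (Finset.notMem_erase q0 T),
          Function.update_self] at hsum
        have hα : α q0 = 0 := by
          by_contra hne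
          -- then x lies in a forbidden span
          let D : Finset (Fin m → ℝ) := (T.erase q0).image (fun q => τ q0 * (τ q * w q)) ∪
            U.image (fun u => τ q0 * u)
          have hDV : (D : Set (Fin m → ℝ)) ⊆ V := by
            intro y hy
            simp only [D, Finset.coe_union, Finset.coe_image, Set.mem_union, Set.mem_image] at hy
            rcases hy with ⟨q, hq', rfl⟩ | ⟨u, hu, rfl⟩
            · refine ⟨τ q0 * τ q, (hτ q0).mul (hτ q), w q, Or.inr ?_, by simp [mul_assoc]⟩
              simp only [Finset.coe_image, Set.mem_image]
              exact ⟨q, hT'S hq', rfl⟩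
            · exact ⟨τ q0, hτ q0, u, Or.inl (hU hu), rfl⟩
          have hDc : D.card < m := by
            have h1 : D.card ≤ (T.erase q0).card + U.card :=
              (Finset.card_union_le _ _).trans
                (add_le_add Finset.card_image_le Finset.card_image_le)
            omega
          have hDt : Submodule.span ℝ (D : Set (Fin m → ℝ)) ≠ ⊤ := by
            intro h
            have := finrank_span_finset_le_card (R := ℝ) D
            rw [Set.finrank, h, finrank_top] at this
            simp at this
            omega
          refine hx' _ ⟨D, ⟨hDV, hDt⟩, rfl⟩ ?_
          -- multiplication by τ q0
          let A : (Fin m → ℝ) →ₗ[ℝ] (Fin m → ℝ) := LinearMap.mulLeft ℝ (τ q0)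
          have hA : A (α q0 • (τ q0 * x) + ∑ q ∈ T.erase q0, α q • (τ q * w q)) ∈
              Submodule.span ℝ (D : Set (Fin m → ℝ)) := by
            have h1 := Submodule.mem_map_of_mem (f := A) hsum
            rw [Submodule.map_span] at h1
            refine Submodule.span_mono ?_ h1
            rintro _ ⟨u, hu, rfl⟩
            simp only [D, Finset.coe_union, Finset.coe_image]
            exact Or.inr ⟨u, hu, rfl⟩
          have hA2 : A (∑ q ∈ T.erase q0, α q • (τ q * w q)) ∈
              Submodule.span ℝ (D : Set (Fin m → ℝ)) := by
            rw [map_sum]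
            refine Submodule.sum_mem _ (fun q hq' => ?_)
            rw [map_smul]
            refine Submodule.smul_mem _ _ (Submodule.subset_span ?_)
            simp only [D, Finset.coe_union, Finset.coe_image]
            exact Or.inl ⟨q, hq', rfl⟩
          rw [map_add, map_smul] at hA
          have h3 := (Submodule.add_mem_iff_left _ hA2).1 hA
          have h4 : A (τ q0 * x) = x := by
            simp [A, ← mul_assoc, (hτ q0).sq]
          rw [h4] at h3
          have h5 := Submodule.smul_mem _ (α q0)⁻¹ h3
          rwa [smul_smul, inv_mul_cancel₀ hne, one_smul] at h5
        rw [hα, zero_smul, zero_add] at hsum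
        have h6 := hT _ hT'S U hU (by omega) τ hτ α hsum
        intro q hqT
        by_cases h : q = q0
        · rw [h, hα]
        · exact h6 q (Finset.mem_erase.2 ⟨h, hqT⟩)
      · rw [hwS _ hq] at hsum
        refine hT T ?_ U hU hcard τ hτ α hsum
        intro q h
        exact Finset.mem_of_mem_insert_of_ne (hTS h) (fun h' => hq (h' ▸ h))

lemma sg_isSg (z : ℤ) : ((sg z : ℤ) : ℝ) = 1 ∨ ((sg z : ℤ) : ℝ) = -1 := by
  unfold sg; split_ifs <;> simp

noncomputable def chrR {m : ℕ} (δ : Fin m → Fin m → ℤ) (a : Fin m → ℤ) : Fin m → ℝ :=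
  fun l => ((chr δ a l : ℤ) : ℝ)

lemma chrR_isSg {m : ℕ} (δ : Fin m → Fin m → ℤ) (a : Fin m → ℤ) : IsSg (chrR δ a) :=
  fun _ => sg_isSg _

lemma norm_sg_mul {m : ℕ} {τ : Fin m → ℝ} (h : IsSg τ) (x : Fin m → ℝ) : ‖τ * x‖ = ‖x‖ := by
  simp only [Pi.norm_def]
  congr 1
  refine Finset.sup_congr rfl (fun l _ => ?_)
  rcases h l with h | h <;> simp [h]

lemma gen_map {d N : ℕ} (hN : 0 < N) (κ δ : Fin (d + 1) → Fin (d + 1) → ℤ)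
    (f : (Fin (d + 1) → ℤ) → Fin (d + 1) → ℝ)
    (hf : ∀ a v, f (gam κ (4 * N) a v) = chrR δ a * f v)
    (G : Ch d N → Fin (d + 2) → Fin (d + 1) → ℝ) (ε : ℝ) (hε : 0 < ε) :
    ∃ F : (Fin (d + 1) → ℤ) → Fin (d + 1) → ℝ,
      (∀ a v, F (gam κ (4 * N) a v) = chrR δ a * F v) ∧
      (∀ c : Ch d N, ∀ t, ‖F (vert c t) - f (vert c t)‖ < ε) ∧
      ∀ c : Ch d N, ∀ T U : Finset (Fin (d + 2)), T.card + U.card ≤ d + 1 →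
        ∀ lF lG : Fin (d + 2) → ℝ,
          ∑ t ∈ T, lF t • F (vert c t) + ∑ t ∈ U, lG t • G c t = 0 → ∀ t ∈ T, lF t = 0 := by
  classical
  have hP : (1 : ℤ) < 4 * N := by omega
  let st := orb κ (4 * N : ℤ)
  let Q := Quotient st
  let lab : (Fin (d + 1) → ℤ) → Q := fun v => Quotient.mk st v
  have hrep : ∀ v, ∃ a, v = gam κ (4 * N) a (lab v).out := by
    intro v
    exact Quotient.mk_out (s := st) v
  choose av hav using hrep
  obtain ⟨w, hw, hgen⟩ := gen_exists (univ.image (fun p : Ch d N × Fin (d + 2) => G p.1 p.2))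
    (fun q : Q => f q.out) ε hε
    (univ.image (fun p : Ch d N × Fin (d + 2) => lab (vert p.1 p.2)))
  refine ⟨fun v => chrR δ (av v) * w (lab v), ?_, ?_, ?_⟩
  · intro a v
    have hl : lab (gam κ (4 * N) a v) = lab v := by
      apply Quotient.sound
      exact st.symm ⟨a, rfl⟩
    have ha : av (gam κ (4 * N) a v) = comp κ a (av v) := by
      apply gam_inj κ _ hP _ _ (lab v).out
      rw [← gam_comp, ← hav v, ← hl, ← hav]
    simp only [hl, ha]
    rw [← mul_assoc]
    congr 1
    funext l
    simp [chrR, chr_comp]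
  · intro c t
    have h1 : f (vert c t) = chrR δ (av (vert c t)) * f (lab (vert c t)).out := by
      conv_lhs => rw [hav (vert c t)]
      rw [hf]
    rw [h1]
    simp only
    rw [← mul_sub, norm_sg_mul (chrR_isSg _ _)]
    apply hw
    exact Finset.mem_image.2 ⟨(c, t), mem_univ _, rfl⟩
  · intro c T U hcard lF lG hsum
    have hinj : ∀ s t, lab (vert c s) = lab (vert c t) → s = t := by
      intro s t h
      obtain ⟨a, ha⟩ : ∃ a, vert c t = gam κ (4 * N) a (vert c s) := Quotient.exact h
      have : a = 0 := by
        apply gam_near κ _ hP a (vert c s)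
        intro j
        rw [← ha]
        exact vert_near c t s j
      rw [this, gam_zero] at ha
      exact (vert_inj c ha).symm
    let lb : Fin (d + 2) → Q := fun t => lab (vert c t)
    have hlb : Function.Injective lb := fun s t h => hinj s t h
    have h := hgen (T.image lb) ?_ (U.image (fun t => G c t)) ?_ ?_
      (fun q => chrR δ (av (vert c (Function.invFun lb q)))) (fun q => chrR_isSg _ _)
      (fun q => lF (Function.invFun lb q)) ?_
    · intro t ht
      have := h (lb t) (Finset.mem_image_of_mem _ ht)
      simpa [Function.leftInverse_invFun hlb t] using this
    · intro q hq
      obtain ⟨t, _, rfl⟩ := Finset.mem_image.1 hq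
      exact Finset.mem_image.2 ⟨(c, t), mem_univ _, rfl⟩
    · intro u hu
      obtain ⟨t, _, rfl⟩ := Finset.mem_image.1 hu
      exact Finset.mem_image.2 ⟨(c, t), mem_univ _, rfl⟩
    · exact (add_le_add Finset.card_image_le Finset.card_image_le).trans hcard
    · rw [Finset.sum_image (fun s _ t _ h => hlb h)]
      simp only [Function.leftInverse_invFun hlb _]
      rw [eq_neg_of_add_eq_zero_left hsum]
      refine Submodule.neg_mem _ (Submodule.sum_mem _ (fun t ht => Submodule.smul_mem _ _
        (Submodule.subset_span ?_)))
      exact Finset.mem_coe.2 (Finset.mem_image_of_mem _ ht)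

end MKF


namespace MKF

lemma gen_mixq {d : ℕ} (F G : Fin (d + 2) → Fin (d + 1) → ℝ)
    (hF : ∀ T U : Finset (Fin (d + 2)), T.card + U.card ≤ d + 1 → ∀ lF lG : Fin (d + 2) → ℝ,
      ∑ t ∈ T, lF t • F t + ∑ t ∈ U, lG t • G t = 0 → ∀ t ∈ T, lF t = 0)
    (hG : ∀ l : Fin (d + 2) → ℝ, (∀ t, 0 ≤ l t) → ∑ t, l t = 1 → ∑ t, l t • G t = 0 → ∀ t, l t ≠ 0)
    (t : Fin (d + 2)) : Gen (mixq F G t) := by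
  classical
  intro l l0 l1 lq i j hi hj
  by_contra hij
  set lF : Fin (d + 2) → ℝ := fun s => if s < t then 0 else l (some s) with hlF
  set lG : Fin (d + 2) → ℝ := fun s => if s < t then l (some s) else if s = t then l none else 0 with hlG
  have e1 : ∑ s, lF s + ∑ s, lG s = 1 := by
    rw [← l1, Fintype.sum_option, ← Finset.sum_add_distrib]
    have : ∀ s, lF s + lG s = l (some s) + if s = t then l none else 0 := by
      intro s
      simp only [hlF, hlG]
      by_cases h : s < t
      · simp [h, h.ne]
      · simp [h]
    rw [Finset.sum_congr rfl (fun s _ => this s), Finset.sum_add_distrib]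
    simp [add_comm]
  have e2 : ∑ s, lF s • F s + ∑ s, lG s • G s = 0 := by
    rw [← lq, Fintype.sum_option, ← Finset.sum_add_distrib]
    have : ∀ s, lF s • F s + lG s • G s = l (some s) • mix F G t s + if s = t then l none • G t else 0 := by
      intro s
      simp only [hlF, hlG, mix]
      by_cases h : s < t
      · have h' : (s : ℕ) < t := h
        simp [h, h.ne]
      · have h' : ¬ (s : ℕ) < t := h
        by_cases h2 : s = t
        · subst h2; simp
        · simp [h, h2]
    rw [Finset.sum_congr rfl (fun s _ => this s), Finset.sum_add_distrib]
    simp [add_comm, mixq]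
  set T := univ.filter (fun s => lF s ≠ 0)
  set U := univ.filter (fun s => lG s ≠ 0)
  have hTU : T.card + U.card ≤ d + 1 := by
    let φ : Fin (d + 2) → Option (Fin (d + 2)) := fun s => if s < t then some s else none
    have hT : ∀ s ∈ T, ¬ s < t ∧ l (some s) ≠ 0 := by
      intro s hs
      have := (Finset.mem_filter.1 hs).2
      simp only [hlF] at this
      split_ifs at this with h <;> simp_all
    have hU : ∀ s ∈ U, (s < t ∨ s = t) ∧ l (φ s) ≠ 0 := by
      intro s hs
      have := (Finset.mem_filter.1 hs).2
      simp only [hlG] at this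
      split_ifs at this with h h2
      · exact ⟨Or.inl h, by simpa [φ, h] using this⟩
      · exact ⟨Or.inr h2, by simpa [φ, h] using this⟩
      · simp at this
    have hUi : Set.InjOn φ U := by
      intro a ha b hb hab
      rcases (hU a ha).1 with h1 | h1 <;> rcases (hU b hb).1 with h2 | h2
      · simpa [φ, h1, h2] using hab
      · simp [φ, h1, h2] at hab
      · simp [φ, h1, h2] at hab
      · rw [h1, h2]
    rw [← Finset.card_image_of_injective T (Option.some_injective _), ← Finset.card_image_of_injOn hUi,
      ← Finset.card_union_of_disjoint]
    · have : T.image some ∪ U.image φ ⊆ (univ.erase i).erase j := by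
        intro o ho
        have : l o ≠ 0 := by
          rcases Finset.mem_union.1 ho with h | h
          · obtain ⟨s, hs, rfl⟩ := Finset.mem_image.1 h
            exact (hT s hs).2
          · obtain ⟨s, hs, rfl⟩ := Finset.mem_image.1 h
            exact (hU s hs).2
        simp only [Finset.mem_erase, mem_univ, and_true]
        exact ⟨fun h => this (h ▸ hj), fun h => this (h ▸ hi)⟩
      refine (Finset.card_le_card this).trans ?_
      rw [Finset.card_erase_of_mem (by simp [Ne.symm hij]), Finset.card_erase_of_mem (mem_univ _)]
      simp
    · rw [Finset.disjoint_left]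
      intro o h1 h2
      obtain ⟨s, hs, rfl⟩ := Finset.mem_image.1 h1
      obtain ⟨s', hs', h⟩ := Finset.mem_image.1 h2
      simp only [φ] at h
      split_ifs at h with h3
      have : s' = s := by simpa using h
      exact (hT s hs).1 (this ▸ h3)
  have e3 : ∑ s ∈ T, lF s • F s + ∑ s ∈ U, lG s • G s = 0 := by
    rw [← e2]
    congr 1
    · exact Finset.sum_subset (Finset.subset_univ _) (fun s _ hs => by
        have : lF s = 0 := by simpa [T] using hs
        simp [this])
    · exact Finset.sum_subset (Finset.subset_univ _) (fun s _ hs => by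
        have : lG s = 0 := by simpa [U] using hs
        simp [this])
  have hz := hF T U hTU lF lG e3
  have hz' : ∀ s, lF s = 0 := by
    intro s
    by_contra h
    exact h (hz s (by simp [T, h]))
  have hne := hG lG (fun s => by
      simp only [hlG]; split_ifs <;> first | exact l0 _ | exact le_rfl) (by simpa [hz'] using e1) (by simpa [hz'] using e2)
  have key : ∀ o, l o = 0 → o = some t := by
    rintro (_ | s) ho
    · exact absurd (by simp [hlG, ho]) (hne t)
    · by_contra h
      have h : s ≠ t := fun h' => h (by rw [h'])
      exact hne s (by simp [hlG, ho, h])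
  exact hij ((key i hi).trans (key j hj).symm)

lemma hit_transfer {ι : Type*} [Fintype ι] {m : ℕ} {q q' : ι → Fin m → ℝ} {i : ι} (τ : Fin m → ℝ)
    (h : ∀ o, o ≠ i → q' o = τ * q o) (hq : Hit q i) : Hit q' i := by
  obtain ⟨l, l0, l1, li, lq⟩ := hq
  refine ⟨l, l0, l1, li, ?_⟩
  have : ∀ o, l o • q' o = τ * (l o • q o) := by
    intro o
    by_cases ho : o = i
    · subst ho; simp [li]
    · rw [h o ho, mul_smul_comm]
  rw [Finset.sum_congr rfl (fun o _ => this o), ← Finset.mul_sum, lq, mul_zero]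

lemma mixq_transfer {m : ℕ} {F G F' G' : Fin (m + 1) → Fin m → ℝ} (P : (Fin m → ℝ) → (Fin m → ℝ) → Prop)
    {s t : Fin (m + 1)} (hst : s ≠ t)
    (hF : ∀ r, r ≠ s → P (F r) (F' r)) (hG : ∀ r, r ≠ s → P (G r) (G' r)) :
    ∀ o, o ≠ some s → P (mixq F G t o) (mixq F' G' t o) := by
  rintro (_ | r) ho
  · exact hG t hst.symm
  · have hr : r ≠ s := fun h => ho (by rw [h])
    change P (mix F G t r) (mix F' G' t r)
    unfold mix
    split_ifs
    · exact hG r hr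
    · exact hF r hr

lemma hit_convex {ι : Type*} [Fintype ι] {m : ℕ} {q : ι → Fin m → ℝ} {i : ι} {S : Set (Fin m → ℝ)}
    (hS : Convex ℝ S) (h : ∀ o, o ≠ i → q o ∈ S) (hq : Hit q i) : (0 : Fin m → ℝ) ∈ S := by
  classical
  obtain ⟨l, l0, l1, li, lq⟩ := hq
  rw [← Finset.sum_erase univ (a := i) (by simpa using li)] at l1
  rw [← Finset.sum_erase univ (a := i) (by simp [li])] at lq
  rw [← lq]
  exact hS.sum_mem (fun o _ => l0 o) l1 (fun o ho => h o (Finset.ne_of_mem_erase ho))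

lemma zero_convex {m : ℕ} {q : Fin (m + 1) → Fin m → ℝ} {S : Set (Fin m → ℝ)}
    (hS : Convex ℝ S) (h : ∀ o, q o ∈ S) (hq : Zero q) : (0 : Fin m → ℝ) ∈ S := by
  obtain ⟨l, l0, l1, lq⟩ := hq
  rw [← lq]
  exact hS.sum_mem (fun o _ => l0 o) l1 (fun o _ => h o)

noncomputable def gamR {m : ℕ} (κ : Fin m → Fin m → ℤ) (a : Fin m → ℤ) (x : Fin m → ℝ) : Fin m → ℝ :=
  fun j => (sg (tw κ a j) : ℝ) * x j + a j

noncomputable def pt {m : ℕ} (N : ℕ) (v : Fin m → ℤ) : Fin m → ℝ := fun j => (v j : ℝ) / (4 * N)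

lemma pt_gam {m : ℕ} (N : ℕ) (hN : 0 < N) (κ : Fin m → Fin m → ℤ) (a v : Fin m → ℤ) :
    pt N (gam κ (4 * N) a v) = gamR κ a (pt N v) := by
  funext j
  have : (N : ℝ) ≠ 0 := by positivity
  simp only [pt, gam, gamR]
  push_cast
  field_simp

lemma pt_norm {d N : ℕ} (hN : 0 < N) (c : Ch d N) (t : Fin (d + 2)) : ‖pt N (vert c t)‖ ≤ 1 / 2 := by
  have hN' : (0 : ℝ) < N := by positivity
  rw [pi_norm_le_iff_of_nonneg (by norm_num)]
  intro j
  have := vert_le c t j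
  have h : |(vert c t j : ℝ)| ≤ 2 * N := by exact_mod_cast this
  rw [pt, Real.norm_eq_abs, abs_div, abs_of_pos (show (0 : ℝ) < 4 * N by positivity),
    div_le_iff₀ (by positivity)]
  linarith

lemma pt_norm_eq {d N : ℕ} (hN : 0 < N) (c : Ch d N) (t : Fin (d + 2)) (j : Fin (d + 1))
    (h : |vert c t j| = 2 * N) : ‖pt N (vert c t)‖ = 1 / 2 := by
  have hN' : (0 : ℝ) < N := by positivity
  refine le_antisymm (pt_norm hN c t) ?_
  refine le_trans ?_ (norm_le_pi_norm _ j)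
  have h : |(vert c t j : ℝ)| = 2 * N := by exact_mod_cast h
  rw [pt, Real.norm_eq_abs, abs_div, abs_of_pos (show (0 : ℝ) < 4 * N by positivity), h,
    le_div_iff₀ (by positivity)]
  linarith

lemma pt_dist {d N : ℕ} (hN : 0 < N) (c : Ch d N) (s t : Fin (d + 2)) :
    dist (pt N (vert c s)) (pt N (vert c t)) ≤ 1 / (4 * N) := by
  have hN' : (0 : ℝ) < N := by positivity
  rw [dist_pi_le_iff (by positivity)]
  intro j
  have h : |(vert c s j : ℝ) - vert c t j| ≤ 1 := by exact_mod_cast vert_near c s t j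
  rw [pt, pt, Real.dist_eq, ← sub_div, abs_div, abs_of_pos (show (0 : ℝ) < 4 * N by positivity)]
  gcongr

noncomputable def lin {d N : ℕ} (c : Ch d N) (t : Fin (d + 2)) (j : Fin (d + 1)) : ℝ :=
  ((vert c t j : ℝ) - c0 d j) / (4 * N)

lemma lin_dist {d N : ℕ} (hN : 0 < N) (c : Ch d N) (t : Fin (d + 2)) :
    dist (lin c t) (pt N (vert c t)) ≤ 1 / (4 * N) := by
  have hN' : (0 : ℝ) < N := by positivity
  rw [dist_pi_le_iff (by positivity)]
  intro j
  rw [lin, pt, Real.dist_eq, ← sub_div, abs_div, abs_of_pos (show (0 : ℝ) < 4 * N by positivity)]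
  gcongr
  rw [abs_le]
  have := c0_pos d j
  have := c0_lt d j
  constructor <;> linarith

lemma lin_zero_iff {d N : ℕ} (hN : 0 < N) (c : Ch d N) (l : Fin (d + 2) → ℝ) (l1 : ∑ t, l t = 1) :
    ∑ t, l t • lin c t = 0 ↔ ∀ j, ∑ t, l t * (vert c t j : ℝ) = c0 d j := by
  have hN' : (0 : ℝ) < N := by positivity
  rw [funext_iff]
  refine forall_congr' fun j => ?_
  have : (∑ t, l t • lin c t) j = (∑ t, l t * (vert c t j : ℝ) - c0 d j) / (4 * N) := by
    simp only [Finset.sum_apply, Pi.smul_apply, smul_eq_mul, lin]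
    have hc : c0 d j = ∑ t, l t * c0 d j := by rw [← Finset.sum_mul, l1, one_mul]
    conv_rhs => rw [hc]
    rw [sub_div, Finset.sum_div, Finset.sum_div, ← Finset.sum_sub_distrib]
    exact Finset.sum_congr rfl (fun t _ => by ring)
  rw [this, Pi.zero_apply, div_eq_zero_iff, sub_eq_zero]
  constructor
  · rintro (h | h)
    · exact h
    · linarith
  · exact Or.inl

lemma cnt_lin {d N : ℕ} (hN : 0 < N) : cnt (lin : Ch d N → _) = 1 := by
  classical
  unfold cnt
  rw [Finset.card_eq_one]
  refine ⟨cstar d N hN, ?_⟩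
  ext c
  simp only [Finset.mem_filter, mem_univ, true_and, Finset.mem_singleton]
  constructor
  · rintro ⟨l, l0, l1, lq⟩
    exact (lin_unique hN c l l0 l1 ((lin_zero_iff hN c l l1).1 lq)).1
  · rintro rfl
    obtain ⟨l, l0, l1, lq⟩ := lin_exists (d := d) hN
    exact ⟨l, l0, l1, (lin_zero_iff hN _ l l1).2 lq⟩

theorem borsuk_ulam_succ {d : ℕ} (κ δ : Fin (d + 1) → Fin (d + 1) → ℤ)
    (f g : (Fin (d + 1) → ℝ) → Fin (d + 1) → ℝ) (hfc : Continuous f) (hgc : Continuous g)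
    (hf : ∀ a x, f (gamR κ a x) = chrR δ a * f x) (hg : ∀ a x, g (gamR κ a x) = chrR δ a * g x)
    (hb : ∀ x, ‖x‖ = 1 / 2 → (0 : Fin (d + 1) → ℝ) ∉ segment ℝ (g x) x) : ∃ x, f x = 0 := by
  by_contra hne
  push Not at hne
  have hcK := isCompact_closedBall (0 : Fin (d + 1) → ℝ) (1 / 2)
  obtain ⟨ε₁, hε₁, h1⟩ := hcK.exists_forall_le' (f := fun x => ‖f x‖) (by fun_prop) (a := 0)
    (fun x _ => norm_pos_iff.2 (hne x))
  obtain ⟨ε₂, hε₂, h2⟩ := ((isCompact_sphere (0 : Fin (d + 1) → ℝ) (1 / 2)).prod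
    (isCompact_Icc (a := (0 : ℝ)) (b := 1))).exists_forall_le'
    (f := fun z => ‖(1 - z.2) • g z.1 + z.2 • z.1‖) (by fun_prop) (a := 0) (by
      rintro ⟨x, t⟩ ⟨hx, ht⟩
      refine norm_pos_iff.2 (fun h => hb x (by simpa using hx) ?_)
      exact ⟨1 - t, t, by linarith [ht.2], ht.1, by ring, h⟩)
  have hseg : ∀ x, ‖x‖ = 1 / 2 → ∀ y ∈ segment ℝ (g x) x, ε₂ ≤ ‖y‖ := by
    rintro x hx y ⟨a, b, ha, hb', hab, rfl⟩
    have := h2 (x, b) ⟨by simpa using hx, hb', by linarith⟩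
    rwa [show 1 - b = a by linarith] at this
  have uf := Metric.uniformContinuousOn_iff.1 (hcK.uniformContinuousOn_of_continuous hfc.continuousOn)
    (ε₁ / 2) (by positivity)
  have ug := Metric.uniformContinuousOn_iff.1 (hcK.uniformContinuousOn_of_continuous hgc.continuousOn)
    (ε₂ / 2) (by positivity)
  obtain ⟨δ₁, hδ₁, uf⟩ := uf
  obtain ⟨δ₂, hδ₂, ug⟩ := ug
  obtain ⟨N', hN'⟩ := exists_nat_one_div_lt (show (0 : ℝ) < min (min δ₁ δ₂) (ε₂ / 2) by positivity)
  set N := N' + 1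
  have hN : 0 < N := Nat.succ_pos _
  have hNr : (0 : ℝ) < N := by positivity
  have hmesh : 1 / (4 * (N : ℝ)) < min (min δ₁ δ₂) (ε₂ / 2) := by
    refine lt_of_le_of_lt ?_ hN'
    apply one_div_le_one_div_of_le
    · positivity
    · simp only [N]; push_cast; nlinarith [Nat.cast_nonneg (α := ℝ) N']
  have m1 : 1 / (4 * (N : ℝ)) < δ₁ := lt_of_lt_of_le hmesh ((min_le_left _ _).trans (min_le_left _ _))
  have m2 : 1 / (4 * (N : ℝ)) < δ₂ := lt_of_lt_of_le hmesh ((min_le_left _ _).trans (min_le_right _ _))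
  have m3 : 1 / (4 * (N : ℝ)) < ε₂ / 2 := lt_of_lt_of_le hmesh (min_le_right _ _)
  obtain ⟨Gp, Geq, Gcl, Ggen⟩ := gen_map hN κ δ (fun v => g (pt N v))
    (fun a v => by rw [pt_gam N hN, hg]) lin (ε₂ / 2) (by positivity)
  obtain ⟨Fp, Feq, Fcl, Fgen⟩ := gen_map hN κ δ (fun v => f (pt N v))
    (fun a v => by rw [pt_gam N hN, hf]) (fun c t => Gp (vert c t)) (ε₁ / 2) (by positivity)
  have mem : ∀ (c : Ch d N) t, pt N (vert c t) ∈ Metric.closedBall (0 : Fin (d + 1) → ℝ) (1 / 2) :=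
    fun c t => by simpa using pt_norm hN c t
  have E1 := cnt_eq (C := Ch d N) (Iv κ) (Iv_Iv κ) (Iv_ne κ) (fun c t => Gp (vert c t)) lin ?_ ?_
  have E2 := cnt_eq (C := Ch d N) (Iv κ) (Iv_Iv κ) (Iv_ne κ) (fun c t => Fp (vert c t))
    (fun c t => Gp (vert c t)) ?_ ?_
  · have hz : cnt (fun (c : Ch d N) t => Fp (vert c t)) = 0 := by
      classical
      unfold cnt
      rw [Finset.card_eq_zero, Finset.filter_eq_empty_iff]
      intro c _ hc
      have := zero_convex (convex_ball (f (pt N (vert c 0))) ε₁) (fun t => ?_) hc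
      · have h := h1 _ (mem c 0)
        simp only [Metric.mem_ball, dist_zero_left] at this
        linarith
      · have a1 : dist (Fp (vert c t)) (f (pt N (vert c t))) < ε₁ / 2 := by
          rw [dist_eq_norm]; exact Fcl c t
        have a2 := uf _ (mem c t) _ (mem c 0) (lt_of_le_of_lt (pt_dist hN c t 0) m1)
        rw [Metric.mem_ball]
        linarith [dist_triangle (Fp (vert c t)) (f (pt N (vert c t))) (f (pt N (vert c 0)))]
    rw [hz, E1, cnt_lin hN] at E2
    simp at E2
  · intro t c
    refine gen_mixq _ _ (Fgen c) ?_ t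
    intro l l0 l1 lq s hs
    have h := Ggen c (univ.erase s) ∅ (by simp) l 0 ?_
    · have : ∑ t, l t = 0 := by
        rw [← Finset.sum_erase univ (a := s) hs]
        exact Finset.sum_eq_zero h
      linarith
    · rw [Finset.sum_erase _ (by simp [hs])]
      simpa using lq
  · intro t s hst c
    obtain ⟨a, ha, -⟩ := vert_Iv κ s c
    refine hit_transfer (chrR δ a) ?_
    refine mixq_transfer (fun u v => v = chrR δ a * u) hst ?_ ?_
    · intro r hr; simp only [ha r hr, Feq]
    · intro r hr; simp only [ha r hr, Geq]
  · intro t c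
    refine gen_mixq _ _ (Ggen c) ?_ t
    intro l l0 l1 lq
    exact (lin_unique hN c l l0 l1 ((lin_zero_iff hN c l l1).1 lq)).2
  · intro t s hst c
    obtain ⟨a, ha, h0 | ⟨j, hj⟩⟩ := vert_Iv κ s c
    · subst h0
      refine hit_transfer 1 ?_
      refine mixq_transfer (fun u v => v = 1 * u) hst ?_ ?_
      · intro r hr; simp only [ha r hr, gam_zero, one_mul]
      · intro r hr; funext j; simp only [lin, ha r hr, gam_zero, one_mul]
    · intro hh
      exfalso
      obtain ⟨r₀, hr₀⟩ := exists_ne s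
      set x₀ := pt N (vert c r₀) with hx₀
      have hn : ‖x₀‖ = 1 / 2 := pt_norm_eq hN c r₀ j (hj r₀ hr₀)
      have := hit_convex (S := Metric.thickening ε₂ (segment ℝ (g x₀) x₀))
        ((convex_segment _ _).thickening _)
        (mixq_transfer (F' := fun c t => 0) (G' := fun c t => 0) (fun u _ => u ∈ Metric.thickening ε₂ (segment ℝ (g x₀) x₀)) hst ?_ ?_) hh
      · obtain ⟨y, hy, hd⟩ := Metric.mem_thickening_iff.1 this
        have := hseg x₀ hn y hy
        rw [dist_zero_left] at hd
        linarith
      · intro r hr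
        refine Metric.mem_thickening_iff.2 ⟨g x₀, left_mem_segment _ _ _, ?_⟩
        have a1 : dist (Gp (vert c r)) (g (pt N (vert c r))) < ε₂ / 2 := by
          rw [dist_eq_norm]; exact Gcl c r
        have a2 := ug _ (mem c r) _ (mem c r₀) (lt_of_le_of_lt (pt_dist hN c r r₀) m2)
        linarith [dist_triangle (Gp (vert c r)) (g (pt N (vert c r))) (g x₀)]
      · intro r hr
        refine Metric.mem_thickening_iff.2 ⟨x₀, right_mem_segment _ _ _, ?_⟩
        have a1 := lin_dist hN c r
        have a2 := pt_dist hN c r r₀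
        linarith [dist_triangle (lin c r) (pt N (vert c r)) x₀]

theorem borsuk_ulam {m : ℕ} (κ δ : Fin m → Fin m → ℤ)
    (f g : (Fin m → ℝ) → Fin m → ℝ) (hfc : Continuous f) (hgc : Continuous g)
    (hf : ∀ a x, f (gamR κ a x) = chrR δ a * f x) (hg : ∀ a x, g (gamR κ a x) = chrR δ a * g x)
    (hb : ∀ x, ‖x‖ = 1 / 2 → (0 : Fin m → ℝ) ∉ segment ℝ (g x) x) : ∃ x, f x = 0 := by
  cases m with
  | zero => exact ⟨0, Subsingleton.elim _ _⟩
  | succ d => exact borsuk_ulam_succ κ δ f g hfc hgc hf hg hb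

end MKF


namespace MKF

section rot
variable {ι : Type*} [Fintype ι] [DecidableEq ι]

/-- rotation in the coordinate plane `(p, q)` -/
noncomputable def Rot (p q : ι) (θ : ℝ) : Matrix ι ι ℝ :=
  1 + (Real.cos θ - 1) • (Matrix.single p p 1 + Matrix.single q q 1)
    + Real.sin θ • (Matrix.single q p 1 - Matrix.single p q 1)

lemma Rot_apply (p q : ι) (θ : ℝ) (i j : ι) : Rot p q θ i j =
    (if i = j then 1 else 0) + (Real.cos θ - 1) * ((if p = i ∧ p = j then 1 else 0) + (if q = i ∧ q = j then 1 else 0))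
      + Real.sin θ * ((if q = i ∧ p = j then 1 else 0) - (if p = i ∧ q = j then 1 else 0)) := by
  simp [Rot, Matrix.single, Matrix.one_apply, mul_add]

lemma Rot_zero (p q : ι) : Rot p q 0 = 1 := by simp [Rot]

lemma Rot_add {p q : ι} (h : p ≠ q) (θ φ : ℝ) : Rot p q (θ + φ) = Rot p q θ * Rot p q φ := by
  set K : Matrix ι ι ℝ := Matrix.single p p 1 + Matrix.single q q 1 with hK
  set J : Matrix ι ι ℝ := Matrix.single q p 1 - Matrix.single p q 1 with hJ
  have KK : K * K = K := by
    simp [hK, mul_add, add_mul, Matrix.single_mul_single_of_ne, h, h.symm]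
  have KJ : K * J = J := by
    simp [hK, hJ, mul_add, add_mul, mul_sub, sub_mul, Matrix.single_mul_single_of_ne, h, h.symm]
  have JK : J * K = J := by
    simp [hK, hJ, mul_add, add_mul, mul_sub, sub_mul, Matrix.single_mul_single_of_ne, h, h.symm]; abel
  have JJ : J * J = -K := by
    simp [hK, hJ, mul_sub, sub_mul, Matrix.single_mul_single_of_ne, h, h.symm]; abel
  change 1 + (Real.cos (θ + φ) - 1) • K + Real.sin (θ + φ) • J =
    (1 + (Real.cos θ - 1) • K + Real.sin θ • J) * (1 + (Real.cos φ - 1) • K + Real.sin φ • J)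
  simp only [mul_add, add_mul, mul_one, one_mul, smul_mul_smul_comm, KK, KJ, JK, JJ]
  rw [Real.cos_add, Real.sin_add]
  module

lemma Rot_transpose (p q : ι) (θ : ℝ) : (Rot p q θ).transpose = Rot p q (-θ) := by
  simp [Rot, Matrix.transpose_add, Matrix.transpose_sub, Matrix.transpose_smul]
  rw [← smul_neg, neg_sub]

lemma Rot_pi {p q : ι} (h : p ≠ q) (a : ℤ) : Rot p q (Real.pi * a) =
    Matrix.diagonal (fun i => (sg (((if p = i then 1 else 0) + (if q = i then 1 else 0)) * a) : ℝ)) := by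
  have hs : Real.sin (Real.pi * a) = 0 := by rw [mul_comm]; exact Real.sin_int_mul_pi a
  have hc : Real.cos (Real.pi * a) = sg a := by
    rw [mul_comm, Real.cos_int_mul_pi]
    unfold sg
    split_ifs with he
    · simp [he.neg_one_zpow]
    · simp [(Int.not_even_iff_odd.1 he).neg_one_zpow]
  ext i j
  rw [Rot_apply, hs, hc, Matrix.diagonal_apply]
  by_cases hij : i = j
  · subst hij
    by_cases h1 : p = i
    · subst h1; simp [h.symm]
    · by_cases h2 : q = i
      · subst h2; simp [h]
      · simp [h1, h2, sg_zero]
  · have h1 : ¬ (p = i ∧ p = j) := fun h => hij (h.1.symm.trans h.2)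
    have h2 : ¬ (q = i ∧ q = j) := fun h => hij (h.1.symm.trans h.2)
    simp [hij, h1, h2]

lemma diag_Rot {p q : ι} (h : p ≠ q) (z : ι → ℤ) (θ : ℝ) :
    Matrix.diagonal (fun i => (sg (z i) : ℝ)) * Rot p q (sg (z p + z q) * θ) =
      Rot p q θ * Matrix.diagonal (fun i => (sg (z i) : ℝ)) := by
  have hcos : Real.cos (sg (z p + z q) * θ) = Real.cos θ := by
    rcases sg_isSg (z p + z q) with h | h <;> rw [h] <;> simp
  have hsin : Real.sin (sg (z p + z q) * θ) = sg (z p) * sg (z q) * Real.sin θ := by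
    have : ((sg (z p) : ℤ) : ℝ) * sg (z q) = sg (z p + z q) := by rw [sg_add]; push_cast; ring
    rw [this]
    rcases sg_isSg (z p + z q) with h | h <;> rw [h] <;> simp
  have sp : ((sg (z p) : ℤ) : ℝ) * sg (z p) = 1 := by exact_mod_cast sg_sq _
  have sq : ((sg (z q) : ℤ) : ℝ) * sg (z q) = 1 := by exact_mod_cast sg_sq _
  ext i j
  rw [Matrix.diagonal_mul, Matrix.mul_diagonal, Rot_apply, Rot_apply, hcos, hsin]
  by_cases hij : i = j
  · subst hij
    have h1 : ¬ (q = i ∧ p = i) := fun h' => h (h'.2.trans h'.1.symm)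
    have h2 : ¬ (p = i ∧ q = i) := fun h' => h (h'.1.trans h'.2.symm)
    simp only [h1, h2, if_false]; ring
  · have h1 : ¬ (p = i ∧ p = j) := fun h => hij (h.1.symm.trans h.2)
    have h2 : ¬ (q = i ∧ q = j) := fun h => hij (h.1.symm.trans h.2)
    simp only [hij, h1, h2, if_false]
    by_cases h3 : q = i ∧ p = j
    · have h4 : ¬ (p = i ∧ q = j) := fun h' => h (h'.1.trans h3.1.symm)
      rw [if_pos h3, if_neg h4]
      obtain ⟨rfl, rfl⟩ := h3
      linear_combination (sg (z p) : ℝ) * Real.sin θ * sq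
    · by_cases h4 : p = i ∧ q = j
      · rw [if_neg h3, if_pos h4]
        obtain ⟨rfl, rfl⟩ := h4
        linear_combination -(sg (z q) : ℝ) * Real.sin θ * sp
      · simp [h3, h4]

lemma Rot_row {p q : ι} {θ : ℝ} {i : ι} (hp : i ≠ p) (h : θ = 0 ∨ i ≠ q) (j : ι) :
    Rot p q θ i j = (1 : Matrix ι ι ℝ) i j := by
  rcases h with h | h
  · rw [h, Rot_zero]
  · rw [Rot_apply, Matrix.one_apply]; simp [hp.symm, h.symm]

lemma Rot_col {p q : ι} {θ : ℝ} {i : ι} (hq : i ≠ q) (h : θ = 0 ∨ i ≠ p) (j : ι) :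
    Rot p q θ j i = (1 : Matrix ι ι ℝ) j i := by
  rcases h with h | h
  · rw [h, Rot_zero]
  · rw [Rot_apply, Matrix.one_apply]; simp [hq.symm, h.symm]

lemma Rot_cont (p q : ι) {X : Type*} [TopologicalSpace X] (θ : X → ℝ) (hθ : Continuous θ) :
    Continuous (fun x => Rot p q (θ x)) := by
  unfold Rot
  fun_prop

/-- partial products -/
noncomputable def Mpre {m : ℕ} (P Q : Fin m → ι) (x : Fin m → ℝ) : ℕ → Matrix ι ι ℝ
  | 0 => 1
  | r + 1 => Mpre P Q x r * (if h : r < m then Rot (P ⟨r, h⟩) (Q ⟨r, h⟩) (Real.pi * x ⟨r, h⟩) else 1)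

lemma Mpre_cont {m : ℕ} (P Q : Fin m → ι) (r : ℕ) : Continuous (fun x => Mpre P Q x r) := by
  induction r with
  | zero => exact continuous_const
  | succ r ih =>
    refine ih.mul ?_
    split_ifs with h
    · exact Rot_cont _ _ _ (by fun_prop)
    · exact continuous_const

lemma Mpre_orth {m : ℕ} (P Q : Fin m → ι) (hPQ : ∀ i j, P i ≠ Q j) (x : Fin m → ℝ) (r : ℕ) :
    Mpre P Q x r * (Mpre P Q x r).transpose = 1 := by
  induction r with
  | zero => simp [Mpre]
  | succ r ih =>
    rw [Mpre, Matrix.transpose_mul]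
    split_ifs with h
    · rw [Rot_transpose, mul_assoc, ← mul_assoc (Rot _ _ _), ← Rot_add (hPQ _ _)]
      simp [Rot_zero, ih]
    · simpa using ih

def inc {m : ℕ} (P Q : Fin m → ι) (j : Fin m) (i : ι) : ℤ :=
  (if P j = i then 1 else 0) + (if Q j = i then 1 else 0)

def kap {m : ℕ} (P Q : Fin m → ι) (i j : Fin m) : ℤ := inc P Q i (P j) + inc P Q i (Q j)

def dz {m : ℕ} (P Q : Fin m → ι) (a : Fin m → ℤ) (r : ℕ) (i : ι) : ℤ :=
  ∑ j : Fin m, if (j : ℕ) < r then inc P Q j i * a j else 0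

lemma Mpre_equiv {m : ℕ} (P Q : Fin m → ι) (hPQ : ∀ i j, P i ≠ Q j) (a : Fin m → ℤ) (x : Fin m → ℝ)
    (r : ℕ) : Mpre P Q (gamR (kap P Q) a x) r =
      Mpre P Q x r * Matrix.diagonal (fun i => (sg (dz P Q a r i) : ℝ)) := by
  induction r with
  | zero => simp [Mpre, dz, sg_zero]
  | succ r ih =>
    rw [Mpre, Mpre, ih]
    by_cases h : r < m
    · rw [dif_pos h, dif_pos h]
      set j : Fin m := ⟨r, h⟩ with hj
      have htw : tw (kap P Q) a j = dz P Q a r (P j) + dz P Q a r (Q j) := by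
        unfold tw dz kap
        rw [← Finset.sum_add_distrib]
        refine Finset.sum_congr rfl (fun i _ => ?_)
        have : i < j ↔ (i : ℕ) < r := Iff.rfl
        simp only [this]
        split_ifs <;> ring
      have hg : Real.pi * gamR (kap P Q) a x j =
          sg (dz P Q a r (P j) + dz P Q a r (Q j)) * (Real.pi * x j) + Real.pi * a j := by
        rw [gamR, htw]; ring
      rw [hg, Rot_add (hPQ _ _), mul_assoc (Mpre P Q x r), ← mul_assoc (Matrix.diagonal _),
        diag_Rot (hPQ _ _) (dz P Q a r), Rot_pi (hPQ _ _), mul_assoc (Rot _ _ _),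
        Matrix.diagonal_mul_diagonal, ← mul_assoc]
      congr 2
      funext i
      have hd : dz P Q a (r + 1) i = dz P Q a r i + inc P Q j i * a j := by
        unfold dz
        have : ∀ t : Fin m, (if (t : ℕ) < r + 1 then inc P Q t i * a t else 0) =
            (if (t : ℕ) < r then inc P Q t i * a t else 0) + if t = j then inc P Q j i * a j else 0 := by
          intro t
          by_cases ht : t = j
          · subst ht; simp [hj]
          · have : (t : ℕ) ≠ r := fun h' => ht (Fin.ext h')
            have : (t : ℕ) < r + 1 ↔ (t : ℕ) < r := by omega
            simp [this, ht]
        rw [Finset.sum_congr rfl (fun t _ => this t), Finset.sum_add_distrib]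
        simp
      rw [hd, sg_add]
      push_cast
      rfl
    · rw [dif_neg h, dif_neg h]
      have : dz P Q a (r + 1) = dz P Q a r := by
        funext i
        unfold dz
        refine Finset.sum_congr rfl (fun t _ => ?_)
        have h1 : (t : ℕ) < r := by omega
        have h2 : (t : ℕ) < r + 1 := by omega
        simp [h1, h2]
      simp [this]

end rot

variable {k l : ℕ}

def pI (j : Fin (k * l)) : Fin k := (finProdFinEquiv.symm j).1
def qI (j : Fin (k * l)) : Fin l := (finProdFinEquiv.symm j).2
def PP (j : Fin (k * l)) : Fin k ⊕ Fin l := Sum.inl (pI j)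
def QQ (j : Fin (k * l)) : Fin k ⊕ Fin l := Sum.inr (qI j)

lemma val_eq (j : Fin (k * l)) : (j : ℕ) = qI j + l * pI j := by
  conv_lhs => rw [← finProdFinEquiv.apply_symm_apply j]
  rfl

noncomputable def MM (x : Fin (k * l) → ℝ) : Matrix (Fin k ⊕ Fin l) (Fin k ⊕ Fin l) ℝ :=
  Mpre PP QQ x (k * l)

def del (i j : Fin (k * l)) : ℤ := if pI i = pI j then 1 else 0

lemma PQ_ne (i j : Fin (k * l)) : (PP i : Fin k ⊕ Fin l) ≠ QQ j := by simp [PP, QQ]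

lemma MM_cont : Continuous (MM : (Fin (k * l) → ℝ) → _) := Mpre_cont _ _ _

lemma MM_orth (x : Fin (k * l) → ℝ) : (MM x).transpose * MM x = 1 :=
  mul_eq_one_comm.1 (Mpre_orth _ _ PQ_ne _ _)

def sgp (a : Fin (k * l) → ℤ) (p : Fin k) : ℤ := sg (∑ i, (if pI i = p then 1 else 0) * a i)

lemma MM_equiv (a : Fin (k * l) → ℤ) (x : Fin (k * l) → ℝ) (i : Fin k ⊕ Fin l) (p : Fin k) :
    MM (gamR (kap PP QQ) a x) i (Sum.inl p) = sgp a p * MM x i (Sum.inl p) := by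
  unfold MM
  rw [Mpre_equiv _ _ PQ_ne, Matrix.mul_diagonal, mul_comm]
  congr 3
  unfold dz inc
  refine Finset.sum_congr rfl (fun j _ => ?_)
  simp [PP, QQ]

lemma chr_del (a : Fin (k * l) → ℤ) (j : Fin (k * l)) : chrR del a j = sgp a (pI j) := rfl

lemma MM_entry (x : Fin (k * l) → ℝ) (j₀ : Fin (k * l))
    (h1 : ∀ j, j < j₀ → x j = 0 ∨ qI j ≠ qI j₀) (h2 : ∀ j, j₀ < j → x j = 0 ∨ pI j ≠ pI j₀) :
    MM x (QQ j₀) (PP j₀) = Real.sin (Real.pi * x j₀) := by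
  have A : ∀ r : ℕ, r ≤ j₀ → ∀ b, Mpre PP QQ x r (QQ j₀) b = (1 : Matrix (Fin k ⊕ Fin l) (Fin k ⊕ Fin l) ℝ) (QQ j₀) b := by
    intro r
    induction r with
    | zero => intro _ b; rfl
    | succ r ih =>
      intro hr b
      have hm : r < k * l := by omega
      rw [Mpre, dif_pos hm, Matrix.mul_apply]
      simp only [ih (by omega), Matrix.one_apply, ite_mul, one_mul, zero_mul, Finset.sum_ite_eq, mem_univ, if_true]
      rw [Rot_row (PQ_ne _ _).symm, Matrix.one_apply]
      rcases h1 ⟨r, hm⟩ (Fin.lt_def.2 (by simpa using hr)) with h | h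
      · left; simp [h]
      · right; intro h'; exact h (Sum.inr_injective h').symm
  have B : ∀ r : ℕ, (j₀ : ℕ) < r → r ≤ k * l → Mpre PP QQ x r (QQ j₀) (PP j₀) = Real.sin (Real.pi * x j₀) := by
    intro r
    induction r with
    | zero => intro h; omega
    | succ r ih =>
      intro hr hrm
      have hm : r < k * l := by omega
      rw [Mpre, dif_pos hm, Matrix.mul_apply]
      by_cases hj : r = j₀
      · subst hj
        simp only [A _ le_rfl, Matrix.one_apply, ite_mul, one_mul, zero_mul, Finset.sum_ite_eq, mem_univ, if_true]
        rw [Rot_apply]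
        simp [PQ_ne, (PQ_ne _ _).symm]
      · have hlt : (j₀ : ℕ) < r := by omega
        have : ∀ b, Rot (PP ⟨r, hm⟩) (QQ ⟨r, hm⟩) (Real.pi * x ⟨r, hm⟩) b (PP j₀) = (1 : Matrix (Fin k ⊕ Fin l) (Fin k ⊕ Fin l) ℝ) b (PP j₀) := by
          intro b
          refine Rot_col (PQ_ne _ _) ?_ b
          rcases h2 ⟨r, hm⟩ (Fin.lt_def.2 hlt) with h | h
          · left; simp [h]
          · right; intro h'; exact h (Sum.inl_injective h').symm
        simp only [this, Matrix.one_apply, mul_ite, mul_one, mul_zero, Finset.sum_ite_eq', mem_univ, if_true]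
        exact ih hlt (by omega)
  exact B _ j₀.is_lt le_rfl

noncomputable def gg (x : Fin (k * l) → ℝ) : Fin (k * l) → ℝ := fun j => MM x (QQ j) (PP j)

lemma gg_cont : Continuous (gg : (Fin (k * l) → ℝ) → _) :=
  continuous_pi fun _ => MM_cont.matrix_elem _ _

lemma gg_equiv (a : Fin (k * l) → ℤ) (x : Fin (k * l) → ℝ) :
    gg (gamR (kap PP QQ) a x) = chrR del a * gg x := by
  funext j
  rw [Pi.mul_apply, chr_del]
  exact MM_equiv a x _ _

lemma gg_boundary (x : Fin (k * l) → ℝ) (hx : ‖x‖ = 1 / 2) : (0 : Fin (k * l) → ℝ) ∉ segment ℝ (gg x) x := by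
  rintro ⟨a, b, ha, hb, hab, h0⟩
  have key : ∀ n : ℕ, ∀ j : Fin (k * l), (pI j : ℕ) * l + (l - 1 - qI j) = n → x j = 0 := by
    intro n
    induction n using Nat.strong_induction_on with
    | _ n ih =>
      intro j hn
      have hq := (qI j).is_lt
      have hsin := MM_entry x j ?_ ?_
      · have h := congrFun h0 j
        simp only [Pi.add_apply, Pi.smul_apply, smul_eq_mul, gg, Pi.zero_apply, hsin] at h
        have hle : |x j| ≤ 1 / 2 := by
          rw [← hx, ← Real.norm_eq_abs]; exact norm_le_pi_norm x j
        rw [abs_le] at hle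
        have hpi := Real.pi_pos
        rcases lt_trichotomy (x j) 0 with hlt | heq | hgt
        · exfalso
          have : Real.sin (Real.pi * x j) < 0 := Real.sin_neg_of_neg_of_neg_pi_lt (by nlinarith) (by nlinarith)
          rcases ha.eq_or_lt with rfl | ha'
          · have : b = 1 := by linarith
            subst this; linarith
          · nlinarith
        · exact heq
        · exfalso
          have : 0 < Real.sin (Real.pi * x j) := Real.sin_pos_of_pos_of_lt_pi (by positivity) (by nlinarith)
          rcases ha.eq_or_lt with rfl | ha'
          · have : b = 1 := by linarith
            subst this; linarith
          · nlinarith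
      · intro i hi
        by_contra hcon
        push Not at hcon
        obtain ⟨hne, hqe⟩ := hcon
        have h1 := val_eq i
        have h2 := val_eq j
        have h3 : (i : ℕ) < j := hi
        rw [hqe] at h1
        have hlt : (pI i : ℕ) < pI j := by
          by_contra hge
          have := Nat.mul_le_mul_left l (not_lt.1 hge)
          omega
        refine hne (ih _ ?_ i rfl)
        have : ((pI i : ℕ) + 1) * l ≤ pI j * l := Nat.mul_le_mul_right l hlt
        rw [add_mul, one_mul] at this
        omega
      · intro i hi
        by_contra hcon
        push Not at hcon
        obtain ⟨hne, hpe⟩ := hcon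
        have h1 := val_eq i
        have h2 := val_eq j
        have h3 : (j : ℕ) < i := hi
        rw [hpe] at h1
        have hqi := (qI i).is_lt
        refine hne (ih _ ?_ i rfl)
        rw [hpe]
        omega
  have : x = 0 := funext fun j => key _ j rfl
  rw [this, norm_zero] at hx
  norm_num at hx

/-- the topological input -/
theorem section_zero (f : (Fin (k * l) → ℝ) → Fin (k * l) → ℝ) (hfc : Continuous f)
    (hf : ∀ a x, f (gamR (kap PP QQ) a x) = chrR del a * f x) : ∃ x, f x = 0 :=
  borsuk_ulam _ _ f gg hfc gg_cont hf gg_equiv gg_boundary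

end MKF


namespace MKF

section sect
variable {E : Type*} [NormedAddCommGroup E] [InnerProductSpace ℝ E] [FiniteDimensional ℝ E]

lemma caratheo {S : Set E} (W : Submodule ℝ E) (hS : S ⊆ W) {k : ℕ} (hW : Module.finrank ℝ W ≤ k)
    {z : E} (hz : z ∈ convexHull ℝ S) : ∃ (t : Fin (k + 1) → ℝ) (x : Fin (k + 1) → E),
      (∀ i, 0 ≤ t i) ∧ (∀ i, x i ∈ S) ∧ ∑ i, t i = 1 ∧ ∑ i, t i • x i = z := by
  classical
  rw [convexHull_eq_union] at hz
  simp only [Set.mem_iUnion] at hz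
  obtain ⟨T, hTS, hind, hz⟩ := hz
  obtain ⟨w, w0, w1, wz⟩ := Finset.mem_convexHull'.1 hz
  have hcard : Fintype.card T ≤ k + 1 := by
    refine hind.card_le_finrank_succ.trans (Nat.succ_le_succ (le_trans ?_ hW))
    apply Submodule.finrank_mono
    rw [vectorSpan_def, Submodule.span_le]
    rintro _ ⟨a, ⟨a, rfl⟩, b, ⟨b, rfl⟩, rfl⟩
    exact W.sub_mem (hS (hTS a.2)) (hS (hTS b.2))
  have hne : T.Nonempty := by
    by_contra h
    rw [Finset.not_nonempty_iff_eq_empty] at h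
    subst h
    simp at w1
  obtain ⟨y₀, hy₀⟩ := hne
  obtain ⟨e⟩ : Nonempty (T ↪ Fin (k + 1)) := Function.Embedding.nonempty_of_card_le (by simpa using hcard)
  have he := e.injective
  refine ⟨Function.extend e (fun y => w y) 0, Function.extend e (fun y => (y : E)) (fun _ => y₀), ?_, ?_, ?_, ?_⟩
  · intro i
    by_cases hi : ∃ y, e y = i
    · obtain ⟨y, rfl⟩ := hi
      rw [he.extend_apply]; exact w0 _ y.2
    · rw [Function.extend_apply' _ _ _ hi]; simp
  · intro i
    by_cases hi : ∃ y, e y = i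
    · obtain ⟨y, rfl⟩ := hi
      rw [he.extend_apply]; exact hTS y.2
    · rw [Function.extend_apply' _ _ _ hi]; exact hTS hy₀
  · rw [← w1, ← Finset.sum_coe_sort T]
    refine (Fintype.sum_of_injective e he _ _ ?_ ?_).symm
    · intro i hi
      rw [Function.extend_apply' _ _ _ hi]; simp
    · intro y; rw [he.extend_apply]
  · rw [← wz, ← Finset.sum_coe_sort T]
    refine (Fintype.sum_of_injective e he _ _ ?_ ?_).symm
    · intro i hi
      rw [Function.extend_apply' _ _ _ hi]; simp
    · intro y; rw [he.extend_apply, he.extend_apply]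

lemma compact_hull {S : Set E} (hS : IsCompact S) : IsCompact (convexHull ℝ S) := by
  set k := Module.finrank ℝ E
  have h1 : IsCompact ((stdSimplex ℝ (Fin (k + 1))) ×ˢ (Set.univ.pi fun _ : Fin (k + 1) => S)) :=
    (isCompact_stdSimplex ℝ _).prod (isCompact_univ_pi fun _ => hS)
  have h2 := h1.image (f := fun z : (Fin (k + 1) → ℝ) × (Fin (k + 1) → E) => ∑ i, z.1 i • z.2 i) (by fun_prop)
  convert h2 using 1
  ext z
  constructor
  · intro hz
    obtain ⟨t, x, t0, xS, t1, tz⟩ := caratheo (k := k) ⊤ (fun _ _ => trivial) (by simp [k]) hz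
    exact ⟨(t, x), ⟨⟨t0, t1⟩, fun i _ => xS i⟩, tz⟩
  · rintro ⟨⟨t, x⟩, ⟨⟨t0, t1⟩, hx⟩, rfl⟩
    exact (convex_convexHull ℝ S).sum_mem (fun i _ => t0 i) t1
      (fun i _ => subset_convexHull ℝ S (hx i trivial))

lemma exists_section {X : Set E} (hX : IsCompact X) :
    ∃ s : C({T : E →L[ℝ] E // (0 : E) ∉ convexHull ℝ (X ∩ {y | T y = y})}, E),
      ∀ T, ∀ y ∈ X, T.1 y = y → 0 < inner ℝ (s T) y := by
  refine exists_continuous_forall_mem_convex_of_local_const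
    (t := fun T : {T : E →L[ℝ] E // (0 : E) ∉ convexHull ℝ (X ∩ {y | T y = y})} => {s : E | ∀ y ∈ X, T.1 y = y → 0 < inner ℝ s y}) ?_ ?_
  · intro T u hu v hv a b ha hb hab y hy hT
    have h1 := hu y hy hT
    have h2 := hv y hy hT
    rw [inner_add_left, inner_smul_left, inner_smul_left]
    simp only [conj_trivial]
    rcases ha.eq_or_lt with rfl | ha
    · have : b = 1 := by linarith
      subst this; simpa using h2
    · have := mul_pos ha h1
      have := mul_nonneg hb h2.le
      linarith
  · rintro ⟨T, hT⟩
    have hc : IsCompact (X ∩ {y | T y = y}) :=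
      hX.inter_right (isClosed_eq T.continuous continuous_id)
    obtain ⟨φ, u, h0, hu⟩ := geometric_hahn_banach_point_closed (convex_convexHull ℝ _)
      (compact_hull hc).isClosed hT
    set s := (InnerProductSpace.toDual ℝ E).symm φ with hs
    have hsφ : ∀ y, inner ℝ s y = φ y := fun y => InnerProductSpace.toDual_symm_apply
    refine ⟨s, ?_⟩
    simp only [Set.mem_setOf_eq]
    refine hX.eventually_forall_of_forall_eventually
      (P := fun (T' : {T : E →L[ℝ] E // (0 : E) ∉ convexHull ℝ (X ∩ {y | T y = y})}) y => T'.1 y = y → 0 < inner ℝ s y) ?_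
    intro y hy
    by_cases hTy : T y = y
    · have : 0 < inner ℝ s y := by
        rw [hsφ]
        have := hu y (subset_convexHull ℝ _ ⟨hy, hTy⟩)
        rw [map_zero] at h0
        linarith
      have hcont : Continuous (fun z : {T : E →L[ℝ] E // (0 : E) ∉ convexHull ℝ (X ∩ {y | T y = y})} × E => inner ℝ s z.2) := by
        fun_prop
      filter_upwards [hcont.continuousAt.eventually_const_lt this] with z hz _ using hz
    · have hcont : Continuous (fun z : {T : E →L[ℝ] E // (0 : E) ∉ convexHull ℝ (X ∩ {y | T y = y})} × E => z.1.1 z.2) := by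
        fun_prop
      filter_upwards [hcont.continuousAt.eventually_ne (hcont.continuousAt.ne_iff_eventually_ne (continuous_snd.continuousAt) |>.1 hTy |>.self_of_nhds), (hcont.continuousAt.ne_iff_eventually_ne (continuous_snd.continuousAt)).1 hTy] with z _ hz h
      exact absurd h hz

/-- projection onto the span of an orthonormal family -/
noncomputable def proj {κ : Type*} [Fintype κ] (v : κ → E) : E →L[ℝ] E :=
  ∑ p, (innerSL ℝ (v p)).smulRight (v p)

lemma proj_apply {κ : Type*} [Fintype κ] (v : κ → E) (y : E) :
    proj v y = ∑ p, (inner ℝ (v p) y : ℝ) • v p := by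
  simp [proj]

lemma proj_mem {κ : Type*} [Fintype κ] (v : κ → E) {y : E} (h : proj v y = y) :
    y ∈ Submodule.span ℝ (Set.range v) := by
  rw [← h, proj_apply]
  exact Submodule.sum_mem _ (fun p _ => Submodule.smul_mem _ _ (Submodule.subset_span ⟨p, rfl⟩))

lemma proj_fix {κ : Type*} [Fintype κ] {v : κ → E} (hv : Orthonormal ℝ v) {y : E}
    (h : y ∈ Submodule.span ℝ (Set.range v)) : proj v y = y := by
  classical
  induction h using Submodule.span_induction with
  | mem x hx =>
    obtain ⟨p, rfl⟩ := hx
    rw [proj_apply]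
    simp [orthonormal_iff_ite.1 hv]
  | zero => simp
  | add x y _ _ hx hy => rw [map_add, hx, hy]
  | smul a x _ hx => rw [map_smul, hx]

lemma proj_sign {κ : Type*} [Fintype κ] (v w : κ → E) (z : κ → ℤ) (h : ∀ p, w p = (sg (z p) : ℝ) • v p) :
    proj w = proj v := by
  ext1 y
  rw [proj_apply, proj_apply]
  refine Finset.sum_congr rfl (fun p _ => ?_)
  have : ((sg (z p) : ℤ) : ℝ) * sg (z p) = 1 := by exact_mod_cast sg_sq _
  rw [h, inner_smul_left, smul_smul, conj_trivial, mul_right_comm, this, one_mul]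

lemma proj_cont {κ Z : Type*} [Fintype κ] [TopologicalSpace Z] (v : Z → κ → E)
    (hv : ∀ p, Continuous (fun x => v x p)) : Continuous (fun x => proj (v x)) := by
  rw [continuous_clm_apply]
  intro y
  simp only [proj_apply]
  exact continuous_finsetSum _ (fun p _ => ((hv p).inner continuous_const).smul (hv p))

theorem main_abs {k l : ℕ} {n : ℕ} (e : Fin k ⊕ Fin l ≃ Fin n)
    (Y : Fin l → Set (EuclideanSpace ℝ (Fin n))) (hY : ∀ i, IsCompact (Y i))
    (h0 : ∀ i, ∀ (t : Fin (k + 1) → ℝ) (x : Fin (k + 1) → EuclideanSpace ℝ (Fin n)),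
      (∀ j, 0 ≤ t j) → (∀ j, x j ∈ Y i) → ∑ j, t j = 1 → ∑ j, t j • x j ≠ 0) :
    ∃ W : Submodule ℝ (EuclideanSpace ℝ (Fin n)), Module.finrank ℝ W = k ∧ ∀ i, ∀ y ∈ Y i, y ∉ W := by
  classical
  choose s hs using fun i => exists_section (hY i)
  let v : (Fin (k * l) → ℝ) → Fin k → EuclideanSpace ℝ (Fin n) :=
    fun x p => WithLp.toLp 2 (fun i => MM x (e.symm i) (Sum.inl p))
  have hvc : ∀ p, Continuous (fun x => v x p) := by
    intro p
    refine (PiLp.continuous_toLp 2 _).comp (continuous_pi fun i => ?_)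
    exact MM_cont.matrix_elem _ _
  have hvo : ∀ x, Orthonormal ℝ (v x) := by
    intro x
    rw [orthonormal_iff_ite]
    intro p q
    have := congrFun (congrFun (MM_orth x) (Sum.inl p)) (Sum.inl q)
    rw [Matrix.mul_apply, Matrix.one_apply] at this
    simp only [Sum.inl.injEq] at this
    rw [← this, PiLp.inner_apply, ← e.symm.sum_comp]
    refine Finset.sum_congr rfl (fun i _ => ?_)
    simp [v, mul_comm]
  have hve : ∀ a x p, v (gamR (kap PP QQ) a x) p =
      (sg (∑ i, (if pI i = p then 1 else 0) * a i) : ℝ) • v x p := by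
    intro a x p
    ext i
    simp only [v, PiLp.smul_apply, smul_eq_mul]
    exact MM_equiv a x _ p
  have hdim : ∀ x, Module.finrank ℝ (Submodule.span ℝ (Set.range (v x))) = k := by
    intro x
    rw [finrank_span_eq_card (hvo x).linearIndependent, Fintype.card_fin]
  have hmem : ∀ i x, (0 : EuclideanSpace ℝ (Fin n)) ∉ convexHull ℝ (Y i ∩ {y | proj (v x) y = y}) := by
    intro i x hz
    obtain ⟨t, z, t0, zS, t1, tz⟩ := caratheo (k := k) (Submodule.span ℝ (Set.range (v x)))
      (fun y hy => proj_mem _ hy.2) (hdim x).le hz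
    exact h0 i t z t0 (fun j => (zS j).1) t1 tz
  let sv : Fin l → (Fin (k * l) → ℝ) → EuclideanSpace ℝ (Fin n) :=
    fun i x => s i ⟨proj (v x), hmem i x⟩
  let f : (Fin (k * l) → ℝ) → Fin (k * l) → ℝ :=
    fun x j => inner ℝ (sv (qI j) x) (v x (pI j))
  have hfc : Continuous f := by
    refine continuous_pi fun j => ?_
    refine Continuous.inner ?_ (hvc _)
    exact (s (qI j)).continuous.comp ((proj_cont v hvc).subtype_mk _)
  have hfe : ∀ a x, f (gamR (kap PP QQ) a x) = chrR del a * f x := by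
    intro a x
    funext j
    rw [Pi.mul_apply, chr_del]
    have : proj (v (gamR (kap PP QQ) a x)) = proj (v x) := proj_sign _ _ _ (hve a x)
    simp only [f, sv, this]
    rw [hve, inner_smul_right]
    rfl
  obtain ⟨x, hx⟩ := section_zero f hfc hfe
  · refine ⟨Submodule.span ℝ (Set.range (v x)), hdim x, ?_⟩
    intro i y hy hyW
    have h1 : 0 < inner ℝ (sv i x) y := hs i ⟨proj (v x), hmem i x⟩ y hy (proj_fix (hvo x) hyW)
    have h2 : ∀ p, inner ℝ (sv i x) (v x p) = 0 := by
      intro p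
      have := congrFun hx (finProdFinEquiv (p, i))
      have hp : pI (finProdFinEquiv (p, i)) = p := by simp [pI]
      have hq : qI (finProdFinEquiv (p, i)) = i := by simp [qI]
      simp only [f, hp, hq] at this
      exact this
    rw [← proj_fix (hvo x) hyW, proj_apply, inner_sum] at h1
    simp [inner_smul_right, h2] at h1

end sect
end MKF

theorem missing_k_flat {n k : ℕ} (hk : k ≤ n)
    (X : Fin (n - k) → Set (EuclideanSpace ℝ (Fin n)))
    (hcpt : ∀ i, IsCompact (X i))
    (p : EuclideanSpace ℝ (Fin n)) (hp : ∀ i, p ∉ convComb (k + 1) (X i)) :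
    ∃ L : AffineSubspace ℝ (EuclideanSpace ℝ (Fin n)),
      p ∈ L ∧ Module.finrank ℝ L.direction = k ∧ ∀ i, (L : Set (EuclideanSpace ℝ (Fin n))) ∩ X i = ∅ := by
  obtain ⟨W, hW, hWX⟩ := MKF.main_abs (finSumFinEquiv.trans (finCongr (Nat.add_sub_cancel' hk)))
    (fun i => (fun y => y - p) '' X i) (fun i => (hcpt i).image (by fun_prop)) (by
      intro i t x t0 hx t1 hsum
      choose z hz hzx using hx
      refine hp i ⟨t, z, t0, hz, t1, ?_⟩
      have h : ∑ j, t j • x j = ∑ j, t j • z j - p := by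
        have : ∀ j, t j • x j = t j • z j - t j • p := fun j => by rw [← hzx j, smul_sub]
        rw [Finset.sum_congr rfl (fun j _ => this j), Finset.sum_sub_distrib, ← Finset.sum_smul, t1,
          one_smul]
      rw [h] at hsum
      exact sub_eq_zero.1 hsum)
  refine ⟨AffineSubspace.mk' p W, AffineSubspace.self_mem_mk' p W, ?_, ?_⟩
  · rw [AffineSubspace.direction_mk', hW]
  · intro i
    rw [Set.eq_empty_iff_forall_notMem]
    rintro y ⟨hyL, hyX⟩
    exact hWX i (y - p) ⟨y, hyX, rfl⟩ (AffineSubspace.mem_mk'.1 hyL)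
end

section
/- Let 0 ≤ k ≤ n. If X ⊆ ℝⁿ is compact and (n−k)-convex (the image of X under every linear map ℝⁿ → ℝ^{n−k} is convex), then every point of conv X is a convex combination of at most k+1 points of X, i.e., conv_{k+1} X = conv X. -/
open Finset


theorem odd_root (p : Polynomial ℝ) (hm : p.Monic) (ho : Odd p.natDegree) :
    ∃ x, p.IsRoot x := by
  have hd : 0 < p.degree := Polynomial.natDegree_pos_iff_degree_pos.1 ho.pos
  have h1 : Filter.Tendsto (fun x => p.eval x) Filter.atTop Filter.atTop :=
    p.tendsto_atTop_of_leadingCoeff_nonneg hd (by rw [hm.leadingCoeff]; norm_num)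
  have h2 : Filter.Tendsto (fun x => p.eval x) Filter.atBot Filter.atBot := by
    have hc : (p.comp (-Polynomial.X)).natDegree = p.natDegree := by
      rw [Polynomial.natDegree_comp]; simp
    have h3 := (p.comp (-Polynomial.X)).tendsto_atBot_of_leadingCoeff_nonpos
      (Polynomial.natDegree_pos_iff_degree_pos.1 (by rw [hc]; exact ho.pos))
      (by rw [Polynomial.leadingCoeff_comp (by simp)]
          simp [hm.leadingCoeff, ho.neg_one_pow])
    have h4 := h3.comp Filter.tendsto_neg_atBot_atTop
    refine h4.congr fun x => ?_
    simp
  obtain ⟨x, hx⟩ := p.continuous.surjective h1 h2 0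
  exact ⟨x, hx⟩

theorem eig_aux {A : Type*} [CommRing A] [Algebra ℝ A] (F : Set A) (n : ℕ) :
    ∀ W : Submodule ℝ A, Module.finrank ℝ W = n → Odd n → (∀ a ∈ F, ∀ w ∈ W, a * w ∈ W) →
    ∃ v ∈ W, v ≠ 0 ∧ ∀ a ∈ F, ∃ c : ℝ, a * v = c • v := by
  induction n using Nat.strong_induction_on with
  | _ n ih =>
  intro W hW hn hF
  have hfd : FiniteDimensional ℝ W := Module.finite_of_finrank_pos (by rw [hW]; exact hn.pos)
  by_cases hs : ∀ a ∈ F, ∃ c : ℝ, ∀ w ∈ W, a * w = c • w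
  · have : Nontrivial W := Module.nontrivial_of_finrank_pos (R := ℝ) (by rw [hW]; exact hn.pos)
    obtain ⟨⟨v, hv⟩, hv0⟩ := exists_ne (0 : W)
    refine ⟨v, hv, fun h => hv0 (Subtype.ext h), fun a ha => ?_⟩
    obtain ⟨c, hc⟩ := hs a ha
    exact ⟨c, hc v hv⟩
  · push Not at hs
    obtain ⟨a, ha, hc⟩ := hs
    let T : W →ₗ[ℝ] W := (LinearMap.mulLeft ℝ a).restrict (hF a ha)
    have hT : ∀ w : W, ((T w : W) : A) = a * w := fun w => rfl
    obtain ⟨x, hx⟩ := odd_root T.charpoly T.charpoly_monic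
      (by rw [LinearMap.charpoly_natDegree, hW]; exact hn)
    have hev : Module.End.HasEigenvalue T x := by
      rwa [Module.End.hasEigenvalue_iff_isRoot_charpoly]
    let U : W →ₗ[ℝ] W := T - algebraMap ℝ _ x
    have hU : ∀ w : W, ((U w : W) : A) = a * w - x • (w : A) := fun w => by
      simp [U, hT]
    have hker0 : LinearMap.ker U ≠ ⊥ := by
      have := hev
      rw [Module.End.hasEigenvalue_iff] at this
      rwa [Module.End.eigenspace_def] at this
    have hkertop : LinearMap.ker U ≠ ⊤ := by
      intro h
      obtain ⟨w, hw, hne⟩ := hc x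
      apply hne
      have : (⟨w, hw⟩ : W) ∈ LinearMap.ker U := by rw [h]; trivial
      have h2 := hU ⟨w, hw⟩
      rw [LinearMap.mem_ker.1 this] at h2
      exact (sub_eq_zero.1 h2.symm)
    have hsum := LinearMap.finrank_range_add_finrank_ker U
    rw [hW] at hsum
    have hk1 : 0 < Module.finrank ℝ (LinearMap.ker U) := by
      exact (Module.finrank_pos_iff (R := ℝ)).2 ((Submodule.nontrivial_iff_ne_bot).2 hker0)
    have hk2 : Module.finrank ℝ (LinearMap.ker U) < n := by
      rw [← hW]; exact Submodule.finrank_lt hkertop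
    have key : ∀ K : Submodule ℝ W, Odd (Module.finrank ℝ K) → Module.finrank ℝ K < n →
        (∀ b (hb : b ∈ F), ∀ w : W, w ∈ K → (⟨b * w, hF b hb _ w.2⟩ : W) ∈ K) →
        ∃ v ∈ W, v ≠ 0 ∧ ∀ a ∈ F, ∃ c : ℝ, a * v = c • v := by
      intro K h1 h2 h3
      obtain ⟨v, hv, h⟩ := ih _ h2 (K.map W.subtype)
        (LinearEquiv.finrank_eq (Submodule.equivSubtypeMap W K)).symm h1 (by
          rintro b hb _ ⟨w, hw, rfl⟩
          exact ⟨_, h3 b hb w hw, rfl⟩)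
      obtain ⟨w, hw, rfl⟩ := hv
      exact ⟨_, w.2, h⟩
    rcases Nat.even_or_odd (Module.finrank ℝ (LinearMap.ker U)) with he | ho
    · refine key (LinearMap.range U) ?_ (by omega) ?_
      · rw [← hsum] at hn
        exact (Nat.odd_add.1 hn).2 he
      · rintro b hb _ ⟨w, rfl⟩
        refine ⟨⟨b * w, hF b hb _ w.2⟩, Subtype.ext ?_⟩
        rw [hU]
        simp only [hU, mul_sub, mul_smul_comm]
        ring_nf
    · refine key (LinearMap.ker U) ho hk2 ?_
      intro b hb w hw
      have h2 := hU w
      rw [LinearMap.mem_ker.1 hw] at h2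
      rw [LinearMap.mem_ker]
      apply Subtype.ext
      rw [hU]
      simp only [ZeroMemClass.coe_zero] at h2 ⊢
      have : b * (a * w - x • (w : A)) = 0 := by rw [← h2, mul_zero]
      rw [mul_sub, mul_smul_comm] at this
      rw [← this]; ring_nf

theorem count_odd {σ : Type*} [Fintype σ] [DecidableEq σ] (o : σ) (hc : 2 ≤ Fintype.card σ) (e : ℕ) :
    Odd (Fintype.card {b : σ → Fin (4 * e + 2) // Even (∑ i, (b i : ℕ)) ∧ ∃ i, i ≠ o ∧ b i ≠ 0}) := by
  set D := 4 * e + 2 with hD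
  rw [Fintype.card_subtype]
  have h1 : 2 * #{b : σ → Fin D | Even (∑ i, (b i : ℕ))} = D ^ Fintype.card σ := by
    have hz : ∑ b : σ → Fin D, ∏ i, (-1 : ℤ) ^ (b i : ℕ) = 0 := by
      have := (Finset.prod_univ_sum (fun _ : σ => (Finset.univ : Finset (Fin D)))
        (fun _ j => (-1 : ℤ) ^ (j : ℕ)))
      rw [Fintype.piFinset_univ] at this
      rw [← this]
      apply Finset.prod_eq_zero (Finset.mem_univ o)
      rw [Fin.sum_univ_eq_sum_range (fun j => (-1 : ℤ) ^ j), neg_one_geom_sum, if_pos]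
      exact ⟨2 * e + 1, by omega⟩
    have h2 : ∑ b : σ → Fin D, (1 + ∏ i, (-1 : ℤ) ^ (b i : ℕ)) = D ^ Fintype.card σ := by
      rw [Finset.sum_add_distrib, hz]; simp
    have h3 : ∑ b : σ → Fin D, (1 + ∏ i, (-1 : ℤ) ^ (b i : ℕ)) =
        ∑ b : σ → Fin D, if Even (∑ i, (b i : ℕ)) then (2 : ℤ) else 0 := by
      refine Finset.sum_congr rfl fun b _ => ?_
      rw [Finset.prod_pow_eq_pow_sum]
      split_ifs with h
      · rw [h.neg_one_pow]; rfl
      · rw [(Nat.not_even_iff_odd.1 h).neg_one_pow]; rfl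
    rw [h3, Finset.sum_ite] at h2
    simp at h2
    zify
    rw [← h2]; ring
  have h2 : #{b : σ → Fin D | Even (∑ i, (b i : ℕ)) ∧ ¬ ∃ i, i ≠ o ∧ b i ≠ 0} = 2 * e + 1 := by
    have : #((Finset.univ : Finset (Fin (2 * e + 1)))) = 2 * e + 1 := by simp
    rw [← this]
    symm
    apply Finset.card_bij (fun (j : Fin (2 * e + 1)) _ => Function.update (fun _ : σ => (0 : Fin D)) o ⟨2 * j, by omega⟩)
    · intro j _
      simp only [Finset.mem_filter, Finset.mem_univ, true_and]
      constructor
      · rw [Finset.sum_eq_single o]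
        · simp
        · intro b _ hb; simp [hb]
        · simp
      · rintro ⟨i, hi, h⟩; simp [hi] at h
    · intro a _ b _ h
      have := congrFun h o
      simp at this
      exact Fin.ext this
    · intro b hb
      simp only [Finset.mem_filter, Finset.mem_univ, true_and] at hb
      obtain ⟨h1, h2⟩ := hb
      push Not at h2
      rw [Finset.sum_eq_single o (fun i _ hi => by simp [h2 i hi]) (by simp)] at h1
      obtain ⟨j, hj⟩ := h1
      refine ⟨⟨j, by omega⟩, Finset.mem_univ _, ?_⟩
      ext i
      by_cases hi : i = o
      · subst hi; simp; omega
      · simp [hi, h2 i hi]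
  have h3 := Finset.card_filter_add_card_filter_not (s := (univ.filter fun b : σ → Fin D => Even (∑ i, (b i : ℕ))))
    (fun b => ∃ i, i ≠ o ∧ b i ≠ 0)
  rw [Finset.filter_filter, Finset.filter_filter, h2] at h3
  obtain ⟨c, hc⟩ := Nat.exists_eq_add_of_le hc
  rw [hc, pow_add] at h1
  have h4 : Even (#{b : σ → Fin D | Even (∑ i, (b i : ℕ))}) := by
    refine ⟨(2 * e + 1) ^ 2 * D ^ c, ?_⟩
    have : D ^ 2 = 4 * (2 * e + 1) ^ 2 := by rw [hD]; ring
    rw [this] at h1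
    linarith
  rw [← h3] at h4
  have := Nat.even_add.1 h4
  rw [← Nat.not_even_iff_odd, this]
  simp
set_option linter.unusedSectionVars false

namespace KC
open MvPolynomial

variable {σ : Type*}

/-- polynomials all of whose monomials have degree less than `n` -/
noncomputable def Low (σ : Type*) (n : ℕ) : Submodule ℝ (MvPolynomial σ ℝ) :=
  restrictSupport ℝ {s | s.degree < n}

theorem mem_Low {n : ℕ} {r : MvPolynomial σ ℝ} :
    r ∈ Low σ n ↔ ∀ s ∈ r.support, s.degree < n := by
  unfold Low
  rw [mem_restrictSupport_iff]
  rfl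

theorem Low_mono {m n : ℕ} (h : m ≤ n) : Low σ m ≤ Low σ n := fun r hr => by
  rw [mem_Low] at *
  exact fun s hs => (hr s hs).trans_le h

theorem Low_zero {r : MvPolynomial σ ℝ} (h : r ∈ Low σ 0) : r = 0 := by
  rw [mem_Low] at h
  rw [← support_eq_empty, Finset.eq_empty_iff_forall_notMem]
  intro s hs
  exact absurd (h s hs) (by omega)

theorem exists_Low (r : MvPolynomial σ ℝ) : ∃ n, r ∈ Low σ n := by
  refine ⟨r.support.sup (fun s => s.degree) + 1, mem_Low.2 fun s hs => ?_⟩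
  exact Nat.lt_succ_of_le (Finset.le_sup (f := fun s : σ →₀ ℕ => s.degree) hs)

theorem Low_mul [DecidableEq σ] {m n : ℕ} {p q : MvPolynomial σ ℝ} (hp : p ∈ Low σ m)
    (hq : q ∈ Low σ (n + 1)) : p * q ∈ Low σ (m + n) := by
  rw [mem_Low] at *
  intro s hs
  have := support_mul p q hs
  rw [Finset.mem_add] at this
  obtain ⟨a, ha, b, hb, rfl⟩ := this
  have h1 := hp a ha
  have h2 := hq b hb
  rw [map_add]
  omega

theorem mono_Low (m : σ →₀ ℕ) (c : ℝ) : monomial m c ∈ Low σ (m.degree + 1) := by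
  rw [mem_Low]
  intro s hs
  have := support_monomial_subset hs
  rw [Finset.mem_singleton] at this
  rw [this]; omega

/-- `P` equals the monomial `m` up to lower degree terms -/
def Near (m : σ →₀ ℕ) (P : MvPolynomial σ ℝ) : Prop := P - monomial m 1 ∈ Low σ m.degree

theorem Near.mul [DecidableEq σ] {m n : σ →₀ ℕ} {P Q : MvPolynomial σ ℝ} (hP : Near m P)
    (hQ : Near n Q) : Near (m + n) (P * Q) := by
  unfold Near at *
  have h : P * Q - monomial (m + n) 1 = (P - monomial m 1) * Q +
      (Q - monomial n 1) * monomial m 1 := by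
    have : monomial (m + n) (1 : ℝ) = monomial m 1 * monomial n 1 := by
      rw [monomial_mul]; simp
    rw [this]; ring
  have hQ' : Q ∈ Low σ (n.degree + 1) := by
    have : Q = (Q - monomial n 1) + monomial n 1 := by ring
    rw [this]
    exact add_mem (Low_mono (by omega) hQ) (mono_Low _ _)
  rw [h, map_add]
  refine add_mem (Low_mul hP hQ') ?_
  rw [add_comm m.degree]
  exact Low_mul hQ (mono_Low _ _)

theorem Near.one : Near (0 : σ →₀ ℕ) (1 : MvPolynomial σ ℝ) := by
  unfold Near
  simp

theorem Near.pow [DecidableEq σ] {m : σ →₀ ℕ} {P : MvPolynomial σ ℝ} (hP : Near m P) (k : ℕ) :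
    Near (k • m) (P ^ k) := by
  induction k with
  | zero => simpa using Near.one
  | succ k ih => rw [pow_succ, succ_nsmul]; exact ih.mul hP

theorem Near.prod [DecidableEq σ] {ι : Type*} (s : Finset ι) (m : ι → σ →₀ ℕ)
    (P : ι → MvPolynomial σ ℝ) (h : ∀ i ∈ s, Near (m i) (P i)) :
    Near (∑ i ∈ s, m i) (∏ i ∈ s, P i) := by
  classical
  induction s using Finset.induction_on with
  | empty => simpa using Near.one
  | insert a s ha ih =>
    rw [Finset.sum_insert ha, Finset.prod_insert ha]
    exact (h a (by simp)).mul (ih fun i hi => h i (by simp [hi]))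

variable [Fintype σ] [DecidableEq σ]

/-- image of a monomial -/
noncomputable def Tm (D : ℕ) (f : σ → MvPolynomial σ ℝ) (m : σ →₀ ℕ) : MvPolynomial σ ℝ :=
  ∏ i, (f i ^ (m i / D) * X i ^ (m i % D))

/-- the triangular linear endomorphism -/
noncomputable def T (D : ℕ) (f : σ → MvPolynomial σ ℝ) :
    MvPolynomial σ ℝ →ₗ[ℝ] MvPolynomial σ ℝ :=
  (basisMonomials σ ℝ).constr ℝ (Tm D f)

theorem T_mono (D : ℕ) (f : σ → MvPolynomial σ ℝ) (m : σ →₀ ℕ) :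
    T D f (monomial m 1) = Tm D f m := by
  have := (basisMonomials σ ℝ).constr_basis ℝ (Tm D f) m
  rw [coe_basisMonomials] at this
  exact this

theorem T_apply (D : ℕ) (f : σ → MvPolynomial σ ℝ) (r : MvPolynomial σ ℝ) :
    T D f r = ∑ m ∈ r.support, r.coeff m • Tm D f m := by
  conv_lhs => rw [r.as_sum]
  rw [map_sum]
  refine Finset.sum_congr rfl fun m _ => ?_
  rw [← T_mono, ← map_smul, smul_monomial, smul_eq_mul, mul_one]

variable {D : ℕ} {f : σ → MvPolynomial σ ℝ}

theorem Tm_near (hf : ∀ i, f i - X i ^ D ∈ Low σ D) (m : σ →₀ ℕ) : Near m (Tm D f m) := by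
  have h := Near.prod Finset.univ (fun i => (m i / D) • Finsupp.single i D +
    (m i % D) • Finsupp.single i 1) (fun i => f i ^ (m i / D) * X i ^ (m i % D)) (by
      intro i _
      refine Near.mul (Near.pow ?_ _) (Near.pow ?_ _)
      · unfold Near
        rw [← X_pow_eq_monomial]
        simpa using hf i
      · unfold Near
        simp [X])
  suffices hm : m = ∑ i, ((m i / D) • Finsupp.single i D +
      (m i % D) • Finsupp.single i 1) by
    rw [← hm] at h
    exact h
  ext j
  simp only [Finsupp.coe_finsetSum, Finset.sum_apply, Finsupp.add_apply, Finsupp.smul_apply,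
    Finsupp.single_apply, smul_eq_mul]
  rw [Finset.sum_eq_single j (fun b _ hb => by simp [hb]) (by simp)]
  simp [Nat.div_add_mod']

theorem T_low (hf : ∀ i, f i - X i ^ D ∈ Low σ D) {r : MvPolynomial σ ℝ} {n : ℕ}
    (hr : r ∈ Low σ (n + 1)) : T D f r - r ∈ Low σ n := by
  have : T D f r - r = ∑ m ∈ r.support, r.coeff m • (Tm D f m - monomial m 1) := by
    rw [T_apply]
    simp only [smul_sub, Finset.sum_sub_distrib, smul_monomial, smul_eq_mul, mul_one]
    rw [← r.as_sum]
  rw [this]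
  refine Submodule.sum_mem _ fun m hm => Submodule.smul_mem _ _ ?_
  refine Low_mono ?_ (Tm_near hf m)
  have := mem_Low.1 hr m hm
  omega

theorem T_inj (hf : ∀ i, f i - X i ^ D ∈ Low σ D) {r : MvPolynomial σ ℝ} (h : T D f r = 0) :
    r = 0 := by
  obtain ⟨n, hn⟩ := exists_Low r
  induction n with
  | zero => exact Low_zero hn
  | succ n ih =>
    apply ih
    have := T_low hf hn
    rw [h, zero_sub] at this
    simpa using this

theorem T_surj (hf : ∀ i, f i - X i ^ D ∈ Low σ D) (E : Submodule ℝ (MvPolynomial σ ℝ))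
    (hE : ∀ r ∈ E, T D f r ∈ E) {r : MvPolynomial σ ℝ} (h : r ∈ E) : ∃ s ∈ E, T D f s = r := by
  obtain ⟨n, hn⟩ := exists_Low r
  induction n generalizing r with
  | zero => exact ⟨0, zero_mem _, by rw [Low_zero hn]; simp⟩
  | succ n ih =>
    obtain ⟨s, hs, h2⟩ := ih (sub_mem (hE r h) h) (T_low hf hn)
    exact ⟨r - s, sub_mem h hs, by rw [map_sub, h2]; ring⟩

theorem Tm_add (hD : 0 < D) (i : σ) (m : σ →₀ ℕ) :
    Tm D f (Finsupp.single i D + m) = f i * Tm D f m := by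
  unfold Tm
  rw [← Finset.mul_prod_erase _ _ (Finset.mem_univ i),
    ← Finset.mul_prod_erase _ (fun j => f j ^ (m j / D) * X j ^ (m j % D)) (Finset.mem_univ i)]
  have : ∀ j ∈ Finset.univ.erase i, (Finsupp.single i D + m) j = m j := by
    intro j hj
    have : i ≠ j := (Finset.ne_of_mem_erase hj).symm
    simp [this]
  rw [Finset.prod_congr rfl fun j hj => by rw [this j hj]]
  have h2 : (D + m i) / D = m i / D + 1 := by rw [Nat.add_div_left _ hD]
  simp only [Finsupp.add_apply, Finsupp.single_eq_same, h2, Nat.add_mod_left]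
  ring

theorem T_mul (hD : 0 < D) (i : σ) (r : MvPolynomial σ ℝ) :
    T D f (X i ^ D * r) = f i * T D f r := by
  induction r using MvPolynomial.induction_on' with
  | add p q hp hq => rw [mul_add, map_add, map_add, mul_add, hp, hq]
  | monomial m b =>
    have h := Tm_add (f := f) hD i m
    rw [← T_mono, ← T_mono] at h
    have h2 : X i ^ D * monomial m b =
        b • (monomial (Finsupp.single i D + m) 1 : MvPolynomial σ ℝ) := by
      rw [X_pow_eq_monomial, monomial_mul, smul_monomial]; simp
    have h3 : (monomial m b : MvPolynomial σ ℝ) = b • monomial m 1 := by rw [smul_monomial]; simp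
    rw [h2, h3, map_smul, map_smul, h, mul_smul_comm]

/-- an element of `J` is a polynomial all of whose monomials are divisible by some `X i ^ D`. -/
theorem T_mem_I (hD : 0 < D) (hf : ∀ i, f i - X i ^ D ∈ Low σ D) (r : MvPolynomial σ ℝ) :
    T D f r ∈ Ideal.span (Set.range f) ↔ ∀ m ∈ r.support, ∃ i, D ≤ m i := by
  constructor
  · intro h
    rw [Ideal.mem_span_range_iff_exists_fun] at h
    obtain ⟨c, hc⟩ := h
    have := fun i => T_surj hf ⊤ (by simp) (r := c i) trivial
    choose s _ hs using this
    have h2 : r = ∑ i, X i ^ D * s i := by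
      rw [← sub_eq_zero]
      apply T_inj hf
      rw [map_sub, map_sum, sub_eq_zero, ← hc]
      refine Finset.sum_congr rfl fun i _ => ?_
      rw [T_mul hD, hs, mul_comm]
    have h3 : r ∈ Ideal.span ((fun s => monomial s (1 : ℝ)) '' (Set.range fun i : σ => Finsupp.single i D)) := by
      rw [h2]
      refine Ideal.sum_mem _ fun i _ => Ideal.mul_mem_right _ _ (Ideal.subset_span ?_)
      exact ⟨_, ⟨i, rfl⟩, by rw [X_pow_eq_monomial]⟩
    rw [mem_ideal_span_monomial_image] at h3
    intro m hm
    obtain ⟨_, ⟨i, rfl⟩, h⟩ := h3 m hm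
    exact ⟨i, by simpa using h i⟩
  · intro h
    rw [T_apply]
    refine Submodule.sum_mem _ fun m hm => ?_
    obtain ⟨i, hi⟩ := h m hm
    rw [Algebra.smul_def]
    refine Ideal.mul_mem_left _ _ ?_
    have : m = Finsupp.single i D + (m - Finsupp.single i D) := by
      rw [add_tsub_cancel_of_le]; simpa using hi
    rw [this, Tm_add hD]
    exact Ideal.mul_mem_right _ _ (Ideal.subset_span ⟨i, rfl⟩)

end KC
set_option linter.unusedSectionVars false

namespace KC
open MvPolynomial

/-- parity weight -/
def pw (σ : Type*) : σ → ZMod 2 := fun _ => 1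

/-- ideal generated by variables other than `o` -/
noncomputable def xI {σ : Type*} (o : σ) : Ideal (MvPolynomial σ ℝ) := Ideal.span (X '' {i | i ≠ o})

/-- even polynomials in the ideal -/
noncomputable def EE {σ : Type*} (o : σ) : Submodule ℝ (MvPolynomial σ ℝ) :=
  weightedHomogeneousSubmodule ℝ (pw σ) 0 ⊓ (xI o).restrictScalars ℝ

theorem mem_EE {σ : Type*} {o : σ} {r : MvPolynomial σ ℝ} :
    r ∈ EE o ↔ IsWeightedHomogeneous (pw σ) r 0 ∧ r ∈ xI o := by
  unfold EE
  rw [Submodule.mem_inf, mem_weightedHomogeneousSubmodule]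
  rfl

variable {σ : Type*} [Fintype σ] [DecidableEq σ]


theorem weight_pw (m : σ →₀ ℕ) : Finsupp.weight (pw σ) m = ((∑ i, m i : ℕ) : ZMod 2) := by
  rw [Finsupp.weight_apply, Finsupp.sum_fintype _ _ (by simp)]
  simp [pw]

theorem Tm_EE {D : ℕ} {f : σ → MvPolynomial σ ℝ} (hD : Even D) (o : σ)
    (he : ∀ i, IsWeightedHomogeneous (pw σ) (f i) 0) (hx : ∀ i, i ≠ o → f i ∈ xI o)
    {m : σ →₀ ℕ} (hm : Finsupp.weight (pw σ) m = 0) (hm2 : ∃ i, i ≠ o ∧ m i ≠ 0) :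
    Tm D f m ∈ EE o := by
  rw [mem_EE]
  constructor
  · have h := IsWeightedHomogeneous.prod Finset.univ
      (fun i => f i ^ (m i / D) * X i ^ (m i % D))
      (fun i => (m i / D) • (0 : ZMod 2) + (m i % D) • (1 : ZMod 2)) (w := pw σ)
      (fun i _ => ((he i).pow _).mul ((isWeightedHomogeneous_X ℝ (pw σ) i).pow _))
    have h2 : ∑ i, ((m i / D) • (0 : ZMod 2) + (m i % D) • (1 : ZMod 2)) = 0 := by
      have hm' := hm
      rw [weight_pw] at hm'
      refine Eq.trans ?_ hm'
      push_cast
      refine Finset.sum_congr rfl fun i _ => ?_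
      obtain ⟨c, hc⟩ := hD
      have h3 : ((m i : ℕ) : ZMod 2) = ((D * (m i / D) + m i % D : ℕ) : ZMod 2) := by
        rw [Nat.div_add_mod]
      have h4 : (D : ZMod 2) = 0 := by
        rw [ZMod.natCast_eq_zero_iff]; exact ⟨c, by omega⟩
      rw [h3]
      push_cast
      simp [h4]
    rw [h2] at h
    exact h
  · obtain ⟨i, hi, h0⟩ := hm2
    unfold Tm
    rw [← Finset.mul_prod_erase _ _ (Finset.mem_univ i)]
    apply Ideal.mul_mem_right
    by_cases h : m i / D = 0
    · apply Ideal.mul_mem_left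
      apply Ideal.pow_mem_of_mem
      · exact Ideal.subset_span ⟨i, hi, rfl⟩
      · rw [Nat.pos_iff_ne_zero]
        intro h2
        have := Nat.div_add_mod (m i) D
        rw [h, h2] at this
        simp at this
        omega
    · apply Ideal.mul_mem_right
      exact Ideal.pow_mem_of_mem _ (hx i hi) _ (Nat.pos_of_ne_zero h)

theorem EE_supp {o : σ} {r : MvPolynomial σ ℝ} (hr : r ∈ EE o) {m : σ →₀ ℕ} (hm : m ∈ r.support) :
    Finsupp.weight (pw σ) m = 0 ∧ ∃ i, i ≠ o ∧ m i ≠ 0 := by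
  rw [mem_EE] at hr
  refine ⟨hr.1 (mem_support_iff.1 hm), ?_⟩
  obtain ⟨i, h1, h2⟩ := mem_ideal_span_X_image.1 hr.2 m hm
  exact ⟨i, h1, h2⟩

theorem T_EE {D : ℕ} {f : σ → MvPolynomial σ ℝ} (hD : Even D) (o : σ)
    (he : ∀ i, IsWeightedHomogeneous (pw σ) (f i) 0) (hx : ∀ i, i ≠ o → f i ∈ xI o)
    (r : MvPolynomial σ ℝ) (hr : r ∈ EE o) : T D f r ∈ EE o := by
  rw [T_apply]
  refine Submodule.sum_mem _ fun m hm => Submodule.smul_mem _ _ ?_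
  have := EE_supp hr hm
  exact Tm_EE hD o he hx this.1 this.2

/-- index set of normal monomials -/
abbrev BB (o : σ) (e : ℕ) :=
  {b : σ → Fin (4 * e + 2) // Even (∑ i, (b i : ℕ)) ∧ ∃ i, i ≠ o ∧ b i ≠ 0}

/-- exponent vector of a normal monomial -/
noncomputable def bexp {o : σ} {e : ℕ} (b : BB o e) : σ →₀ ℕ :=
  Finsupp.equivFunOnFinite.symm fun i => (b.1 i : ℕ)

theorem bexp_apply {o : σ} {e : ℕ} (b : BB o e) (i : σ) : bexp b i = b.1 i := rfl

theorem bexp_inj {o : σ} {e : ℕ} : Function.Injective (bexp : BB o e → σ →₀ ℕ) := by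
  intro a b h
  apply Subtype.ext
  funext i
  apply Fin.ext
  exact DFunLike.congr_fun h i

theorem main_dim (o : σ) (hc : 2 ≤ Fintype.card σ) (e : ℕ) (f : σ → MvPolynomial σ ℝ)
    (hf : ∀ i, f i - X i ^ (4 * e + 2) ∈ Low σ (4 * e + 2))
    (he : ∀ i, IsWeightedHomogeneous (pw σ) (f i) 0) (hx : ∀ i, i ≠ o → f i ∈ xI o) :
    Odd (Module.finrank ℝ ((EE o).map (Ideal.Quotient.mkₐ ℝ (Ideal.span (Set.range f))).toLinearMap)) := by
  have hD : Even (4 * e + 2) := ⟨2 * e + 1, by omega⟩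
  set D := 4 * e + 2 with hDD
  set I := Ideal.span (Set.range f)
  set π := (Ideal.Quotient.mkₐ ℝ I).toLinearMap
  have hπ : ∀ a, π a = 0 ↔ a ∈ I := fun a => Ideal.Quotient.eq_zero_iff_mem
  let v : BB o e → (MvPolynomial σ ℝ ⧸ I) := fun b => π (T D f (monomial (bexp b) 1))
  have hspan : (EE o).map π = Submodule.span ℝ (Set.range v) := by
    apply le_antisymm
    · rintro _ ⟨r, hr, rfl⟩
      obtain ⟨s, hs, rfl⟩ := T_surj hf (EE o) (T_EE hD o he hx) hr
      rw [T_apply, map_sum]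
      refine Submodule.sum_mem _ fun m hm => ?_
      rw [map_smul]
      apply Submodule.smul_mem
      rw [← T_mono]
      by_cases hJ : ∃ i, D ≤ m i
      · rw [(hπ _).2 ((T_mem_I (by omega) hf _).2 ?_)]
        · exact zero_mem _
        · intro m' hm'
          have := support_monomial_subset hm'
          rw [Finset.mem_singleton] at this
          rw [this]; exact hJ
      · push Not at hJ
        have h2 := EE_supp hs hm
        refine Submodule.subset_span ⟨⟨fun i => ⟨m i, hJ i⟩, ?_, ?_⟩, ?_⟩
        · have := h2.1
          rw [weight_pw, ZMod.natCast_eq_zero_iff_even] at this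
          exact this
        · obtain ⟨i, hi, h3⟩ := h2.2
          refine ⟨i, hi, fun h => h3 ?_⟩
          have := congrArg Fin.val h
          simpa using this
        · have : bexp (⟨fun i => ⟨m i, hJ i⟩, by
            have := h2.1
            rw [weight_pw, ZMod.natCast_eq_zero_iff_even] at this
            exact this, by
              obtain ⟨i, hi, h3⟩ := h2.2
              refine ⟨i, hi, fun h => h3 ?_⟩
              have := congrArg Fin.val h
              simpa using this⟩ : BB o e) = m := by
            ext i; rfl
          simp only [v, this]
    · rw [Submodule.span_le]
      rintro _ ⟨b, rfl⟩
      refine ⟨_, ?_, rfl⟩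
      rw [T_mono]
      refine Tm_EE hD o he hx ?_ ?_
      · rw [weight_pw, ZMod.natCast_eq_zero_iff_even]
        exact b.2.1
      · obtain ⟨i, hi, h⟩ := b.2.2
        refine ⟨i, hi, fun h2 => h (Fin.ext ?_)⟩
        rw [bexp_apply] at h2
        simpa using h2
  have hli : LinearIndependent ℝ v := by
    rw [Fintype.linearIndependent_iff]
    intro g hg b
    have h1 : ∑ b, g b • v b = π (T D f (∑ b, monomial (bexp b) (g b))) := by
      rw [map_sum, map_sum]
      refine Finset.sum_congr rfl fun b _ => ?_
      simp only [v]
      rw [← map_smul, ← map_smul, smul_monomial, smul_eq_mul, mul_one]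
    rw [h1, hπ, T_mem_I (by omega) hf] at hg
    have h2 : coeff (bexp b) (∑ b, monomial (bexp b) (g b)) = g b := by
      rw [coeff_sum, Finset.sum_eq_single b]
      · simp
      · intro b' _ hb'
        rw [coeff_monomial, if_neg]
        exact fun h => hb' (bexp_inj h)
      · simp
    by_contra h3
    obtain ⟨i, hi⟩ := hg (bexp b) (by rw [mem_support_iff, h2]; exact h3)
    rw [bexp_apply] at hi
    have := (b.1 i).2
    omega
  rw [hspan, finrank_span_eq_card hli]
  exact count_odd o hc e

theorem even_odd_split {o : σ} {a : MvPolynomial σ ℝ} (ha : a ∈ xI o) :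
    ∃ a0 a1, a = a0 + a1 ∧ a0 ∈ EE o ∧ a1 ∈ xI o ∧ IsWeightedHomogeneous (pw σ) a1 1 := by
  refine ⟨weightedHomogeneousComponent (pw σ) 0 a, weightedHomogeneousComponent (pw σ) 1 a,
    ?_, ?_, ?_, weightedHomogeneousComponent_isWeightedHomogeneous 1 a⟩
  · ext m
    rw [coeff_add, coeff_weightedHomogeneousComponent, coeff_weightedHomogeneousComponent]
    generalize Finsupp.weight (pw σ) m = t
    have ht : t = 0 ∨ t = 1 := by revert t; decide
    rcases ht with rfl | rfl <;> simp
  · rw [mem_EE]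
    refine ⟨weightedHomogeneousComponent_isWeightedHomogeneous 0 a, ?_⟩
    refine mem_ideal_span_X_image.2 fun m hm => mem_ideal_span_X_image.1 ha m ?_
    rw [support_weightedHomogeneousComponent] at hm
    exact (Finset.mem_filter.1 hm).1
  · refine mem_ideal_span_X_image.2 fun m hm => mem_ideal_span_X_image.1 ha m ?_
    rw [support_weightedHomogeneousComponent] at hm
    exact (Finset.mem_filter.1 hm).1

theorem alg0 (o : σ) (hc : 2 ≤ Fintype.card σ) (e : ℕ) (f : σ → MvPolynomial σ ℝ)
    (hf : ∀ i, f i - X i ^ (4 * e + 2) ∈ Low σ (4 * e + 2))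
    (he : ∀ i, IsWeightedHomogeneous (pw σ) (f i) 0) (hx : ∀ i, i ≠ o → f i ∈ xI o)
    (hid : ∀ i, i ≠ o → X i ∈ xI o * xI o ⊔ Ideal.span (Set.range f))
    (ho : f o = X o ^ (4 * e + 2) + ∑ i ∈ Finset.univ.erase o, X i ^ 2 - 1) :
    ∃ z : σ → ℝ, (∃ i, i ≠ o ∧ z i ≠ 0) ∧ ∀ i, eval z (f i) = 0 := by
  have hdim := main_dim o hc e f hf he hx
  set I := Ideal.span (Set.range f) with hI
  set q := Ideal.Quotient.mkₐ ℝ I with hq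
  have hq0 : ∀ a, q a = 0 ↔ a ∈ I := fun a => Ideal.Quotient.eq_zero_iff_mem
  obtain ⟨v, ⟨r, hr, hrv⟩, hv0, hv⟩ := eig_aux (q '' {a | IsWeightedHomogeneous (pw σ) a 0}) _
    ((EE o).map q.toLinearMap) rfl hdim (by
      rintro _ ⟨a, ha, rfl⟩ _ ⟨w, hw, rfl⟩
      refine ⟨a * w, ?_, by simp⟩
      have h2 := mem_EE.1 hw
      refine mem_EE.2 ⟨?_, Ideal.mul_mem_left _ _ h2.2⟩
      simpa using IsWeightedHomogeneous.mul ha h2.1)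
  have hv' : ∀ a, IsWeightedHomogeneous (pw σ) a 0 → ∃ c : ℝ, q a * v = c • v :=
    fun a ha => hv _ ⟨a, ha, rfl⟩
  -- some element of `EE` acts non trivially
  have hne : ∃ a ∈ EE o, q a * v ≠ 0 := by
    by_contra hcon
    push Not at hcon
    have hidem : IsIdempotentElem ((xI o).map q) := by
      apply le_antisymm
      · exact Ideal.mul_le_left
      · unfold xI
        rw [Ideal.map_span, Ideal.span_le]
        rintro _ ⟨_, ⟨i, hi, rfl⟩, rfl⟩
        have := Ideal.mem_map_of_mem q (hid i hi)
        rw [Ideal.map_sup, Ideal.map_mul] at this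
        have h2 : Ideal.map q I = ⊥ := by
          rw [Ideal.map_eq_bot_iff_le_ker]
          intro a ha
          exact (hq0 a).2 ha
        rw [h2, sup_bot_eq] at this
        unfold xI at this
        rw [Ideal.map_span] at this
        exact this
    have hfg : ((xI o).map q).FG := by
      apply Ideal.FG.map
      exact ⟨(Finset.univ.erase o).image X, by unfold xI; congr 1; ext; simp⟩
    obtain ⟨ε, hε, hε2⟩ := (Ideal.isIdempotentElem_iff_of_fg _ hfg).1 hidem
    have hεm : ε ∈ (xI o).map q := by rw [hε2]; exact Submodule.mem_span_singleton_self ε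
    have hvm : v ∈ (xI o).map q := by
      rw [← hrv]; exact Ideal.mem_map_of_mem q (mem_EE.1 hr).2
    have hεv : ε * v = v := by
      rw [hε2, Submodule.mem_span_singleton] at hvm
      obtain ⟨a, rfl⟩ := hvm
      rw [smul_eq_mul, mul_left_comm, hε.eq]
    obtain ⟨a, ha, rfl⟩ := (Ideal.mem_map_iff_of_surjective q (Ideal.Quotient.mkₐ_surjective ℝ I)).1 hεm
    obtain ⟨a0, a1, rfl, h0, h1, h1'⟩ := even_odd_split ha
    have h2 : q (a0) * v = 0 := hcon _ h0
    have h3 : q (a1 * a1) * v = 0 := hcon _ (mem_EE.2 ⟨by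
      have := h1'.mul h1'
      have h11 : (1 : ZMod 2) + 1 = 0 := by decide
      rwa [h11] at this, Ideal.mul_mem_left _ _ h1⟩)
    rw [map_add, add_mul, h2, zero_add] at hεv
    rw [map_mul, mul_assoc, hεv, hεv] at h3
    exact hv0 h3
  have hXX : ∀ i j, IsWeightedHomogeneous (pw σ) (X i * X j : MvPolynomial σ ℝ) 0 := by
    intro i j
    have := (isWeightedHomogeneous_X ℝ (pw σ) i).mul (isWeightedHomogeneous_X ℝ (pw σ) j)
    have h11 : pw σ i + pw σ j = 0 := by unfold pw; decide
    rwa [h11] at this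
  choose c hcc using fun i j => hv' _ (hXX i j)
  have hpos : ∃ j, 0 < c j j := by
    by_contra hcon
    push Not at hcon
    have h1 : q (f o) * v = 0 := by
      rw [(hq0 _).2 (Ideal.subset_span ⟨o, rfl⟩), zero_mul]
    have h2 : ∀ k : ℕ, q (X o ^ (2 * k)) * v = (c o o) ^ k • v := by
      intro k
      induction k with
      | zero => simp
      | succ k ih =>
        have : (X o ^ (2 * (k + 1)) : MvPolynomial σ ℝ) = X o ^ (2 * k) * (X o * X o) := by ring
        rw [this, map_mul, mul_assoc, hcc, mul_smul_comm, ih, smul_smul, pow_succ, mul_comm]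
    have h3 : q (f o) * v = ((c o o) ^ (2 * e + 1) + ∑ i ∈ Finset.univ.erase o, c i i - 1) • v := by
      have : 4 * e + 2 = 2 * (2 * e + 1) := by ring
      rw [ho, this, map_sub, map_add, sub_mul, add_mul, h2, map_sum, Finset.sum_mul, sub_smul,
        add_smul, Finset.sum_smul]
      congr 1
      · congr 1
        refine Finset.sum_congr rfl fun i _ => ?_
        rw [← hcc, pow_two]
      · simp
    rw [h3, smul_eq_zero] at h1
    have h4 := h1.resolve_right hv0
    have h5 : (c o o) ^ (2 * e + 1) ≤ 0 := Odd.pow_nonpos ⟨e, rfl⟩ (hcon o)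
    have h6 : ∑ i ∈ Finset.univ.erase o, c i i ≤ 0 := Finset.sum_nonpos fun i _ => hcon i
    linarith
  obtain ⟨j, hj⟩ := hpos
  -- choose a square root
  obtain ⟨s, hs, hu0⟩ : ∃ s : ℝ, s * s = c j j ∧ q (X j) * v + s • v ≠ 0 := by
    by_cases h : q (X j) * v + (√(c j j)) • v = 0
    · refine ⟨-√(c j j), by rw [neg_mul_neg, Real.mul_self_sqrt hj.le], fun h2 => ?_⟩
      have h3 : (2 * √(c j j)) • v = 0 := by
        have := congrArg₂ (· - ·) h h2
        simp only [sub_zero] at this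
        rw [← this, two_mul, add_smul, neg_smul]; abel
      rw [smul_eq_zero] at h3
      have := Real.sqrt_pos.2 hj
      exact h3.elim (fun h => by linarith) hv0
    · exact ⟨_, Real.mul_self_sqrt hj.le, h⟩
  have hs0 : s ≠ 0 := by rintro rfl; simp at hs; linarith
  set u := q (X j) * v + s • v with hu
  let z : σ → ℝ := fun i => c i j / s
  have hz : ∀ i, q (X i) * u = z i • u := by
    intro i
    have h1 : q (X i) * (q (X j) * v) = c i j • v := by rw [← mul_assoc, ← map_mul, hcc]
    have h2 : q (X i) * v = (c i j / c j j) • (q (X j) * v) := by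
      have : c j j • (q (X i) * v) = c i j • (q (X j) * v) := by
        rw [← mul_smul_comm, ← hcc, ← mul_smul_comm, ← hcc, map_mul, map_mul]; ring
      rw [div_eq_inv_mul, mul_smul, ← this, smul_smul, inv_mul_cancel₀ hj.ne', one_smul]
    rw [hu, mul_add, h1, mul_smul_comm, h2, smul_add, smul_smul, smul_smul, add_comm]
    congr 2
    · rw [← hs]; simp only [z]; field_simp
    · simp only [z]; field_simp
  have hev : ∀ a, q a * u = (eval z a) • u := by
    intro a
    induction a using MvPolynomial.induction_on with
    | C a =>
      rw [eval_C, ← algebraMap_eq, AlgHom.commutes]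
      exact (Algebra.smul_def a u).symm
    | add p r hp hr => rw [map_add, add_mul, hp, hr, map_add, add_smul]
    | mul_X p i hp => rw [map_mul, mul_assoc, hz, mul_smul_comm, hp, map_mul, eval_X, smul_smul, mul_comm]
  refine ⟨z, ?_, fun i => ?_⟩
  · obtain ⟨a, ha, hav⟩ := hne
    obtain ⟨t, ht⟩ := hv' a (mem_EE.1 ha).1
    by_contra hcon
    push Not at hcon
    have h1 : eval z a = 0 := by
      have : xI o ≤ RingHom.ker (eval z) := by
        unfold xI
        rw [Ideal.span_le]
        rintro _ ⟨i, hi, rfl⟩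
        simpa using hcon i hi
      exact this (mem_EE.1 ha).2
    have h2 : q a * u = t • u := by
      rw [hu, mul_add, mul_left_comm, ht, mul_smul_comm, mul_smul_comm, ht, smul_add, smul_comm t s]
    rw [hev, h1, zero_smul] at h2
    have h3 := (smul_eq_zero.1 h2.symm).resolve_right hu0
    rw [ht, h3, zero_smul] at hav
    exact hav rfl
  · have h1 := hev (f i)
    rw [(hq0 _).2 (Ideal.subset_span ⟨i, rfl⟩), zero_mul] at h1
    exact (smul_eq_zero.1 h1.symm).resolve_right hu0

end KC

namespace KC
open MvPolynomial

theorem homog_degree {σ : Type*} {p : MvPolynomial σ ℝ} {n : ℕ} (h : p.IsHomogeneous n)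
    {s : σ →₀ ℕ} (hs : coeff s p ≠ 0) : s.degree = n := by
  rw [← h hs]
  exact DFunLike.congr_fun (Finsupp.degree_eq_weight_one (R := ℕ)) s

theorem homog_low {σ : Type*} {p : MvPolynomial σ ℝ} {n m : ℕ} (h : p.IsHomogeneous n)
    (hn : n < m) : p ∈ Low σ m := by
  rw [mem_Low]
  intro s hs
  have := homog_degree h (mem_support_iff.1 hs)
  omega

theorem homog_even {σ : Type*} [Fintype σ] {p : MvPolynomial σ ℝ} {n : ℕ} (h : p.IsHomogeneous n)
    (hn : Even n) : IsWeightedHomogeneous (pw σ) p 0 := by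
  classical
  intro s hs
  have := homog_degree h (hs)
  rw [weight_pw, ZMod.natCast_eq_zero_iff_even, ← Finsupp.degree_eq_sum, this]
  exact hn

theorem exists_pos_of_degree {σ : Type*} {u : σ →₀ ℕ} (h : 0 < u.degree) :
    ∃ i u', u = Finsupp.single i 1 + u' := by
  have : u ≠ 0 := by rintro rfl; simp at h
  obtain ⟨i, hi⟩ := Finsupp.ne_iff.1 this
  refine ⟨i, u - Finsupp.single i 1, ?_⟩
  rw [add_tsub_cancel_of_le]
  simp at hi
  simp; omega

theorem homog_xI {N : ℕ} {p : MvPolynomial (Fin N) ℝ} {n : ℕ} (h : p.IsHomogeneous n)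
    (hn : 2 ≤ n) : rename some p ∈ xI (none : Option (Fin N)) * xI none := by
  rw [p.as_sum, map_sum]
  refine Submodule.sum_mem _ fun u hu => ?_
  have := homog_degree h (mem_support_iff.1 hu)
  obtain ⟨i, u', h1⟩ := exists_pos_of_degree (u := u) (by omega)
  obtain ⟨j, u'', h2⟩ := exists_pos_of_degree (u := u') (by
    rw [h1, map_add] at this; simp at this; omega)
  have h3 : monomial u (coeff u p) = X i * X j * monomial u'' (coeff u p) := by
    rw [X, X, monomial_mul, monomial_mul]
    simp only [mul_one, one_mul]
    congr 2
    rw [h1, h2, add_assoc]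
  rw [h3, map_mul, map_mul, rename_X, rename_X]
  apply Ideal.mul_mem_right
  exact Ideal.mul_mem_mul (Ideal.subset_span ⟨some i, by simp, rfl⟩)
    (Ideal.subset_span ⟨some j, by simp, rfl⟩)

theorem alg1 {N : ℕ} (hN : 1 ≤ N) (e : ℕ) (he : 1 ≤ e) (p : Fin N → MvPolynomial (Fin N) ℝ)
    (hp : ∀ i, (p i).IsHomogeneous (4 * e)) (ε : ℝ) (hε : 0 < ε) :
    ∃ x : Fin N → ℝ, x ≠ 0 ∧ ∑ i, x i ^ 2 ≤ 1 ∧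
      ∃ l : ℝ, ∀ i, l * x i = eval x (p i) + ε * x i ^ (4 * e + 2) := by
  let f : Option (Fin N) → MvPolynomial (Option (Fin N)) ℝ := fun a => match a with
    | none => X none ^ (4 * e + 2) + ∑ i ∈ Finset.univ.erase none, X i ^ 2 - 1
    | some i => X (some i) ^ (4 * e + 2) + C ε⁻¹ * (rename some (p i) - X none * X (some i))
  have hfn : f none = X none ^ (4 * e + 2) + ∑ i ∈ Finset.univ.erase none, X i ^ 2 - 1 := rfl
  have hfs : ∀ i, f (some i) = X (some i) ^ (4 * e + 2) +
    C ε⁻¹ * (rename some (p i) - X none * X (some i)) := fun _ => rfl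
  have hr : ∀ i, (rename (some : Fin N → Option (Fin N)) (p i)).IsHomogeneous (4 * e) :=
    fun i => (hp i).rename_isHomogeneous
  have hXX : ∀ i j : Option (Fin N), (X i * X j : MvPolynomial (Option (Fin N)) ℝ).IsHomogeneous 2 :=
    fun i j => (isHomogeneous_X ℝ i).mul (isHomogeneous_X ℝ j)
  have hXp : ∀ (i : Option (Fin N)) n, (X i ^ n : MvPolynomial (Option (Fin N)) ℝ).IsHomogeneous n :=
    fun i n => isHomogeneous_X_pow i n
  have hX : ∀ i, X (some i) ∈ xI (none : Option (Fin N)) :=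
    fun i => Ideal.subset_span ⟨some i, by simp, rfl⟩
  have hX2 : ∀ i n, 2 ≤ n → X (some i) ^ n ∈ xI (none : Option (Fin N)) * xI none := by
    intro i n hn
    obtain ⟨k, rfl⟩ := Nat.exists_eq_add_of_le hn
    rw [pow_add, pow_two]
    exact Ideal.mul_mem_right _ _ (Ideal.mul_mem_mul (hX i) (hX i))
  obtain ⟨z, ⟨i0, hi0, hz0⟩, hz⟩ := alg0 (none : Option (Fin N)) (by simp; omega) e f
    (by
      rintro (_ | i)
      · rw [hfn]
        have : (X none ^ (4 * e + 2) + ∑ i ∈ Finset.univ.erase none, X i ^ 2 - 1 -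
            X none ^ (4 * e + 2) : MvPolynomial (Option (Fin N)) ℝ) =
            ∑ i ∈ Finset.univ.erase none, X i ^ 2 - 1 := by ring
        rw [this]
        refine sub_mem (Submodule.sum_mem _ fun i _ => homog_low (hXp i 2) (by omega))
          (homog_low (isHomogeneous_one _ _) (by omega))
      · rw [hfs, add_sub_cancel_left, C_mul']
        exact Submodule.smul_mem _ _ (sub_mem (homog_low (hr i) (by omega))
          (homog_low (hXX _ _) (by omega))))
    (by
      have h2 : Even (4 * e + 2) := ⟨2 * e + 1, by omega⟩
      rintro (_ | i)
      · rw [hfn]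
        exact ((homog_even (hXp _ _) h2).add (IsWeightedHomogeneous.sum _ _ _
          fun i _ => homog_even (hXp i 2) (by decide))).sub (isWeightedHomogeneous_one ℝ _)
      · rw [hfs]
        exact (homog_even (hXp _ _) h2).add (((homog_even (hr i) ⟨2 * e, by omega⟩).sub
          (homog_even (hXX _ _) (by decide))).C_mul _))
    (by
      rintro (_ | i) hi
      · exact absurd rfl hi
      · rw [hfs]
        exact add_mem (Ideal.mul_le_left (hX2 i _ (by omega))) (Ideal.mul_mem_left _ _
          (sub_mem (Ideal.mul_le_left (homog_xI (hp i) (by omega))) (Ideal.mul_mem_left _ _ (hX i)))))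
    (by
      rintro (_ | i) hi
      · exact absurd rfl hi
      · have h0 : f none ∈ Ideal.span (Set.range f) := Ideal.subset_span ⟨none, rfl⟩
        have h1 : f (some i) ∈ Ideal.span (Set.range f) := Ideal.subset_span ⟨some i, rfl⟩
        have hC : (C ε * C ε⁻¹ : MvPolynomial (Option (Fin N)) ℝ) = 1 := by
          rw [← C_mul, mul_inv_cancel₀ hε.ne', C_1]
        have key : (X (some i) : MvPolynomial (Option (Fin N)) ℝ) =
            (X none ^ (4 * e + 1) * (rename some (p i) + C ε * X (some i) ^ (4 * e + 2)) +
              X (some i) * ∑ i ∈ Finset.univ.erase none, X i ^ 2) +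
            (- (X none ^ (4 * e + 1) * C ε) * f (some i) - X (some i) * f none) := by
          rw [hfs, hfn]
          linear_combination (X none ^ (4 * e + 1) * (rename some (p i) - X none * X (some i))) * hC
        rw [key]
        refine add_mem (Ideal.mem_sup_left (add_mem (Ideal.mul_mem_left _ _
          (add_mem (homog_xI (hp i) (by omega)) (Ideal.mul_mem_left _ _ (hX2 i _ (by omega)))))
          (Ideal.mul_mem_left _ _ (Ideal.sum_mem _ ?_)))) (Ideal.mem_sup_right
          (sub_mem (Ideal.mul_mem_left _ _ h1) (Ideal.mul_mem_left _ _ h0)))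
        rintro (_ | k) hk
        · simp at hk
        · exact hX2 k 2 le_rfl)
    hfn
  refine ⟨fun i => z (some i), ?_, ?_, z none, ?_⟩
  · intro h
    cases i0 with
    | none => exact hi0 rfl
    | some i => exact hz0 (congrFun h i)
  · have := hz none
    rw [hfn] at this
    simp only [map_sub, map_add, map_pow, eval_X, map_sum, map_one] at this
    have h2 : ∑ i ∈ Finset.univ.erase none, z i ^ 2 = ∑ i, z (some i) ^ 2 := by
      have h3 := Finset.add_sum_erase Finset.univ (fun i => z i ^ 2) (Finset.mem_univ none)
      rw [Fintype.sum_option] at h3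
      linarith
    have h4 : 0 ≤ z none ^ (4 * e + 2) := Even.pow_nonneg ⟨2 * e + 1, by omega⟩ _
    rw [h2] at this
    linarith
  · intro i
    have := hz (some i)
    rw [hfs] at this
    simp only [map_sub, map_add, map_pow, map_mul, eval_X, eval_C, eval_rename] at this
    have h2 : (z ∘ some) = fun i => z (some i) := rfl
    rw [h2] at this
    field_simp at this
    linarith

end KC

namespace KC

theorem cara {E : Type*} [AddCommGroup E] [Module ℝ E] [FiniteDimensional ℝ E]
    (V : Submodule ℝ E) (Z : Set E) (hZ : Z ⊆ V) (k : ℕ) (hk : Module.finrank ℝ V ≤ k)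
    (x : E) (hx : x ∈ convexHull ℝ Z) :
    ∃ (t : Fin (k + 1) → ℝ) (z : Fin (k + 1) → E),
      (∀ i, 0 ≤ t i) ∧ (∀ i, z i ∈ Z) ∧ ∑ i, t i = 1 ∧ ∑ i, t i • z i = x := by
  classical
  obtain ⟨ι, _, z, w, hz, hind, hw, hw1, hwx⟩ := eq_pos_convex_span_of_mem_convexHull hx
  have hne : Nonempty ι := by
    by_contra h
    rw [not_nonempty_iff] at h
    simp at hw1
  obtain ⟨i0⟩ := hne
  have hcard : Fintype.card ι ≤ k + 1 := by
    have h1 := hind.card_le_finrank_succ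
    have h2 : vectorSpan ℝ (Set.range z) ≤ V := by
      rw [vectorSpan_def, Submodule.span_le]
      rintro _ ⟨a, ha, b, hb, rfl⟩
      exact V.sub_mem (hZ (hz ha)) (hZ (hz hb))
    have h3 := Submodule.finrank_mono h2
    omega
  obtain ⟨e⟩ : Nonempty (ι ↪ Fin (k + 1)) :=
    Function.Embedding.nonempty_of_card_le (by simpa using hcard)
  refine ⟨Function.extend e w 0, Function.extend e z (fun _ => z i0), ?_, ?_, ?_, ?_⟩
  · intro i
    by_cases h : ∃ a, e a = i
    · obtain ⟨a, rfl⟩ := h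
      rw [e.injective.extend_apply]
      exact (hw a).le
    · rw [Function.extend_apply' _ _ _ h]
      simp
  · intro i
    by_cases h : ∃ a, e a = i
    · obtain ⟨a, rfl⟩ := h
      rw [e.injective.extend_apply]
      exact hz ⟨a, rfl⟩
    · rw [Function.extend_apply' _ _ _ h]
      exact hz ⟨i0, rfl⟩
  · rw [← hw1]
    symm
    apply Fintype.sum_of_injective e e.injective
    · intro i hi
      rw [Function.extend_apply' _ _ _ (by simpa using hi)]
      simp
    · intro i
      rw [e.injective.extend_apply]
  · rw [← hwx]
    symm
    apply Fintype.sum_of_injective e e.injective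
    · intro i hi
      rw [Function.extend_apply' _ _ _ (by simpa using hi)]
      simp
    · intro i
      rw [e.injective.extend_apply, e.injective.extend_apply]

theorem compact_hull {N : ℕ} (Z : Set (Fin N → ℝ)) (hZ : IsCompact Z) :
    IsCompact (convexHull ℝ Z) := by
  have hc : IsCompact ((stdSimplex ℝ (Fin (N + 1))) ×ˢ
      (Set.univ.pi (fun _ : Fin (N + 1) => Z))) :=
    (isCompact_stdSimplex ℝ _).prod (isCompact_univ_pi fun _ => hZ)
  have hcont : Continuous (fun q : (Fin (N + 1) → ℝ) × (Fin (N + 1) → (Fin N → ℝ)) =>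
      ∑ i, q.1 i • q.2 i) := by fun_prop
  have := hc.image hcont
  convert this using 1
  ext x
  constructor
  · intro hx
    obtain ⟨t, z, h0, hz, h1, hs⟩ := cara ⊤ Z (by simp) N (by simp) x hx
    exact ⟨(t, z), ⟨⟨h0, h1⟩, fun i _ => hz i⟩, hs⟩
  · rintro ⟨⟨t, z⟩, ⟨⟨h0, h1⟩, hz⟩, rfl⟩
    exact (convex_convexHull ℝ Z).sum_mem (fun i _ => h0 i) h1
      (fun i _ => subset_convexHull ℝ Z (hz i (Set.mem_univ i)))

theorem sep {N : ℕ} (Z : Set (Fin N → ℝ)) (hZ : IsCompact Z) (h0 : (0 : Fin N → ℝ) ∉ convexHull ℝ Z) :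
    ∃ w : Fin N → ℝ, ∀ y ∈ Z, 0 < ∑ i, w i * y i := by
  obtain ⟨f, a, ha, hb⟩ := geometric_hahn_banach_point_closed (convex_convexHull ℝ Z)
    (compact_hull Z hZ).isClosed h0
  refine ⟨fun i => f (Pi.single i 1), fun y hy => ?_⟩
  have h1 := hb y (subset_convexHull ℝ Z hy)
  rw [map_zero] at ha
  have h2 : f y = ∑ i, f (Pi.single i 1) * y i := by
    conv_lhs => rw [pi_eq_sum_univ' y]
    rw [map_sum]
    refine Finset.sum_congr rfl fun i _ => ?_
    rw [map_smul, smul_eq_mul, mul_comm]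
  rw [← h2]; linarith

/-- the sphere -/
def Sph (N : ℕ) : Set (Fin N → ℝ) := {u | ∑ i, u i ^ 2 = 1}

theorem Sph_compact (N : ℕ) : IsCompact (Sph N) := by
  apply Metric.isCompact_of_isClosed_isBounded
  · exact isClosed_eq (by fun_prop) continuous_const
  · refine (Metric.isBounded_closedBall (x := (0 : Fin N → ℝ)) (r := 1)).subset ?_
    intro u hu
    rw [mem_closedBall_zero_iff, pi_norm_le_iff_of_nonneg zero_le_one]
    intro i
    have h1 : u i ^ 2 ≤ ∑ i, u i ^ 2 :=
      Finset.single_le_sum (f := fun i => u i ^ 2) (fun i _ => sq_nonneg _) (Finset.mem_univ i)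
    have h2 : ∑ i, u i ^ 2 = 1 := hu
    rw [Real.norm_eq_abs]
    exact abs_le_one_iff_mul_self_le_one.2 (by nlinarith)

theorem Sph_ne {N : ℕ} {u : Fin N → ℝ} (hu : u ∈ Sph N) : u ≠ 0 := by
  rintro rfl
  have h2 : ∑ i, (0 : Fin N → ℝ) i ^ 2 = 1 := hu
  simp at h2

theorem Sph_cont {N : ℕ} (i : Fin N) : Continuous (fun u : Sph N => u.1 i) :=
  (continuous_apply i).comp continuous_subtype_val

theorem Sph_cont2 {N : ℕ} :
    Continuous (fun z : Sph N × (Fin N → ℝ) => ∑ i, z.1.1 i * z.2 i) :=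
  continuous_finsetSum _ fun i _ => ((Sph_cont i).comp continuous_fst).mul (by fun_prop)

theorem exists_g {N : ℕ} (Y : Set (Fin N → ℝ)) (hY : IsCompact Y)
    (h2 : ∀ u : Fin N → ℝ, u ≠ 0 → (0 : Fin N → ℝ) ∉ convexHull ℝ {y | y ∈ Y ∧ ∑ i, u i * y i = 0}) :
    ∃ g : C(Sph N, Fin N → ℝ), ∀ u : Sph N, ∀ y ∈ Y, ∑ i, u.1 i * y i = 0 → 0 < ∑ i, g u i * y i := by
  have := exists_continuous_forall_mem_convex_of_local_const (X := Sph N) (E := Fin N → ℝ)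
    (t := fun u => {w | ∀ y ∈ Y, ∑ i, u.1 i * y i = 0 → 0 < ∑ i, w i * y i}) ?_ ?_
  · exact this
  · intro u w hw w' hw' a b ha hb hab y hy huy
    have e1 := hw y hy huy
    have e2 := hw' y hy huy
    have : ∑ i, (a • w + b • w') i * y i = a * ∑ i, w i * y i + b * ∑ i, w' i * y i := by
      rw [Finset.mul_sum, Finset.mul_sum, ← Finset.sum_add_distrib]
      refine Finset.sum_congr rfl fun i _ => ?_
      simp only [Pi.add_apply, Pi.smul_apply, smul_eq_mul]; ring
    rw [this]
    rcases ha.eq_or_lt with rfl | ha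
    · have : b = 1 := by linarith
      subst this; linarith
    · have := mul_pos ha e1
      have := mul_nonneg hb e2.le
      linarith
  · intro u
    have hc : IsCompact {y | y ∈ Y ∧ ∑ i, u.1 i * y i = 0} :=
      hY.inter_right (isClosed_eq (f := fun y : Fin N → ℝ => ∑ i, u.1 i * y i)
        (by fun_prop) continuous_const)
    obtain ⟨w, hw⟩ := sep _ hc (h2 u.1 (Sph_ne u.2))
    refine ⟨w, ?_⟩
    have hK : IsCompact {y | y ∈ Y ∧ ∑ i, w i * y i ≤ 0} :=
      hY.inter_right (isClosed_le (f := fun y : Fin N → ℝ => ∑ i, w i * y i) (by fun_prop) continuous_const)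
    have := hK.eventually_forall_of_forall_eventually (x₀ := u)
      (P := fun (v : Sph N) y => ∑ i, v.1 i * y i ≠ 0) ?_
    · filter_upwards [this] with v hv y hy hvy
      by_contra hcon
      exact hv y ⟨hy, not_lt.1 hcon⟩ hvy
    · rintro y ⟨hy, hwy⟩
      have hne : ∑ i, u.1 i * y i ≠ 0 := fun h => absurd (hw y ⟨hy, h⟩) (not_lt.2 hwy)
      have hcont : Continuous (fun z : Sph N × (Fin N → ℝ) => ∑ i, z.1.1 i * z.2 i) := Sph_cont2
      exact hcont.continuousAt.eventually_ne hne

end KC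

namespace KC
open MvPolynomial

theorem homog_smul {N d : ℕ} {p : MvPolynomial (Fin N) ℝ} (h : p.IsHomogeneous d)
    (r : ℝ) (u : Fin N → ℝ) : eval (fun i => r * u i) p = r ^ d * eval u p := by
  rw [eval_eq', eval_eq', Finset.mul_sum]
  refine Finset.sum_congr rfl fun s hs => ?_
  have h1 := homog_degree h (mem_support_iff.1 hs)
  rw [Finsupp.degree_eq_sum] at h1
  simp only [mul_pow]
  rw [Finset.prod_mul_distrib, Finset.prod_pow_eq_pow_sum, h1]
  ring

theorem evenize {N e : ℕ} (q : MvPolynomial (Fin N) ℝ) (hq : q.totalDegree ≤ 4 * e) :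
    ∃ p : MvPolynomial (Fin N) ℝ, p.IsHomogeneous (4 * e) ∧
      ∀ u ∈ Sph N, eval u p = (eval u q + eval (fun i => - u i) q) / 2 := by
  classical
  refine ⟨∑ s ∈ q.support, if Even s.degree then
    monomial s (coeff s q) * (∑ i, X i ^ 2) ^ ((4 * e - s.degree) / 2) else 0, ?_, ?_⟩
  · apply IsHomogeneous.sum
    intro s hs
    split_ifs with hev
    · have h1 : s.degree ≤ 4 * e := (le_totalDegree hs).trans hq
      have h2 : (∑ i : Fin N, (X i : MvPolynomial (Fin N) ℝ) ^ 2).IsHomogeneous 2 :=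
        IsHomogeneous.sum _ _ _ fun i _ => isHomogeneous_X_pow i 2
      have h3 := (isHomogeneous_monomial (coeff s q) (rfl : s.degree = s.degree)).mul
        (h2.pow ((4 * e - s.degree) / 2))
      convert h3 using 1
      obtain ⟨a, ha⟩ := hev
      omega
    · exact isHomogeneous_zero _ _ _
  · intro u hu
    have hu : ∑ i, u i ^ 2 = 1 := hu
    rw [map_sum, eval_eq' u q, eval_eq' _ q, ← Finset.sum_add_distrib, Finset.sum_div]
    refine Finset.sum_congr rfl fun s hs => ?_
    have h4 : ∏ i, (-u i) ^ s i = (-1) ^ s.degree * ∏ i, u i ^ s i := by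
      rw [Finsupp.degree_eq_sum, ← Finset.prod_pow_eq_pow_sum, ← Finset.prod_mul_distrib]
      refine Finset.prod_congr rfl fun i _ => ?_
      rw [neg_pow]
    rw [h4]
    split_ifs with hev
    · rw [hev.neg_one_pow, map_mul, map_pow, map_sum]
      simp only [map_pow, eval_X, hu, one_pow, eval_monomial]
      rw [Finsupp.prod_fintype _ _ (by simp)]
      ring
    · rw [(Nat.not_even_iff_odd.1 hev).neg_one_pow, map_zero]
      ring

theorem sw {N : ℕ} (f : C(Sph N, ℝ)) (δ : ℝ) (hδ : 0 < δ) :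
    ∃ q : MvPolynomial (Fin N) ℝ, ∀ u : Sph N, |eval u.1 q - f u| < δ := by
  have : CompactSpace (Sph N) := isCompact_iff_compactSpace.1 (Sph_compact N)
  let co : Fin N → C(Sph N, ℝ) := fun i => ⟨fun u => u.1 i, Sph_cont i⟩
  let φ : MvPolynomial (Fin N) ℝ →ₐ[ℝ] C(Sph N, ℝ) := aeval co
  have hφ : ∀ q u, φ q u = eval u.1 q := by
    intro q u
    induction q using MvPolynomial.induction_on with
    | C a => simp [φ]
    | add p q hp hq => simp [map_add, hp, hq]
    | mul_X p i hp => simp [map_mul, hp, φ, co]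
  have hsep : (φ.range).SeparatesPoints := by
    intro u v huv
    have : u.1 ≠ v.1 := fun h => huv (Subtype.ext h)
    obtain ⟨i, hi⟩ := Function.ne_iff.1 this
    exact ⟨co i, ⟨co i, ⟨X i, by simp [φ]⟩, rfl⟩, hi⟩
  obtain ⟨⟨g, q, rfl⟩, hg⟩ :=
    ContinuousMap.exists_mem_subalgebra_near_continuous_of_separatesPoints φ.range hsep f f.continuous δ hδ
  refine ⟨q, fun u => ?_⟩
  have := hg u
  rw [Real.norm_eq_abs] at this
  rw [← hφ]
  exact this

theorem sum_close {N : ℕ} (a b y : Fin N → ℝ) (δ M : ℝ) (hδ : 0 ≤ δ) (hy : ∑ i, |y i| ≤ M)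
    (hab : ∀ i, |a i - b i| ≤ δ) : ∑ i, b i * y i - δ * M ≤ ∑ i, a i * y i := by
  have h : ∑ i, (b i * y i - a i * y i) ≤ ∑ i, δ * |y i| := by
    refine Finset.sum_le_sum fun i _ => ?_
    calc b i * y i - a i * y i = -((a i - b i) * y i) := by ring
      _ ≤ |(a i - b i) * y i| := neg_le_abs _
      _ = |a i - b i| * |y i| := abs_mul _ _
      _ ≤ δ * |y i| := mul_le_mul_of_nonneg_right (hab i) (abs_nonneg _)
  rw [← Finset.mul_sum, Finset.sum_sub_distrib] at h
  have := mul_le_mul_of_nonneg_left hy hδ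
  linarith

theorem topo {N : ℕ} (hN : 1 ≤ N) (Y : Set (Fin N → ℝ)) (hY : IsCompact Y)
    (h1 : ∀ u : Fin N → ℝ, u ≠ 0 → ∃ y ∈ Y, ∑ i, u i * y i = 0)
    (h2 : ∀ u : Fin N → ℝ, u ≠ 0 →
      (0 : Fin N → ℝ) ∉ convexHull ℝ {y | y ∈ Y ∧ ∑ i, u i * y i = 0}) : False := by
  obtain ⟨g, hg⟩ := exists_g Y hY h2
  have hS : CompactSpace (Sph N) := isCompact_iff_compactSpace.1 (Sph_compact N)
  -- lower bound
  obtain ⟨c, hc, hgc⟩ : ∃ c : ℝ, 0 < c ∧ ∀ u : Sph N, ∀ y ∈ Y, ∑ i, u.1 i * y i = 0 →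
      c ≤ ∑ i, g u i * y i := by
    have hK : IsCompact {z : Sph N × (Fin N → ℝ) | z ∈ (Set.univ ×ˢ Y : Set _) ∧
        ∑ i, z.1.1 i * z.2 i = 0} :=
      (isCompact_univ.prod hY).inter_right
        (isClosed_eq (f := fun z : Sph N × (Fin N → ℝ) => ∑ i, z.1.1 i * z.2 i)
          Sph_cont2 continuous_const)
    obtain ⟨c, hc, h⟩ := hK.exists_forall_le' (a := (0 : ℝ))
      (f := fun z : Sph N × (Fin N → ℝ) => ∑ i, g z.1 i * z.2 i)
      (Continuous.continuousOn (by fun_prop)) (by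
        rintro ⟨u, y⟩ ⟨⟨-, hy⟩, huy⟩
        exact hg u y hy huy)
    exact ⟨c, hc, fun u y hy huy => h (u, y) ⟨⟨Set.mem_univ _, hy⟩, huy⟩⟩
  obtain ⟨M, hM, hYM⟩ : ∃ M : ℝ, 0 < M ∧ ∀ y ∈ Y, ∑ i, |y i| ≤ M := by
    obtain ⟨M, hM⟩ := (hY.image (f := fun y : Fin N → ℝ => ∑ i, |y i|) (by fun_prop)).bddAbove
    refine ⟨max M 1, by positivity, fun y hy => le_max_of_le_left (hM ⟨y, hy, rfl⟩)⟩
  have hδ : 0 < c / (2 * M) := by positivity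
  have hq := fun i => sw (N := N) ⟨fun u => g u i, by fun_prop⟩ (c / (2 * M)) hδ
  choose q hq using hq
  simp only [ContinuousMap.coe_mk] at hq
  obtain ⟨e, he, hqe⟩ : ∃ e : ℕ, 1 ≤ e ∧ ∀ i, (q i).totalDegree ≤ 4 * e := by
    refine ⟨∑ i, (q i).totalDegree + 1, by omega, fun i => ?_⟩
    have := Finset.single_le_sum (f := fun i => (q i).totalDegree) (fun i _ => Nat.zero_le _)
      (Finset.mem_univ i)
    omega
  choose p hp hpe using fun i => evenize (q i) (hqe i)
  obtain ⟨x, hx0, hx1, l, hl⟩ := alg1 hN e he p hp (c / (4 * M)) (by positivity)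
  have hr2 : 0 < ∑ i, x i ^ 2 := by
    obtain ⟨i, hi⟩ := Function.ne_iff.1 hx0
    have h3 : x i ^ 2 ≤ ∑ i, x i ^ 2 :=
      Finset.single_le_sum (f := fun i => x i ^ 2) (fun i _ => sq_nonneg _) (Finset.mem_univ i)
    have : 0 < x i ^ 2 := by
      have : x i ≠ 0 := hi
      positivity
    linarith
  obtain ⟨r, hr, hrr⟩ : ∃ r : ℝ, 0 < r ∧ r ^ 2 = ∑ i, x i ^ 2 :=
    ⟨√(∑ i, x i ^ 2), Real.sqrt_pos.2 hr2, Real.sq_sqrt hr2.le⟩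
  have hr1 : r ≤ 1 := by nlinarith
  let u : Fin N → ℝ := fun i => x i / r
  have hxu : x = fun i => r * u i := by
    funext i; simp only [u]; field_simp
  have huS : u ∈ Sph N := by
    change ∑ i, (x i / r) ^ 2 = 1
    simp only [div_pow]
    rw [← Finset.sum_div, ← hrr]
    field_simp
  have hnS : (fun i => - u i) ∈ Sph N := by
    change ∑ i, (-u i) ^ 2 = 1
    simp only [neg_sq]
    exact huS
  obtain ⟨y, hy, huy⟩ := h1 u (Sph_ne huS)
  have hp1 : c / 2 ≤ ∑ i, eval u (p i) * y i := by
    have e1 := hgc ⟨u, huS⟩ y hy huy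
    have e2 := hgc ⟨fun i => - u i, hnS⟩ y hy (by
      simp only [neg_mul, Finset.sum_neg_distrib, huy, neg_zero])
    have e3 := sum_close (fun i => eval u (p i))
      (fun i => (g ⟨u, huS⟩ i + g ⟨fun i => - u i, hnS⟩ i) / 2) y (c / (2 * M)) M hδ.le (hYM y hy) (by
        intro i
        have f1 := abs_lt.1 (hq i ⟨u, huS⟩)
        have f2 := abs_lt.1 (hq i ⟨fun i => - u i, hnS⟩)
        simp only [hpe i u huS]
        rw [abs_le]
        constructor <;> linarith [f1.1, f1.2, f2.1, f2.2])
    have e4 : ∑ i, (g ⟨u, huS⟩ i + g ⟨fun i => - u i, hnS⟩ i) / 2 * y i =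
        (∑ i, g ⟨u, huS⟩ i * y i + ∑ i, g ⟨fun i => - u i, hnS⟩ i * y i) / 2 := by
      rw [← Finset.sum_add_distrib, Finset.sum_div]
      exact Finset.sum_congr rfl fun i _ => by ring
    have e5 : c / (2 * M) * M = c / 2 := by field_simp
    rw [e4, e5] at e3
    linarith
  have hxi : ∀ i, |x i| ^ (4 * e + 2) ≤ r ^ (4 * e) := by
    intro i
    have h3 : x i ^ 2 ≤ ∑ i, x i ^ 2 :=
      Finset.single_le_sum (f := fun i => x i ^ 2) (fun i _ => sq_nonneg _) (Finset.mem_univ i)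
    have h4 : |x i| ≤ r := abs_le_of_sq_le_sq (by rw [hrr]; exact h3) hr.le
    calc |x i| ^ (4 * e + 2) ≤ r ^ (4 * e + 2) := pow_le_pow_left₀ (abs_nonneg _) h4 _
      _ ≤ r ^ (4 * e) := pow_le_pow_of_le_one hr.le hr1 (by omega)
  have hz : 0 = r ^ (4 * e) * ∑ i, eval u (p i) * y i
      + c / (4 * M) * ∑ i, x i ^ (4 * e + 2) * y i := by
    have : ∑ i, (l * x i) * y i = 0 := by
      have : ∑ i, (l * x i) * y i = l * r * ∑ i, u i * y i := by
        rw [Finset.mul_sum]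
        refine Finset.sum_congr rfl fun i _ => ?_
        have := congrFun hxu i
        rw [this]; ring
      rw [this, huy, mul_zero]
    rw [← this, Finset.mul_sum, Finset.mul_sum, ← Finset.sum_add_distrib]
    refine Finset.sum_congr rfl fun i _ => ?_
    have h5 : eval x (p i) = r ^ (4 * e) * eval u (p i) := by
      rw [← homog_smul (hp i), ← hxu]
    rw [hl i, h5]; ring
  have hrp : 0 < r ^ (4 * e) := by positivity
  have h6 := sum_close (fun i => x i ^ (4 * e + 2)) 0 y (r ^ (4 * e)) M hrp.le (hYM y hy) (by
    intro i
    simp only [Pi.zero_apply, sub_zero, abs_pow]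
    exact hxi i)
  simp only [Pi.zero_apply, zero_mul, Finset.sum_const_zero, zero_sub] at h6
  have h7 : c / (4 * M) * (-(r ^ (4 * e) * M)) ≤ c / (4 * M) * ∑ i, x i ^ (4 * e + 2) * y i :=
    mul_le_mul_of_nonneg_left h6 (by positivity)
  have h8 : c / (4 * M) * (-(r ^ (4 * e) * M)) = - (r ^ (4 * e) * (c / 4)) := by field_simp
  have h9 := mul_le_mul_of_nonneg_left hp1 hrp.le
  have h10 := mul_pos hrp hc
  nlinarith

end KC

theorem k_convex_caratheodory {n k : ℕ} (hk : k ≤ n)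
    (X : Set (EuclideanSpace ℝ (Fin n))) (hX : IsCompact X)
    (hconv : ∀ f : EuclideanSpace ℝ (Fin n) →ₗ[ℝ] EuclideanSpace ℝ (Fin (n - k)),
      Convex ℝ (f '' X)) :
    convComb (k + 1) X = convexHull ℝ X := by
  apply Set.Subset.antisymm
  · rintro p ⟨t, x, h0, hx, h1, rfl⟩
    exact (convex_convexHull ℝ X).sum_mem (fun i _ => h0 i) h1
      (fun i _ => subset_convexHull ℝ X (hx i))
  intro p hp
  rcases hk.eq_or_lt with rfl | hkn
  · obtain ⟨t, z, h0, hz, h1, hs⟩ := KC.cara ⊤ X (by simp) k (by simp) p hp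
    exact ⟨t, z, h0, hz, h1, hs⟩
  by_contra hnot
  let J : (Fin (k + 1) → ℝ) →ₗ[ℝ] EuclideanSpace ℝ (Fin n) :=
    { toFun := fun y => WithLp.toLp 2 (fun j => if h : j.1 < k + 1 then y ⟨j.1, h⟩ else 0)
      map_add' := by
        intro a b
        ext j
        by_cases h : j.1 < k + 1
        · simp only [PiLp.add_apply, dif_pos h, Pi.add_apply]
        · simp only [PiLp.add_apply, dif_neg h, add_zero]
      map_smul' := by
        intro a b
        ext j
        by_cases h : j.1 < k + 1
        · simp only [PiLp.smul_apply, dif_pos h, Pi.smul_apply, RingHom.id_apply]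
        · simp only [PiLp.smul_apply, dif_neg h, smul_zero] }
  have hJa : ∀ y j, J y j = if h : j.1 < k + 1 then y ⟨j.1, h⟩ else 0 := fun y j => rfl
  have hJc : Continuous J := J.continuous_of_finiteDimensional
  let inj : Fin (k + 1) → Fin n := fun j => ⟨j.1, by omega⟩
  let R : EuclideanSpace ℝ (Fin n) → (Fin (k + 1) → ℝ) := fun x j => (x - p) (inj j)
  have hRc : Continuous R := by fun_prop
  have hRJ : ∀ y, R (p + J y) = y := by
    intro y
    funext j
    have : (p + J y - p) (inj j) = J y (inj j) := by simp
    change (p + J y - p) (inj j) = y j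
    rw [this, hJa, dif_pos j.2]
  let Y : Set (Fin (k + 1) → ℝ) := {y | p + J y ∈ X}
  have hY : IsCompact Y := by
    have hcl : IsClosed Y := hX.isClosed.preimage (by fun_prop)
    refine (hX.image hRc).of_isClosed_subset hcl ?_
    intro y hy
    exact ⟨p + J y, hy, hRJ y⟩
  refine KC.topo (by omega : 1 ≤ k + 1) Y hY ?_ ?_
  · intro u hu
    let f : EuclideanSpace ℝ (Fin n) →ₗ[ℝ] EuclideanSpace ℝ (Fin (n - k)) :=
      { toFun := fun x => WithLp.toLp 2 (fun i => if i.1 = 0 then ∑ j, u j * x (inj j)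
          else x ⟨k + i.1, by omega⟩)
        map_add' := by
          intro a b
          ext i
          by_cases h : i.1 = 0 <;> simp [h, mul_add, Finset.sum_add_distrib]
        map_smul' := by
          intro a b
          ext i
          by_cases h : i.1 = 0
          · simp only [h, if_true, PiLp.smul_apply, smul_eq_mul, RingHom.id_apply,
              Finset.mul_sum]
            exact Finset.sum_congr rfl fun j _ => by ring
          · simp [h] }
    have hfa : ∀ x i, f x i = if i.1 = 0 then ∑ j, u j * x (inj j)
          else x ⟨k + i.1, by omega⟩ := fun x i => rfl
    have hfp : f p ∈ f '' X := by
      rw [← (hconv f).convexHull_eq, ← LinearMap.image_convexHull]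
      exact ⟨p, hp, rfl⟩
    obtain ⟨x, hx, hxp⟩ := hfp
    refine ⟨R x, ?_, ?_⟩
    · change p + J (R x) ∈ X
      convert hx using 1
      ext j
      have e1 : (p + J (R x)) j = p j + J (R x) j := rfl
      rw [e1, hJa]
      by_cases h : j.1 < k + 1
      · rw [dif_pos h]
        change p j + (x j - p j) = x j
        ring
      · rw [dif_neg h]
        have e2 := congrArg (fun v : EuclideanSpace ℝ (Fin (n - k)) =>
          v ⟨j.1 - k, by omega⟩) hxp
        simp only [hfa] at e2
        rw [if_neg (by omega), if_neg (by omega)] at e2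
        have e3 : (⟨k + (j.1 - k), by omega⟩ : Fin n) = j := Fin.ext (by simp; omega)
        rw [e3] at e2
        rw [e2, add_zero]
    · have e2 := congrArg (fun v : EuclideanSpace ℝ (Fin (n - k)) =>
          v ⟨0, by omega⟩) hxp
      simp only [hfa, if_true] at e2
      change ∑ i, u i * (x (inj i) - p (inj i)) = 0
      simp only [mul_sub, Finset.sum_sub_distrib]
      rw [e2, sub_self]
  · intro u hu h0
    let φ : Module.Dual ℝ (Fin (k + 1) → ℝ) := ∑ i, u i • LinearMap.proj i
    have hφ : ∀ y, φ y = ∑ i, u i * y i := by intro y; simp [φ]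
    have hφ0 : φ ≠ 0 := by
      intro h
      apply hu
      funext i
      have := hφ (Pi.single i 1)
      rw [h] at this
      simpa [Pi.single_apply] using this.symm
    have hfr := Module.Dual.finrank_ker_add_one_of_ne_zero hφ0
    rw [Module.finrank_fin_fun] at hfr
    obtain ⟨t, z, ht, hz, h1, hs⟩ := KC.cara (LinearMap.ker φ) _
      (by rintro y ⟨-, hy⟩; rw [SetLike.mem_coe, LinearMap.mem_ker, hφ, hy]) k (by omega) _ h0
    apply hnot
    refine ⟨t, fun i => p + J (z i), ht, fun i => (hz i).1, h1, ?_⟩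
    simp only [smul_add, Finset.sum_add_distrib]
    rw [← Finset.sum_smul, h1, one_smul]
    simp only [← map_smul]
    rw [← map_sum, hs, map_zero, add_zero]
end
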